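/- arXiv:1309.6414 — 4 statements merged into one kernel-verified Lean document; each statement's English description precedes it below -/
import Mathlib

section
/- Let d ≥ 1, α ∈ (0,2) and A(d,−α) := α 2^{α−1} π^{−d/2} Γ((d+α)/2) / Γ(1−α/2). Then for every ξ ∈ ℝ^d, ∫_{ℝ^d} (e^{i ξ·z} − 1 − i ξ·z 1_{{|z|≤1}}) A(d,−α) |z|^{−(d+α)} dz = −|ξ|^α, the integral being absolutely convergent. -/
open MeasureTheory Filter Topology
open scoped ENNReal RealInnerProductSpace

/-- The normalizing constant `A(d,-α) = α 2^{α-1} π^{-d/2} Γ((d+α)/2) / Γ(1-α/2)`. -/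
noncomputable def stableConst (d : ℕ) (α : ℝ) : ℝ :=
  α * 2 ^ (α - 1) * Real.pi ^ (-(d : ℝ) / 2) * Real.Gamma (((d : ℝ) + α) / 2) /
    Real.Gamma (1 - α / 2)


lemma stable_A {β s : ℝ} (hβ1 : β < 1) (hs : 0 < s) :
    ∫⁻ t in Set.Ioi (0:ℝ), ENNReal.ofReal (t ^ (β - 2) * Real.exp (-(s / t))) =
      ENNReal.ofReal (Real.Gamma (1 - β) * s ^ (β - 1)) := by
  have h1 := Real.integral_rpow_mul_exp_neg_mul_Ioi (a := 1 - β) (r := s) (by linarith) hs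
  have h2 := integral_comp_rpow_Ioi (fun u : ℝ => u ^ (1 - β - 1) * Real.exp (-(s * u)))
    (p := -1) (by norm_num)
  rw [h1] at h2
  have h3 : ∫ t in Set.Ioi (0:ℝ), t ^ (β - 2) * Real.exp (-(s / t)) =
      Real.Gamma (1 - β) * s ^ (β - 1) := by
    have e : Real.Gamma (1 - β) * s ^ (β - 1) = (1 / s) ^ (1 - β) * Real.Gamma (1 - β) := by
      rw [one_div, Real.inv_rpow hs.le, ← Real.rpow_neg hs.le, mul_comm]
      congr 2; ring
    rw [e, ← h2]
    refine setIntegral_congr_fun measurableSet_Ioi fun t ht => ?_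
    have ht : 0 < t := ht
    simp only [smul_eq_mul, abs_neg, abs_one, one_mul]
    rw [← mul_assoc, ← Real.rpow_mul ht.le, ← Real.rpow_add ht, Real.rpow_neg_one, div_eq_mul_inv]
    congr 2; ring
  have hpos : 0 < Real.Gamma (1 - β) * s ^ (β - 1) :=
    mul_pos (Real.Gamma_pos_of_pos (by linarith)) (Real.rpow_pos_of_pos hs _)
  rw [← h3, ofReal_integral_eq_lintegral_ofReal]
  · exact Integrable.of_integral_ne_zero (by rw [h3]; exact hpos.ne')
  · refine (ae_restrict_iff' measurableSet_Ioi).2 (ae_of_all _ fun t ht => ?_)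
    have ht : 0 < t := ht
    exact mul_nonneg (Real.rpow_nonneg ht.le _) (Real.exp_nonneg _)

lemma stable_B {β c : ℝ} (hβ0 : 0 < β) (hβ1 : β < 1) (hc : 0 ≤ c) :
    ∫⁻ t in Set.Ioi (0:ℝ), ENNReal.ofReal (t ^ (β - 1) * (1 - Real.exp (-(c / t)))) =
      ENNReal.ofReal (Real.Gamma (1 - β) * (c ^ β / β)) := by
  have h1 : ∀ t ∈ Set.Ioi (0:ℝ), ENNReal.ofReal (t ^ (β - 1) * (1 - Real.exp (-(c / t)))) =
      ∫⁻ s in Set.Ioc 0 c, ENNReal.ofReal (t ^ (β - 2) * Real.exp (-(s / t))) := by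
    intro t ht
    have ht : 0 < t := ht
    rw [← ofReal_integral_eq_lintegral_ofReal, ← intervalIntegral.integral_of_le hc]
    · congr 1
      have hd : ∀ x ∈ Set.uIcc 0 c, HasDerivAt (fun s => -t ^ (β - 1) * Real.exp (-(s / t)))
          (t ^ (β - 2) * Real.exp (-(x / t))) x := by
        intro x _
        have := ((((hasDerivAt_id x).div_const t).neg).exp).const_mul (-t ^ (β - 1))
        have e : t ^ (β - 1) = t ^ (β - 2) * t := by
          rw [← Real.rpow_add_one ht.ne']; congr 1; ring
        have e' : t ^ (β - 2) * Real.exp (-(x / t)) =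
            -t ^ (β - 1) * (Real.exp (-(x / t)) * -(1 / t)) := by
          rw [e]; field_simp
        rw [e']
        exact this
      rw [intervalIntegral.integral_eq_sub_of_hasDerivAt hd]
      · simp; ring
      · apply Continuous.intervalIntegrable; fun_prop
    · apply Continuous.integrableOn_Ioc; fun_prop
    · exact ae_of_all _ fun s => mul_nonneg (Real.rpow_nonneg ht.le _) (Real.exp_nonneg _)
  rw [setLIntegral_congr_fun measurableSet_Ioi h1, lintegral_lintegral_swap]
  · have h2 : ∀ s ∈ Set.Ioc 0 c, ∫⁻ t in Set.Ioi (0:ℝ),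
        ENNReal.ofReal (t ^ (β - 2) * Real.exp (-(s / t))) =
        ENNReal.ofReal (Real.Gamma (1 - β) * s ^ (β - 1)) := fun s hs => stable_A hβ1 hs.1
    rw [setLIntegral_congr_fun measurableSet_Ioc h2, ← ofReal_integral_eq_lintegral_ofReal,
      ← intervalIntegral.integral_of_le hc, intervalIntegral.integral_const_mul,
      integral_rpow (Or.inl (by linarith))]
    · simp [Real.zero_rpow hβ0.ne']
    · apply Integrable.const_mul
      have := (intervalIntegral.intervalIntegrable_rpow' (r := β - 1) (by linarith) (a := 0) (b := c))
      rwa [intervalIntegrable_iff_integrableOn_Ioc_of_le hc] at this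
    · refine (ae_restrict_iff' measurableSet_Ioc).2 (ae_of_all _ fun t ht => ?_)
      exact mul_nonneg (Real.Gamma_pos_of_pos (by linarith)).le (Real.rpow_nonneg ht.1.le _)
  · apply Measurable.aemeasurable
    unfold Function.uncurry
    fun_prop

lemma stable_C {d : ℕ} (ξ : EuclideanSpace ℝ (Fin d)) {t : ℝ} (ht : 0 < t) :
    ∫⁻ z : EuclideanSpace ℝ (Fin d),
      ENNReal.ofReal ((1 - Real.cos ⟪ξ, z⟫) * Real.exp (-(‖z‖ ^ 2 * t))) =
    ENNReal.ofReal ((Real.pi / t) ^ ((d : ℝ) / 2) * (1 - Real.exp (-(‖ξ‖ ^ 2 / 4 / t)))) := by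
  have ht' : 0 < (t : ℂ).re := by simpa using ht
  have i0 := GaussianFourier.integrable_cexp_neg_mul_sq_norm_add ht' 0 ξ
  have i1 := GaussianFourier.integrable_cexp_neg_mul_sq_norm_add ht' Complex.I ξ
  have v0 := GaussianFourier.integral_cexp_neg_mul_sq_norm_add ht' 0 ξ
  have v1 := GaussianFourier.integral_cexp_neg_mul_sq_norm_add ht' Complex.I ξ
  have hi := (i0.sub i1)
  have hv := integral_sub i0 i1
  rw [v0, v1] at hv
  have key : ∀ z : EuclideanSpace ℝ (Fin d),
      (1 - Real.cos ⟪ξ, z⟫) * Real.exp (-(‖z‖ ^ 2 * t)) =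
      (Complex.exp (-(t:ℂ) * ‖z‖ ^ 2 + 0 * ((⟪ξ, z⟫ : ℝ) : ℂ)) -
        Complex.exp (-(t:ℂ) * ‖z‖ ^ 2 + Complex.I * ((⟪ξ, z⟫ : ℝ) : ℂ))).re := by
    intro z
    have e1 : (-(t:ℂ) * ‖z‖ ^ 2 + 0 * ((⟪ξ, z⟫ : ℝ) : ℂ)) = ((-(‖z‖ ^ 2 * t) : ℝ) : ℂ) := by
      push_cast; ring
    have e2 : (-(t:ℂ) * ‖z‖ ^ 2 + Complex.I * ((⟪ξ, z⟫ : ℝ) : ℂ)) =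
      ((-(‖z‖ ^ 2 * t) : ℝ) : ℂ) + ((⟪ξ, z⟫ : ℝ) : ℂ) * Complex.I := by
      push_cast; ring
    rw [e1, e2, Complex.exp_add, ← Complex.ofReal_exp, Complex.sub_re, Complex.re_ofReal_mul,
      Complex.exp_ofReal_mul_I_re, Complex.ofReal_re]
    ring
  simp_rw [key]
  rw [← ofReal_integral_eq_lintegral_ofReal]
  · congr 1
    have := integral_re hi
    simp only [RCLike.re_eq_complex_re, Pi.sub_apply] at this
    rw [this, hv]
    have e3 : (Real.pi / (t:ℂ)) ^ ((Module.finrank ℝ (EuclideanSpace ℝ (Fin d)) : ℂ) / 2) =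
        (((Real.pi / t) ^ ((d : ℝ) / 2) : ℝ) : ℂ) := by
      rw [Complex.ofReal_cpow (by positivity)]
      simp
    have e4 : Complex.exp (Complex.I ^ 2 * (‖ξ‖:ℂ) ^ 2 / (4 * t)) =
        ((Real.exp (-(‖ξ‖ ^ 2 / 4 / t)) : ℝ) : ℂ) := by
      rw [Complex.ofReal_exp]; congr 1; push_cast; rw [Complex.I_sq]; field_simp
    rw [e3, e4]
    simp only [ne_eq, OfNat.ofNat_ne_zero, not_false_eq_true, zero_pow, zero_mul, zero_div,
      Complex.exp_zero, mul_one]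
    rw [← Complex.ofReal_mul, ← Complex.ofReal_sub, Complex.ofReal_re]
    ring
  · exact hi.re
  · refine ae_of_all _ fun z => ?_
    simp only [← key]
    exact mul_nonneg (by linarith [Real.cos_le_one ⟪ξ, z⟫]) (Real.exp_nonneg _)

lemma stable_A' {a r : ℝ} (ha : 0 < a) (hr : 0 < r) :
    ∫⁻ t in Set.Ioi (0:ℝ), ENNReal.ofReal (t ^ (a - 1) * Real.exp (-(r * t))) =
      ENNReal.ofReal (Real.Gamma a * r ^ (-a)) := by
  have h1 := Real.integral_rpow_mul_exp_neg_mul_Ioi ha hr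
  have e : (1 / r) ^ a * Real.Gamma a = Real.Gamma a * r ^ (-a) := by
    rw [one_div, Real.inv_rpow hr.le, ← Real.rpow_neg hr.le, mul_comm]
  rw [e] at h1
  have hpos : 0 < Real.Gamma a * r ^ (-a) :=
    mul_pos (Real.Gamma_pos_of_pos ha) (Real.rpow_pos_of_pos hr _)
  rw [← h1, ofReal_integral_eq_lintegral_ofReal]
  · exact Integrable.of_integral_ne_zero (by rw [h1]; exact hpos.ne')
  · refine (ae_restrict_iff' measurableSet_Ioi).2 (ae_of_all _ fun t ht => ?_)
    have ht : 0 < t := ht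
    exact mul_nonneg (Real.rpow_nonneg ht.le _) (Real.exp_nonneg _)

lemma stable_D {d : ℕ} (hd : 1 ≤ d) {α : ℝ} (hα1 : 0 < α) (hα2 : α < 2)
    (ξ : EuclideanSpace ℝ (Fin d)) :
    ∫⁻ z : EuclideanSpace ℝ (Fin d), ENNReal.ofReal ((1 - Real.cos ⟪ξ, z⟫) *
      (Real.Gamma (((d : ℝ) + α) / 2) * ‖z‖ ^ (-((d : ℝ) + α)))) =
    ENNReal.ofReal (Real.pi ^ ((d : ℝ) / 2) *
      (Real.Gamma (1 - α / 2) * ((‖ξ‖ ^ 2 / 4) ^ (α / 2) / (α / 2)))) := by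
  have hs : 0 < ((d : ℝ) + α) / 2 := by positivity
  have hcos : ∀ z : EuclideanSpace ℝ (Fin d), 0 ≤ 1 - Real.cos ⟪ξ, z⟫ := fun z => by
    linarith [Real.cos_le_one ⟪ξ, z⟫]
  have h1 : ∀ z : EuclideanSpace ℝ (Fin d), ENNReal.ofReal ((1 - Real.cos ⟪ξ, z⟫) *
      (Real.Gamma (((d : ℝ) + α) / 2) * ‖z‖ ^ (-((d : ℝ) + α)))) =
      ∫⁻ t in Set.Ioi (0:ℝ), ENNReal.ofReal (t ^ (((d : ℝ) + α) / 2 - 1) *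
        ((1 - Real.cos ⟪ξ, z⟫) * Real.exp (-(‖z‖ ^ 2 * t)))) := by
    intro z
    rcases eq_or_ne z 0 with rfl | hz
    · simp
    have hz' : 0 < ‖z‖ := norm_pos_iff.2 hz
    have e : ‖z‖ ^ (-((d : ℝ) + α)) = (‖z‖ ^ 2) ^ (-(((d : ℝ) + α) / 2)) := by
      rw [← Real.rpow_natCast, ← Real.rpow_mul hz'.le]; congr 1; push_cast; ring
    rw [ENNReal.ofReal_mul (hcos z), e, ← stable_A' hs (by positivity),
      ← lintegral_const_mul' _ _ ENNReal.ofReal_ne_top]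
    refine lintegral_congr fun t => ?_
    rw [← ENNReal.ofReal_mul (hcos z)]
    congr 1; ring
  simp_rw [h1]
  rw [lintegral_lintegral_swap]
  · have h2 : ∀ t ∈ Set.Ioi (0:ℝ), ∫⁻ z : EuclideanSpace ℝ (Fin d),
        ENNReal.ofReal (t ^ (((d : ℝ) + α) / 2 - 1) *
        ((1 - Real.cos ⟪ξ, z⟫) * Real.exp (-(‖z‖ ^ 2 * t)))) =
        ENNReal.ofReal (Real.pi ^ ((d : ℝ) / 2)) *
        ENNReal.ofReal (t ^ (α / 2 - 1) * (1 - Real.exp (-(‖ξ‖ ^ 2 / 4 / t)))) := by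
      intro t ht
      have ht : 0 < t := ht
      have hp : 0 ≤ t ^ (((d : ℝ) + α) / 2 - 1) := Real.rpow_nonneg ht.le _
      simp_rw [ENNReal.ofReal_mul hp]
      rw [lintegral_const_mul' _ _ ENNReal.ofReal_ne_top, stable_C ξ ht, ← ENNReal.ofReal_mul hp,
        ← ENNReal.ofReal_mul (by positivity)]
      congr 1
      have e : t ^ (((d : ℝ) + α) / 2 - 1) = t ^ (α / 2 - 1) * t ^ ((d : ℝ) / 2) := by
        rw [← Real.rpow_add ht]; congr 1; ring
      have : 0 < t ^ ((d : ℝ) / 2) := Real.rpow_pos_of_pos ht _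
      rw [e, Real.div_rpow Real.pi_pos.le ht.le]
      field_simp
    rw [setLIntegral_congr_fun measurableSet_Ioi h2, lintegral_const_mul' _ _ ENNReal.ofReal_ne_top,
      stable_B (by positivity) (by linarith) (by positivity), ← ENNReal.ofReal_mul (by positivity)]
  · apply Measurable.aemeasurable
    unfold Function.uncurry
    fun_prop

lemma stable_E {d : ℕ} (hd : 1 ≤ d) {α : ℝ} (hα1 : 0 < α) (hα2 : α < 2) :
    Integrable (fun z : EuclideanSpace ℝ (Fin d) =>
      min 1 (‖z‖ ^ 2) * ‖z‖ ^ (-((d : ℝ) + α))) volume := by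
  have : Nonempty (Fin d) := ⟨⟨0, hd⟩⟩
  have := integrable_fun_norm_addHaar (volume : Measure (EuclideanSpace ℝ (Fin d)))
    (f := fun y : ℝ => min 1 (y ^ 2) * y ^ (-((d : ℝ) + α)))
  rw [this, ← Set.Ioc_union_Ioi_eq_Ioi zero_le_one]
  have e : ∀ y : ℝ, 0 < y → y ^ (d - 1) * y ^ (-((d : ℝ) + α)) = y ^ (-1 - α) := by
    intro y hy
    rw [← Real.rpow_natCast, ← Real.rpow_add hy, Nat.cast_sub hd]; congr 1; push_cast; ring
  simp only [finrank_euclideanSpace, Fintype.card_fin, smul_eq_mul]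
  refine IntegrableOn.union ?_ ?_
  · have h := intervalIntegral.intervalIntegrable_rpow' (r := 1 - α) (by linarith) (a := 0) (b := 1)
    rw [intervalIntegrable_iff_integrableOn_Ioc_of_le zero_le_one] at h
    refine h.congr_fun (fun y hy => ?_) measurableSet_Ioc
    have : y ^ 2 ≤ 1 := pow_le_one₀ hy.1.le hy.2
    simp only
    rw [min_eq_right this, mul_left_comm, e y hy.1, ← Real.rpow_natCast, ← Real.rpow_add hy.1]
    congr 1; push_cast; ring
  · refine (integrableOn_Ioi_rpow_of_lt (a := -1 - α) (by linarith) one_pos).congr_fun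
      (fun y hy => ?_) measurableSet_Ioi
    have hy : 1 < y := hy
    have : 1 ≤ y ^ 2 := one_le_pow₀ hy.le
    simp only
    rw [min_eq_left this, one_mul, e y (by linarith)]

lemma stable_F (x : ℝ) : ‖Complex.exp (Complex.I * x) - 1 - Complex.I * x‖ ≤ 2 * x ^ 2 := by
  have hn : ‖Complex.I * (x:ℂ)‖ = |x| := by simp
  by_cases h : |x| ≤ 1
  · have := Complex.norm_exp_sub_one_sub_id_le (x := Complex.I * x) (by rwa [hn])
    rw [hn, sq_abs] at this
    nlinarith [sq_nonneg x]
  · have h1 := norm_sub_le (Complex.exp (Complex.I * x) - 1) (Complex.I * x)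
    have h2 := Real.norm_exp_I_mul_ofReal_sub_one_le (x := x)
    rw [hn] at h1
    rw [Real.norm_eq_abs] at h2
    nlinarith [sq_abs x]

/-- for `α ∈ (0,2)`,
`∫ (e^{iξ·z} - 1 - iξ·z 1_{|z|≤1}) A(d,-α) |z|^{-(d+α)} dz = -|ξ|^α`,
the integral being absolutely convergent. -/
theorem stmt1 (d : ℕ) (hd : 1 ≤ d) (α : ℝ) (hα1 : 0 < α) (hα2 : α < 2)
    (ξ : EuclideanSpace ℝ (Fin d)) :
    Integrable (fun z : EuclideanSpace ℝ (Fin d) =>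
      (Complex.exp (Complex.I * ((⟪ξ, z⟫ : ℝ) : ℂ)) - 1 -
          Complex.I * ((⟪ξ, z⟫ : ℝ) : ℂ) * (if ‖z‖ ≤ 1 then 1 else 0)) *
        ((stableConst d α * ‖z‖ ^ (-((d : ℝ) + α)) : ℝ) : ℂ)) volume ∧
    ∫ z : EuclideanSpace ℝ (Fin d),
      (Complex.exp (Complex.I * ((⟪ξ, z⟫ : ℝ) : ℂ)) - 1 -
          Complex.I * ((⟪ξ, z⟫ : ℝ) : ℂ) * (if ‖z‖ ≤ 1 then 1 else 0)) *
        ((stableConst d α * ‖z‖ ^ (-((d : ℝ) + α)) : ℝ) : ℂ)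
      = ((-(‖ξ‖ ^ α) : ℝ) : ℂ) := by
  set F : EuclideanSpace ℝ (Fin d) → ℂ := fun z =>
      (Complex.exp (Complex.I * ((⟪ξ, z⟫ : ℝ) : ℂ)) - 1 -
          Complex.I * ((⟪ξ, z⟫ : ℝ) : ℂ) * (if ‖z‖ ≤ 1 then 1 else 0)) *
        ((stableConst d α * ‖z‖ ^ (-((d : ℝ) + α)) : ℝ) : ℂ) with hF
  have hg1 : 0 < Real.Gamma (((d : ℝ) + α) / 2) := Real.Gamma_pos_of_pos (by positivity)
  have hg2 : 0 < Real.Gamma (1 - α / 2) := Real.Gamma_pos_of_pos (by linarith)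
  have hc : 0 < stableConst d α := by unfold stableConst; positivity
  have hint : Integrable F := by
    refine ((stable_E hd hα1 hα2).const_mul ((2 + 2 * ‖ξ‖ ^ 2) * stableConst d α)).mono' ?_ ?_
    · apply Measurable.aestronglyMeasurable
      have hm : Measurable (fun z : EuclideanSpace ℝ (Fin d) => if ‖z‖ ≤ 1 then (1:ℂ) else 0) :=
        Measurable.ite (measurableSet_le measurable_norm measurable_const)
          measurable_const measurable_const
      have hi : Measurable (fun z : EuclideanSpace ℝ (Fin d) => ((⟪ξ, z⟫ : ℝ) : ℂ)) := by fun_prop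
      have hk : Measurable (fun z : EuclideanSpace ℝ (Fin d) =>
        ((stableConst d α * ‖z‖ ^ (-((d : ℝ) + α)) : ℝ) : ℂ)) := by fun_prop
      exact (((Complex.measurable_exp.comp (hi.const_mul Complex.I)).sub_const 1).sub
        ((hi.const_mul Complex.I).mul hm)).mul hk
    · refine ae_of_all _ fun z => ?_
      have hk : 0 ≤ stableConst d α * ‖z‖ ^ (-((d : ℝ) + α)) :=
        mul_nonneg hc.le (Real.rpow_nonneg (norm_nonneg _) _)
      rw [hF]
      simp only
      rw [norm_mul, Complex.norm_real, Real.norm_of_nonneg hk]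
      have : ‖Complex.exp (Complex.I * ((⟪ξ, z⟫ : ℝ) : ℂ)) - 1 -
          Complex.I * ((⟪ξ, z⟫ : ℝ) : ℂ) * (if ‖z‖ ≤ 1 then 1 else 0)‖ ≤
          (2 + 2 * ‖ξ‖ ^ 2) * min 1 (‖z‖ ^ 2) := by
        split_ifs with h
        · rw [mul_one, min_eq_right (pow_le_one₀ (norm_nonneg _) h)]
          refine (stable_F _).trans ?_
          have h1 := abs_real_inner_le_norm ξ z
          have h2 : ⟪ξ, z⟫ ^ 2 ≤ (‖ξ‖ * ‖z‖) ^ 2 := by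
            rw [← sq_abs]; gcongr
          nlinarith [sq_nonneg ‖z‖]
        · have h1 : 1 ≤ ‖z‖ ^ 2 := one_le_pow₀ (not_le.1 h).le
          rw [min_eq_left h1, mul_zero, sub_zero]
          have h2 := norm_sub_le (Complex.exp (Complex.I * ((⟪ξ, z⟫ : ℝ) : ℂ))) 1
          rw [Complex.norm_exp_I_mul_ofReal, norm_one] at h2
          nlinarith [sq_nonneg ‖ξ‖]
      calc _ ≤ (2 + 2 * ‖ξ‖ ^ 2) * min 1 (‖z‖ ^ 2) *
            (stableConst d α * ‖z‖ ^ (-((d : ℝ) + α))) := mul_le_mul_of_nonneg_right this hk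
        _ = _ := by ring
  refine ⟨hint, ?_⟩
  have hneg := integral_neg_eq_self F volume
  have hadd := integral_add hint.comp_neg hint
  rw [hneg] at hadd
  set G : EuclideanSpace ℝ (Fin d) → ℝ := fun z => (1 - Real.cos ⟪ξ, z⟫) *
      (Real.Gamma (((d : ℝ) + α) / 2) * ‖z‖ ^ (-((d : ℝ) + α))) with hG
  set K : ℝ := stableConst d α / Real.Gamma (((d : ℝ) + α) / 2) with hK
  have hFG : ∀ z, F (-z) + F z = ((-2 * K * G z : ℝ) : ℂ) := by
    intro z
    have hcos : Complex.exp (Complex.I * ((⟪ξ, z⟫ : ℝ) : ℂ)) +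
        Complex.exp (Complex.I * ((-⟪ξ, z⟫ : ℝ) : ℂ)) = 2 * ((Real.cos ⟪ξ, z⟫ : ℝ) : ℂ) := by
      rw [Complex.ofReal_cos, Complex.two_cos]
      congr 2 <;> push_cast <;> ring
    have hKG : -2 * K * G z = (2 * Real.cos ⟪ξ, z⟫ - 2) *
        (stableConst d α * ‖z‖ ^ (-((d : ℝ) + α))) := by
      rw [hK, hG]; field_simp; ring
    rw [hKG, hF]
    simp only [inner_neg_right, norm_neg]
    push_cast at hcos ⊢
    rw [← hcos]
    ring
  have hGint : ∫ z, G z = Real.pi ^ ((d : ℝ) / 2) *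
      (Real.Gamma (1 - α / 2) * ((‖ξ‖ ^ 2 / 4) ^ (α / 2) / (α / 2))) := by
    rw [integral_eq_lintegral_of_nonneg_ae, stable_D hd hα1 hα2 ξ, ENNReal.toReal_ofReal (by positivity)]
    · refine ae_of_all _ fun z => ?_
      exact mul_nonneg (by linarith [Real.cos_le_one ⟪ξ, z⟫]) (by positivity)
    · apply Measurable.aestronglyMeasurable
      fun_prop
  simp_rw [hFG] at hadd
  rw [integral_complex_ofReal, integral_const_mul, hGint] at hadd
  have hval : -2 * K * (Real.pi ^ ((d : ℝ) / 2) *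
      (Real.Gamma (1 - α / 2) * ((‖ξ‖ ^ 2 / 4) ^ (α / 2) / (α / 2)))) = 2 * -(‖ξ‖ ^ α) := by
    have e1 : (‖ξ‖ ^ 2 / 4) ^ (α / 2) = ‖ξ‖ ^ α / 2 ^ α := by
      have : ‖ξ‖ ^ 2 / 4 = (‖ξ‖ / 2) ^ (2:ℝ) := by
        rw [Real.rpow_two]; ring
      rw [this, ← Real.rpow_mul (by positivity), ← Real.div_rpow (norm_nonneg _) (by norm_num)]
      congr 1; ring
    have e2 : (2:ℝ) ^ (α - 1) = 2 ^ α / 2 := by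
      rw [Real.rpow_sub_one (by norm_num)]
    have e3 : Real.pi ^ (-(d : ℝ) / 2) = (Real.pi ^ ((d : ℝ) / 2))⁻¹ := by
      rw [← Real.rpow_neg Real.pi_pos.le]; congr 1; ring
    rw [hK, stableConst, e1, e2, e3]
    have : 0 < Real.pi ^ ((d : ℝ) / 2) := Real.rpow_pos_of_pos Real.pi_pos _
    have : (0:ℝ) < 2 ^ α := by positivity
    generalize Real.Gamma (1 - α / 2) = g at hg2 ⊢
    field_simp
  rw [hval] at hadd
  have h2 : (2:ℂ) * ∫ z, F z = 2 * ((-(‖ξ‖ ^ α) : ℝ) : ℂ) := by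
    rw [two_mul, ← hadd]; push_cast; ring
  exact mul_left_cancel₀ two_ne_zero h2
end

section
/- Let d ≥ 1, α ∈ (1,2) and A(d,−α) := α 2^{α−1} π^{−d/2} Γ((d+α)/2) / Γ(1−α/2). Then for every ξ ∈ ℝ^d the function z ↦ (e^{i ξ·z} − 1 − i ξ·z)|z|^{−(d+α)} is absolutely integrable on ℝ^d and ∫_{ℝ^d} (e^{i ξ·z} − 1 − i ξ·z) A(d,−α) |z|^{−(d+α)} dz = −|ξ|^α; that is, for α ∈ (1,2) the truncation 1_{{|z|≤1}} in the compensator may be dropped. -/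
open MeasureTheory Filter Topology
open scoped ENNReal RealInnerProductSpace

lemma aux_integrableOn {g : ℝ → ℝ} (hg : Measurable g) {C a b : ℝ} (ha : -1 < a) (hb : b < -1)
    (h1 : ∀ s, 0 < s → |g s| ≤ C * s ^ a) (h2 : ∀ s, 0 < s → |g s| ≤ C * s ^ b) :
    IntegrableOn g (Set.Ioi 0) := by
  rw [← Set.Ioc_union_Ioi_eq_Ioi (zero_le_one' ℝ)]
  refine IntegrableOn.union ?_ ?_
  · have h : IntegrableOn (fun s : ℝ => C * s ^ a) (Set.Ioc 0 1) := by
      have := (intervalIntegral.intervalIntegrable_rpow' (a := 0) (b := 1) ha)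
      rw [intervalIntegrable_iff_integrableOn_Ioc_of_le zero_le_one] at this
      exact this.const_mul C
    refine Integrable.mono' h hg.aestronglyMeasurable ?_
    refine (ae_restrict_mem measurableSet_Ioc).mono fun s hs => ?_
    exact h1 s hs.1
  · have h : IntegrableOn (fun s : ℝ => C * s ^ b) (Set.Ioi 1) :=
      (integrableOn_Ioi_rpow_of_lt hb one_pos).const_mul C
    refine Integrable.mono' h hg.aestronglyMeasurable ?_
    refine (ae_restrict_mem measurableSet_Ioi).mono fun s hs => ?_
    exact h2 s (zero_lt_one.trans hs)

lemma aux_exp_bound {x : ℝ} (hx : 0 ≤ x) :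
    |Real.exp (-x) - 1| ≤ x ∧ |Real.exp (-x) - 1| ≤ 1 := by
  have h1 := Real.add_one_le_exp (-x)
  have h2 := Real.exp_pos (-x)
  have h3 : Real.exp (-x) ≤ 1 := Real.exp_le_one_iff.2 (by linarith)
  constructor <;> rw [abs_le] <;> constructor <;> linarith

/-- one-dimensional integral, `β = α / 2` -/
lemma aux_int1 {β c : ℝ} (h0 : 0 < β) (h1 : β < 1) (hc : 0 < c) :
    ∫ s in Set.Ioi (0 : ℝ), (Real.exp (-(c * s)) - 1) * s ^ (-β - 1) =
      -(c ^ β * Real.Gamma (1 - β) / β) := by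
  have key := integral_Ioi_mul_deriv_eq_deriv_mul (a := (0 : ℝ)) (a' := (0 : ℝ)) (b' := (0 : ℝ))
    (u := fun s : ℝ => Real.exp (-(c * s)) - 1)
    (u' := fun s : ℝ => Real.exp (-(c * s)) * -c)
    (v := fun s : ℝ => s ^ (-β) / (-β)) (v' := fun s : ℝ => s ^ (-β - 1)) ?_ ?_ ?_ ?_ ?_ ?_
  · rw [key]
    have h := Real.integral_rpow_mul_exp_neg_mul_Ioi (a := 1 - β) (r := c) (by linarith) hc
    have h' : ∫ s in Set.Ioi (0 : ℝ), Real.exp (-(c * s)) * -c * (s ^ (-β) / (-β)) =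
        ∫ s in Set.Ioi (0 : ℝ), (c / β) * (s ^ (1 - β - 1) * Real.exp (-(c * s))) := by
      congr 1
      ext s
      rw [show 1 - β - 1 = -β by ring]
      field_simp
    rw [h', integral_const_mul, h, one_div, Real.inv_rpow hc.le, ← Real.rpow_neg hc.le]
    have : c ^ β = c * c ^ (-(1 - β)) := by
      rw [← Real.rpow_one_add' hc.le (by linarith)]; congr 1; ring
    rw [this]; ring
  · intro x _
    have : HasDerivAt (fun s : ℝ => -(c * s)) (-c) x := by
      have h := (hasDerivAt_id x).const_mul (-c)
      simp only [id, mul_one] at h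
      simpa only [neg_mul] using h
    exact (this.exp).sub_const 1
  · intro x hx
    have := (Real.hasDerivAt_rpow_const (x := x) (p := -β) (Or.inl (ne_of_gt hx))).div_const (-β)
    convert this using 1
    field_simp
  · refine aux_integrableOn (C := c + 1) (a := -β) (b := -β - 1) ?_ (by linarith) (by linarith)
      ?_ ?_
    · apply Measurable.mul
      · fun_prop
      · exact measurable_id.pow_const _
    · intro s hs
      have := (aux_exp_bound (mul_pos hc hs).le).1
      have hp := Real.rpow_pos_of_pos hs (-β - 1)
      have e : s ^ (-β) = s * s ^ (-β - 1) := by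
        rw [← Real.rpow_one_add' hs.le (by linarith)]; congr 1; ring
      simp only [Pi.mul_apply, abs_mul, abs_of_pos hp]
      rw [e]
      calc _ ≤ (c * s) * s ^ (-β - 1) := by gcongr
        _ ≤ _ := by nlinarith [mul_pos hs hp]
    · intro s hs
      have := (aux_exp_bound (mul_pos hc hs).le).2
      have hp := Real.rpow_pos_of_pos hs (-β - 1)
      simp only [Pi.mul_apply, abs_mul, abs_of_pos hp]
      gcongr
      linarith
  · have h := integrableOn_rpow_mul_exp_neg_mul_rpow (p := 1) (s := -β) (b := c) (by linarith)
      one_pos hc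
    have h' : IntegrableOn (fun s : ℝ => c / β * (s ^ (-β) * Real.exp (-c * s ^ (1 : ℝ))))
      (Set.Ioi 0) := h.const_mul (c / β)
    refine h'.congr_fun (fun s _ => ?_) measurableSet_Ioi
    simp only [Pi.mul_apply, Real.rpow_one]
    rw [show -c * s = -(c * s) by ring]
    field_simp
  · have hlim : Tendsto (fun s : ℝ => (c / β) * s ^ (1 - β)) (𝓝[>] 0) (𝓝 0) := by
      have : ContinuousAt (fun s : ℝ => (c / β) * s ^ (1 - β)) 0 :=
        (Real.continuousAt_rpow_const _ _ (Or.inr (by linarith))).const_mul _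
      have h := this.tendsto
      rw [Real.zero_rpow (by linarith), mul_zero] at h
      exact h.mono_left nhdsWithin_le_nhds
    refine squeeze_zero_norm' ?_ hlim
    filter_upwards [self_mem_nhdsWithin] with s hs
    have hs : 0 < s := hs
    have := (aux_exp_bound (mul_pos hc hs).le).1
    have hp := Real.rpow_pos_of_pos hs (-β)
    have e : s ^ (1 - β) = s * s ^ (-β) := by
      rw [← Real.rpow_one_add' hs.le (by linarith)]; congr 1
    simp only [Pi.mul_apply, norm_mul, norm_div, Real.norm_eq_abs, abs_of_pos hp, abs_neg,
      abs_of_pos h0]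
    rw [e]
    calc _ ≤ (c * s) * (s ^ (-β) / β) := by gcongr
      _ = _ := by ring
  · have hlim : Tendsto (fun s : ℝ => s ^ (-β) / β) atTop (𝓝 0) := by
      simpa using (tendsto_rpow_neg_atTop h0).div_const β
    refine squeeze_zero_norm' ?_ hlim
    filter_upwards [eventually_gt_atTop 0] with s hs
    have := (aux_exp_bound (mul_pos hc hs).le).2
    have hp := Real.rpow_pos_of_pos hs (-β)
    simp only [Pi.mul_apply, norm_mul, norm_div, Real.norm_eq_abs, abs_of_pos hp, abs_neg,
      abs_of_pos h0]
    calc _ ≤ 1 * (s ^ (-β) / β) := by gcongr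
      _ = _ := by ring

lemma aux_int2 {β c : ℝ} (h0 : 0 < β) (h1 : β < 1) (hc : 0 < c) :
    ∫ t in Set.Ioi (0 : ℝ), t ^ (β - 1) * (Real.exp (-(c / t)) - 1) =
      -(c ^ β * Real.Gamma (1 - β) / β) := by
  rw [← aux_int1 h0 h1 hc, ← integral_comp_rpow_Ioi _ (p := -1) (by norm_num)]
  refine setIntegral_congr_fun measurableSet_Ioi fun s hs => ?_
  have hs : 0 < s := hs
  simp only [abs_neg, abs_one, one_mul, smul_eq_mul]
  rw [← Real.rpow_mul hs.le, Real.rpow_neg_one, div_inv_eq_mul, ← mul_assoc, ← Real.rpow_add hs,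
    mul_comm]
  congr 2
  ring

lemma aux_F_bound (x : ℝ) :
    ‖Complex.exp (Complex.I * (x : ℂ)) - 1 - Complex.I * (x : ℂ)‖ ≤ 2 * |x| ∧
    ‖Complex.exp (Complex.I * (x : ℂ)) - 1 - Complex.I * (x : ℂ)‖ ≤ 2 * |x| ^ 2 := by
  have hI : ‖Complex.I * (x : ℂ)‖ = |x| := by simp
  have h1 : ‖Complex.exp (Complex.I * (x : ℂ)) - 1 - Complex.I * (x : ℂ)‖ ≤ 2 * |x| := by
    refine (norm_sub_le _ _).trans ?_
    have : ‖Complex.exp (Complex.I * (x : ℂ)) - 1‖ ≤ ‖x‖ := Real.norm_exp_I_mul_ofReal_sub_one_le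
    rw [Real.norm_eq_abs] at this
    rw [hI]; linarith
  refine ⟨h1, ?_⟩
  rcases le_total |x| 1 with h | h
  · have := Complex.norm_exp_sub_one_sub_id_le (x := Complex.I * (x : ℂ)) (by rw [hI]; exact h)
    rw [hI] at this
    nlinarith [sq_nonneg |x|]
  · nlinarith

lemma aux_integrable (d : ℕ) (hd : 1 ≤ d) (α : ℝ) (hα1 : 1 < α) (hα2 : α < 2)
    (ξ : EuclideanSpace ℝ (Fin d)) :
    Integrable (fun z : EuclideanSpace ℝ (Fin d) =>
      (Complex.exp (Complex.I * ((⟪ξ, z⟫ : ℝ) : ℂ)) - 1 - Complex.I * ((⟪ξ, z⟫ : ℝ) : ℂ)) *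
        ((‖z‖ ^ (-((d : ℝ) + α)) : ℝ) : ℂ)) volume := by
  have : Nonempty (Fin d) := ⟨⟨0, hd⟩⟩
  set k := ‖ξ‖ with hk
  have hk0 : 0 ≤ k := norm_nonneg _
  have hdom : Integrable (fun z : EuclideanSpace ℝ (Fin d) =>
      (fun r : ℝ => min (2 * (k * r)) (2 * (k * r) ^ 2) * r ^ (-((d : ℝ) + α))) ‖z‖) volume := by
    rw [integrable_fun_norm_addHaar volume
      (f := fun r : ℝ => min (2 * (k * r)) (2 * (k * r) ^ 2) * r ^ (-((d : ℝ) + α)))]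
    have hfr : Module.finrank ℝ (EuclideanSpace ℝ (Fin d)) = d := by simp
    rw [hfr]
    have hpow : ∀ s : ℝ, 0 < s → ∀ n : ℕ,
        s ^ (d - 1) * (s ^ n * s ^ (-((d : ℝ) + α))) = s ^ ((n : ℝ) - 1 - α) := by
      intro s hs n
      rw [← Real.rpow_natCast, ← Real.rpow_natCast, ← Real.rpow_add hs, ← Real.rpow_add hs]
      congr 1
      push_cast [Nat.cast_sub hd]
      ring
    refine aux_integrableOn (C := 2 * k + 2 * k ^ 2) (a := 1 - α) (b := -α) ?_ (by linarith)
      (by linarith) ?_ ?_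
    · simp only [smul_eq_mul]
      apply Measurable.mul (by fun_prop)
      apply Measurable.mul (by fun_prop)
      exact measurable_id.pow_const _
    · intro s hs
      have hp := Real.rpow_pos_of_pos hs (-((d : ℝ) + α))
      have hm : 0 ≤ min (2 * (k * s)) (2 * (k * s) ^ 2) := by positivity
      rw [smul_eq_mul, abs_of_nonneg (by positivity)]
      have e := hpow s hs 2
      rw [show ((2 : ℕ) : ℝ) - 1 - α = 1 - α by push_cast; ring] at e
      calc _ ≤ s ^ (d - 1) * ((2 * (k * s) ^ 2) * s ^ (-((d : ℝ) + α))) := by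
            gcongr; exact min_le_right _ _
        _ = 2 * k ^ 2 * s ^ (1 - α) := by rw [← e]; ring
        _ ≤ _ := by gcongr; linarith
    · intro s hs
      have hp := Real.rpow_pos_of_pos hs (-((d : ℝ) + α))
      have hm : 0 ≤ min (2 * (k * s)) (2 * (k * s) ^ 2) := by positivity
      rw [smul_eq_mul, abs_of_nonneg (by positivity)]
      have e := hpow s hs 1
      rw [show ((1 : ℕ) : ℝ) - 1 - α = - α by push_cast; ring] at e
      calc _ ≤ s ^ (d - 1) * ((2 * (k * s)) * s ^ (-((d : ℝ) + α))) := by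
            gcongr; exact min_le_left _ _
        _ = 2 * k * s ^ (- α) := by rw [← e]; ring
        _ ≤ _ := by gcongr; nlinarith
  refine hdom.mono' ?_ ?_
  · apply Measurable.aestronglyMeasurable
    apply Measurable.mul
    · fun_prop
    · exact Complex.measurable_ofReal.comp (measurable_norm.pow_const _)
  · refine Eventually.of_forall fun z => ?_
    have hin : |⟪ξ, z⟫| ≤ k * ‖z‖ := abs_real_inner_le_norm ξ z
    obtain ⟨b1, b2⟩ := aux_F_bound ⟪ξ, z⟫
    rw [norm_mul, Complex.norm_real, Real.norm_eq_abs, abs_of_nonneg (by positivity)]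
    refine mul_le_mul_of_nonneg_right (le_min ?_ ?_) (by positivity)
    · linarith
    · exact b2.trans (by gcongr)

lemma aux_gauss (d : ℕ) (ξ : EuclideanSpace ℝ (Fin d)) {t : ℝ} (ht : 0 < t)
    (hint : Integrable (fun z : EuclideanSpace ℝ (Fin d) =>
      (Complex.exp (Complex.I * ((⟪ξ, z⟫ : ℝ) : ℂ)) - 1 - Complex.I * ((⟪ξ, z⟫ : ℝ) : ℂ)) *
        ((Real.exp (-(‖z‖ ^ 2 * t)) : ℝ) : ℂ)) volume) :
    ∫ z : EuclideanSpace ℝ (Fin d),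
      (Complex.exp (Complex.I * ((⟪ξ, z⟫ : ℝ) : ℂ)) - 1 - Complex.I * ((⟪ξ, z⟫ : ℝ) : ℂ)) *
        ((Real.exp (-(‖z‖ ^ 2 * t)) : ℝ) : ℂ) =
    (((Real.pi / t) ^ ((d : ℝ) / 2) * (Real.exp (-(‖ξ‖ ^ 2 / 4 / t)) - 1) : ℝ) : ℂ) := by
  have hb : 0 < (t : ℂ).re := by simpa using ht
  have i1 := GaussianFourier.integrable_cexp_neg_mul_sq_norm_add hb Complex.I ξ
  have i0 := GaussianFourier.integrable_cexp_neg_mul_sq_norm_add hb 0 ξ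
  have v1 := GaussianFourier.integral_cexp_neg_mul_sq_norm_add hb Complex.I ξ
  have v0 := GaussianFourier.integral_cexp_neg_mul_sq_norm_add hb 0 ξ
  have hodd : ∫ z : EuclideanSpace ℝ (Fin d), Complex.I * ((⟪ξ, z⟫ : ℝ) : ℂ) *
        ((Real.exp (-(‖z‖ ^ 2 * t)) : ℝ) : ℂ) = 0 := by
    have h := integral_neg_eq_self (fun z : EuclideanSpace ℝ (Fin d) =>
      Complex.I * ((⟪ξ, z⟫ : ℝ) : ℂ) * ((Real.exp (-(‖z‖ ^ 2 * t)) : ℝ) : ℂ)) volume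
    simp only [inner_neg_right, norm_neg, Complex.ofReal_neg, mul_neg, neg_mul] at h
    rw [integral_neg] at h
    simp only [neg_mul]  at *
    exact self_eq_neg.1 h.symm
  have e : ∀ z : EuclideanSpace ℝ (Fin d),
      (Complex.exp (Complex.I * ((⟪ξ, z⟫ : ℝ) : ℂ)) - 1 - Complex.I * ((⟪ξ, z⟫ : ℝ) : ℂ)) *
        ((Real.exp (-(‖z‖ ^ 2 * t)) : ℝ) : ℂ) =
      (Complex.exp (-t * ‖z‖ ^ 2 + Complex.I * ⟪ξ, z⟫) - Complex.exp (-t * ‖z‖ ^ 2 + 0 * ⟪ξ, z⟫))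
      - Complex.I * ((⟪ξ, z⟫ : ℝ) : ℂ) * ((Real.exp (-(‖z‖ ^ 2 * t)) : ℝ) : ℂ) := by
    intro z
    rw [Complex.exp_add, zero_mul, add_zero]
    have : ((Real.exp (-(‖z‖ ^ 2 * t)) : ℝ) : ℂ) = Complex.exp (-t * ‖z‖ ^ 2) := by
      push_cast; congr 1; ring
    rw [this]; ring
  have i2 : Integrable (fun z : EuclideanSpace ℝ (Fin d) => Complex.I * ((⟪ξ, z⟫ : ℝ) : ℂ) *
      ((Real.exp (-(‖z‖ ^ 2 * t)) : ℝ) : ℂ)) volume := by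
    refine ((i1.sub i0).sub hint).congr (Eventually.of_forall fun z => ?_)
    simp only [Pi.sub_apply]
    rw [e z]; ring
  simp_rw [e]
  have h3 := integral_sub (i1.sub i0) i2
  simp only [Pi.sub_apply] at h3
  rw [h3, hodd, integral_sub i1 i0, v1, v0, sub_zero]
  have hp : ((Real.pi : ℂ) / t) ^ ((d : ℂ) / 2) = (((Real.pi / t) ^ ((d : ℝ) / 2) : ℝ) : ℂ) := by
    rw [Complex.ofReal_cpow (by positivity)]; push_cast; rfl
  have hfr : Module.finrank ℝ (EuclideanSpace ℝ (Fin d)) = d := by simp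
  rw [hfr, hp]
  push_cast
  rw [Complex.I_sq, mul_sub, zero_pow two_ne_zero, zero_mul, zero_div, Complex.exp_zero]
  congr 3
  field_simp

/-- for `α ∈ (1,2)` the function `z ↦ (e^{iξ·z} - 1 - iξ·z)|z|^{-(d+α)}`
is absolutely integrable on `ℝ^d` and
`∫ (e^{iξ·z} - 1 - iξ·z) A(d,-α) |z|^{-(d+α)} dz = -|ξ|^α`;
that is, the truncation `1_{|z|≤1}` in the compensator may be dropped. -/
theorem stmt2 (d : ℕ) (hd : 1 ≤ d) (α : ℝ) (hα1 : 1 < α) (hα2 : α < 2)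
    (ξ : EuclideanSpace ℝ (Fin d)) :
    Integrable (fun z : EuclideanSpace ℝ (Fin d) =>
      (Complex.exp (Complex.I * ((⟪ξ, z⟫ : ℝ) : ℂ)) - 1 - Complex.I * ((⟪ξ, z⟫ : ℝ) : ℂ)) *
        ((‖z‖ ^ (-((d : ℝ) + α)) : ℝ) : ℂ)) volume ∧
    ∫ z : EuclideanSpace ℝ (Fin d),
      (Complex.exp (Complex.I * ((⟪ξ, z⟫ : ℝ) : ℂ)) - 1 - Complex.I * ((⟪ξ, z⟫ : ℝ) : ℂ)) *
        ((stableConst d α * ‖z‖ ^ (-((d : ℝ) + α)) : ℝ) : ℂ)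
      = ((-(‖ξ‖ ^ α) : ℝ) : ℂ) := by
  have hI := aux_integrable d hd α hα1 hα2 ξ
  refine ⟨hI, ?_⟩
  rcases eq_or_ne ξ 0 with rfl | hξ
  · simp [Real.zero_rpow (by linarith : α ≠ 0)]
  have hk : 0 < ‖ξ‖ := norm_pos_iff.2 hξ
  set F : EuclideanSpace ℝ (Fin d) → ℂ := fun z =>
    Complex.exp (Complex.I * ((⟪ξ, z⟫ : ℝ) : ℂ)) - 1 - Complex.I * ((⟪ξ, z⟫ : ℝ) : ℂ) with hF
  have hFm : Measurable F := by rw [hF]; fun_prop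
  set s : ℝ := ((d : ℝ) + α) / 2 with hs
  have hs0 : 0 < s := by positivity
  have hG : 0 < Real.Gamma s := Real.Gamma_pos_of_pos hs0
  set φ : EuclideanSpace ℝ (Fin d) → ℝ → ℝ := fun z t =>
    t ^ (s - 1) * Real.exp (-(‖z‖ ^ 2 * t)) with hφ
  have hφm : Measurable (fun p : EuclideanSpace ℝ (Fin d) × ℝ => φ p.1 p.2) := by
    rw [hφ]
    apply Measurable.mul
    · exact measurable_snd.pow_const _
    · fun_prop
  have hφnn : ∀ z t, 0 < t → 0 ≤ φ z t := fun z t ht => by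
    simp only [hφ]; positivity
  have hφint : ∀ z, z ≠ 0 → ∫ t in Set.Ioi (0 : ℝ), φ z t
      = Real.Gamma s * ‖z‖ ^ (-((d : ℝ) + α)) := by
    intro z hz
    have hz : 0 < ‖z‖ := norm_pos_iff.2 hz
    have h := Real.integral_rpow_mul_exp_neg_mul_Ioi (a := s) (r := ‖z‖ ^ 2) hs0 (by positivity)
    simp only [hφ]
    rw [h, one_div, Real.inv_rpow (by positivity), ← Real.rpow_neg (by positivity),
      ← Real.rpow_natCast, ← Real.rpow_mul hz.le, mul_comm]
    congr 2
    rw [hs]; push_cast; ring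
  have hφi : ∀ z, z ≠ 0 → IntegrableOn (φ z) (Set.Ioi 0) := by
    intro z hz
    apply Integrable.of_integral_ne_zero
    rw [hφint z hz]
    have hz : 0 < ‖z‖ := norm_pos_iff.2 hz
    positivity
  have hF0 : F 0 = 0 := by simp [hF]
  set K : EuclideanSpace ℝ (Fin d) × ℝ → ℂ := fun p => F p.1 * ((φ p.1 p.2 : ℝ) : ℂ) with hKdef
  have hK : Integrable K (volume.prod (volume.restrict (Set.Ioi (0 : ℝ)))) := by
    have hKm : Measurable K :=
      (hFm.comp measurable_fst).mul (Complex.measurable_ofReal.comp hφm)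
    rw [integrable_prod_iff hKm.aestronglyMeasurable]
    constructor
    · refine Eventually.of_forall fun z => ?_
      rcases eq_or_ne z 0 with rfl | hz
      · simp [hKdef, hF0]
      · exact (hφi z hz).ofReal.const_mul (F z)
    · refine (hI.norm.const_mul (Real.Gamma s)).congr (Eventually.of_forall fun z => ?_)
      rcases eq_or_ne z 0 with rfl | hz
      · simp [hKdef, hF0]
      · have e : ∫ t in Set.Ioi (0 : ℝ), ‖K (z, t)‖ = ∫ t in Set.Ioi (0 : ℝ), ‖F z‖ * φ z t := by
          refine setIntegral_congr_fun measurableSet_Ioi fun t ht => ?_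
          simp only [hKdef, norm_mul, Complex.norm_real, Real.norm_eq_abs,
            abs_of_nonneg (hφnn z t ht)]
        simp only []
        rw [e, integral_const_mul, hφint z hz, norm_mul, Complex.norm_real, Real.norm_eq_abs,
          abs_of_nonneg (by positivity : 0 ≤ ‖z‖ ^ (-((d : ℝ) + α)))]
        ring
  have hswap := integral_integral_swap (f := fun z t => K (z, t)) hK
  have hL : ∫ z, ∫ t in Set.Ioi (0 : ℝ), K (z, t) =
      ∫ z, (Real.Gamma s : ℂ) * (F z * ((‖z‖ ^ (-((d : ℝ) + α)) : ℝ) : ℂ)) := by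
    refine integral_congr_ae (Eventually.of_forall fun z => ?_)
    rcases eq_or_ne z 0 with rfl | hz
    · simp [hKdef, hF0]
    · simp only [hKdef]
      rw [integral_const_mul, integral_complex_ofReal, hφint z hz]
      push_cast; ring
  have hR : ∫ t in Set.Ioi (0 : ℝ), ∫ z, K (z, t) =
      ∫ t in Set.Ioi (0 : ℝ), ((Real.pi ^ ((d : ℝ) / 2) *
        (t ^ (α / 2 - 1) * (Real.exp (-(‖ξ‖ ^ 2 / 4 / t)) - 1)) : ℝ) : ℂ) := by
    refine integral_congr_ae ?_
    filter_upwards [hK.prod_left_ae, ae_restrict_mem measurableSet_Ioi] with t hti ht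
    have ht : 0 < t := ht
    have e : ∀ z, K (z, t) = ((t ^ (s - 1) : ℝ) : ℂ) *
        (F z * ((Real.exp (-(‖z‖ ^ 2 * t)) : ℝ) : ℂ)) := by
      intro z; simp only [hKdef, hφ]; push_cast; ring
    have hne : ((t ^ (s - 1) : ℝ) : ℂ) ≠ 0 := by
      exact_mod_cast (Real.rpow_pos_of_pos ht _).ne'
    have hi : Integrable (fun z => F z * ((Real.exp (-(‖z‖ ^ 2 * t)) : ℝ) : ℂ)) volume := by
      refine (hti.const_mul (((t ^ (s - 1) : ℝ) : ℂ)⁻¹)).congr (Eventually.of_forall fun z => ?_)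
      simp only []
      rw [e z, ← mul_assoc, inv_mul_cancel₀ hne, one_mul]
    simp_rw [e]
    rw [integral_const_mul, aux_gauss d ξ ht hi, ← Complex.ofReal_mul]
    congr 1
    have : t ^ (α / 2 - 1) = t ^ (s - 1) / t ^ ((d : ℝ) / 2) := by
      rw [← Real.rpow_sub ht]; congr 1; rw [hs]; ring
    rw [this, Real.div_rpow Real.pi_pos.le ht.le]
    ring
  rw [hL, hR, integral_const_mul, integral_complex_ofReal, integral_const_mul,
    aux_int2 (by linarith) (by linarith) (by positivity)] at hswap
  have hfin : ∫ z, F z * ((stableConst d α * ‖z‖ ^ (-((d : ℝ) + α)) : ℝ) : ℂ) =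
      (stableConst d α : ℂ) * ∫ z, F z * ((‖z‖ ^ (-((d : ℝ) + α)) : ℝ) : ℂ) := by
    rw [← integral_const_mul]
    congr 1; ext z; push_cast; ring
  rw [hfin]
  have hGc : (Real.Gamma s : ℂ) ≠ 0 := by exact_mod_cast hG.ne'
  have hJ : ∫ z, F z * ((‖z‖ ^ (-((d : ℝ) + α)) : ℝ) : ℂ) =
     ((Real.pi ^ ((d : ℝ) / 2) * -((‖ξ‖ ^ 2 / 4) ^ (α / 2) * Real.Gamma (1 - α / 2) / (α / 2))
      / Real.Gamma s : ℝ) : ℂ) := by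
    rw [Complex.ofReal_div, eq_div_iff hGc, ← hswap, mul_comm]
  rw [hJ, ← Complex.ofReal_mul]
  congr 1
  have hG2 : 0 < Real.Gamma (1 - α / 2) := Real.Gamma_pos_of_pos (by linarith)
  have e1 : (‖ξ‖ ^ 2 / 4) ^ (α / 2) = ‖ξ‖ ^ α / 2 ^ α := by
    rw [show ‖ξ‖ ^ 2 / 4 = (‖ξ‖ / 2) ^ 2 by ring, ← Real.rpow_natCast, ← Real.rpow_mul (by positivity),
      Real.div_rpow hk.le (by norm_num)]
    congr 2 <;> push_cast <;> ring
  have e2 : (2 : ℝ) ^ (α - 1) = 2 ^ α / 2 := by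
    rw [Real.rpow_sub_one (by norm_num)]
  have e3 : Real.pi ^ (-(d : ℝ) / 2) = (Real.pi ^ ((d : ℝ) / 2))⁻¹ := by
    rw [neg_div, Real.rpow_neg Real.pi_pos.le]
  have hα0 : α ≠ 0 := by linarith
  have hpi := Real.rpow_pos_of_pos Real.pi_pos ((d : ℝ) / 2)
  have h2 : (0 : ℝ) < 2 ^ α := by positivity
  rw [stableConst, e1, e2, e3, ← hs]
  generalize Real.Gamma (1 - α / 2) = g at hG2 ⊢
  field_simp
end

section
/- Let d ≥ 1 and α ∈ (1,2). The function p(t,x) := (2π)^{−d} ∫_{ℝ^d} e^{−i ξ·x} e^{−t|ξ|^α} dξ is real-valued and strictly positive, and there exists a constant c ≥ 1 depending only on d and α such that for all t > 0 and x ∈ ℝ^d, c^{−1} ( t^{−d/α} ∧ t |x|^{−(d+α)} ) ≤ p(t,x) ≤ c ( t^{−d/α} ∧ t |x|^{−(d+α)} ), where a ∧ b := min{a,b}. -/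
open MeasureTheory Filter Topology
open scoped ENNReal NNReal RealInnerProductSpace

/-- `p(t,x) = (2π)^{-d} ∫ e^{-iξ·x} e^{-t|ξ|^α} dξ`, the transition density (as a complex
integral) of the rotationally symmetric α-stable process. -/
noncomputable def stableDensityC (d : ℕ) (α : ℝ) (t : ℝ) (x : EuclideanSpace ℝ (Fin d)) : ℂ :=
  (((2 * Real.pi) ^ (-(d : ℝ)) : ℝ) : ℂ) *
    ∫ ξ : EuclideanSpace ℝ (Fin d),
      Complex.exp (-Complex.I * ((⟪ξ, x⟫ : ℝ) : ℂ)) * Complex.exp (-(t : ℂ) * ((‖ξ‖ ^ α : ℝ) : ℂ))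

/-- The comparison function `t^{-d/α} ∧ t |x|^{-(d+α)}`, valued in `[0,∞]` so that it
equals `t^{-d/α}` at `x = 0`. -/
noncomputable def stableBnd (d : ℕ) (α : ℝ) (t : ℝ) (x : EuclideanSpace ℝ (Fin d)) : ℝ≥0∞ :=
  min (ENNReal.ofReal t ^ (-(d : ℝ) / α)) (ENNReal.ofReal t * (‖x‖₊ : ℝ≥0∞) ^ (-((d : ℝ) + α)))

lemma levy_integrable {β : ℝ} (h0 : 0 < β) (h1 : β < 1) {l : ℝ} (hl : 0 < l) :
    IntegrableOn (fun x : ℝ => (1 - Real.exp (-(l * x))) * (β * x ^ (-(β + 1)))) (Set.Ioi 0) := by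
  have hm : Measurable (fun x : ℝ => (1 - Real.exp (-(l * x))) * (β * x ^ (-(β + 1)))) := by
    fun_prop
  rw [← Set.Ioc_union_Ioi_eq_Ioi (zero_le_one' ℝ)]
  refine IntegrableOn.union ?_ ?_
  · have h : IntegrableOn (fun x : ℝ => l * β * x ^ (-β)) (Set.Ioc 0 1) := by
      have := (intervalIntegral.intervalIntegrable_rpow' (a := 0) (b := 1) (r := -β) (by linarith))
      rw [intervalIntegrable_iff_integrableOn_Ioc_of_le zero_le_one] at this
      exact this.const_mul _
    refine Integrable.mono' h hm.aestronglyMeasurable ?_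
    refine (ae_restrict_iff' measurableSet_Ioc).2 (Eventually.of_forall fun x hx => ?_)
    have hx0 : 0 < x := hx.1
    have e1 : 0 ≤ 1 - Real.exp (-(l * x)) := by
      have : Real.exp (-(l * x)) ≤ 1 := Real.exp_le_one_iff.2 (by nlinarith [mul_pos hl hx0])
      linarith
    have e2 : 1 - Real.exp (-(l * x)) ≤ l * x := by
      have := Real.add_one_le_exp (-(l * x)); linarith
    have e3 : x ^ (-β) = x * x ^ (-(β + 1)) := by
      rw [show -β = 1 + (-(β + 1)) by ring, Real.rpow_add hx0, Real.rpow_one]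
    have e4 : 0 ≤ x ^ (-(β + 1)) := by positivity
    rw [Real.norm_of_nonneg (by positivity), e3]
    calc _ ≤ (l * x) * (β * x ^ (-(β + 1))) := by gcongr
      _ = _ := by ring
  · have h : IntegrableOn (fun x : ℝ => β * x ^ (-(β + 1))) (Set.Ioi 1) :=
      (integrableOn_Ioi_rpow_of_lt (by linarith) one_pos).const_mul _
    refine Integrable.mono' h hm.aestronglyMeasurable ?_
    refine (ae_restrict_iff' measurableSet_Ioi).2 (Eventually.of_forall fun x hx => ?_)
    have hx0 : 0 < x := lt_trans one_pos hx
    have e1 : 0 ≤ 1 - Real.exp (-(l * x)) := by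
      have : Real.exp (-(l * x)) ≤ 1 := Real.exp_le_one_iff.2 (by nlinarith [mul_pos hl hx0])
      linarith
    have e4 : 0 ≤ x ^ (-(β + 1)) := by positivity
    rw [Real.norm_of_nonneg (by positivity)]
    have : 1 - Real.exp (-(l * x)) ≤ 1 := by linarith [Real.exp_pos (-(l * x))]
    calc _ ≤ 1 * (β * x ^ (-(β + 1))) := by gcongr
      _ = _ := by ring

lemma levy_scale {β : ℝ} {l : ℝ} (hl : 0 < l) :
    ∫ x in Set.Ioi (0:ℝ), (1 - Real.exp (-(l * x))) * (β * x ^ (-(β + 1))) =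
      l ^ β * ∫ x in Set.Ioi (0:ℝ), (1 - Real.exp (-(1 * x))) * (β * x ^ (-(β + 1))) := by
  have h := integral_comp_mul_left_Ioi
    (fun x : ℝ => (1 - Real.exp (-(1 * x))) * (β * x ^ (-(β + 1)))) 0 hl
  rw [mul_zero, smul_eq_mul] at h
  have h2 : ∫ x in Set.Ioi (0:ℝ), (1 - Real.exp (-(l * x))) * (β * x ^ (-(β + 1))) =
      l ^ (β + 1) * ∫ x in Set.Ioi (0:ℝ), (1 - Real.exp (-(1 * (l * x)))) *
        (β * (l * x) ^ (-(β + 1))) := by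
    rw [← integral_const_mul]
    refine setIntegral_congr_fun measurableSet_Ioi fun x hx => ?_
    have hx0 : (0:ℝ) < x := hx
    rw [Real.mul_rpow hl.le hx0.le, one_mul]
    have : l ^ (β + 1) * l ^ (-(β + 1)) = 1 := by
      rw [← Real.rpow_add hl]; simp
    linear_combination (-(1 - Real.exp (-(l * x))) * β * x ^ (-(β + 1))) * this
  rw [h2, h, ← mul_assoc, Real.rpow_add hl, Real.rpow_one, mul_assoc (l ^ β), mul_inv_cancel₀ hl.ne',
    mul_one]

lemma levy_pos {β : ℝ} (h0 : 0 < β) (h1 : β < 1) :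
    0 < ∫ x in Set.Ioi (0:ℝ), (1 - Real.exp (-(1 * x))) * (β * x ^ (-(β + 1))) := by
  rw [setIntegral_pos_iff_support_of_nonneg_ae]
  · refine lt_of_lt_of_le (b := volume (Set.Ioi (0:ℝ))) (by simp) (measure_mono fun x hx => ?_)
    have hx0 : (0:ℝ) < x := hx
    refine ⟨?_, hx⟩
    have : Real.exp (-(1 * x)) < 1 := Real.exp_lt_one_iff.2 (by linarith)
    have : 0 < (1 - Real.exp (-(1 * x))) * (β * x ^ (-(β + 1))) :=
      mul_pos (by linarith) (by positivity)
    exact this.ne'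
  · refine (ae_restrict_iff' measurableSet_Ioi).2 (Eventually.of_forall fun x hx => ?_)
    have hx0 : (0:ℝ) < x := hx
    have : Real.exp (-(1 * x)) < 1 := Real.exp_lt_one_iff.2 (by linarith)
    exact (mul_pos (by linarith) (by positivity)).le
  · exact levy_integrable h0 h1 one_pos

/-- Laplace transform of the Pareto law. -/
noncomputable def parL (β t l : ℝ) : ℝ :=
  ∫ x, Real.exp (-(l * |x|)) ∂(ProbabilityTheory.paretoMeasure t β)

lemma parL_eq {β t l : ℝ} (h0 : 0 < β) (ht : 0 < t) (hl : 0 < l) :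
    1 - parL β t l = t ^ β * ∫ x in Set.Ioi (0:ℝ), (Set.Ici t).indicator
      (fun x : ℝ => (1 - Real.exp (-(l * x))) * (β * x ^ (-(β + 1)))) x := by
  have hP := ProbabilityTheory.isProbabilityMeasure_paretoMeasure ht h0
  have hExpInt : Integrable (fun x => Real.exp (-(l * |x|))) (ProbabilityTheory.paretoMeasure t β) := by
    refine Integrable.of_bound (by fun_prop) 1 (Eventually.of_forall fun x => ?_)
    rw [Real.norm_of_nonneg (Real.exp_pos _).le]
    exact Real.exp_le_one_iff.2 (by have := abs_nonneg x; nlinarith)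
  have h1 : 1 - parL β t l =
      ∫ x, (1 - Real.exp (-(l * |x|))) ∂(ProbabilityTheory.paretoMeasure t β) := by
    rw [integral_sub (integrable_const _) hExpInt]; simp [parL]
  rw [h1, ProbabilityTheory.paretoMeasure, integral_withDensity_eq_integral_toReal_smul]
  · rw [← integral_const_mul, ← integral_indicator measurableSet_Ioi]
    refine integral_congr_ae (Eventually.of_forall fun x => ?_)
    simp only [ProbabilityTheory.paretoPDF]
    rw [ENNReal.toReal_ofReal (ProbabilityTheory.paretoPDFReal_nonneg ht.le h0.le x)]
    by_cases hx : t ≤ x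
    · have hx0 : 0 < x := ht.trans_le hx
      simp [ProbabilityTheory.paretoPDFReal, Set.indicator, hx, hx0, abs_of_pos hx0]
      ring
    · simp [ProbabilityTheory.paretoPDFReal, Set.indicator, hx]
  · exact (ProbabilityTheory.measurable_paretoPDFReal t β).ennreal_ofReal
  · exact Eventually.of_forall fun x => ENNReal.ofReal_lt_top

lemma parL_tendsto {β l : ℝ} (h0 : 0 < β) (h1 : β < 1) (hl : 0 < l) :
    Tendsto (fun n : ℕ => (parL β ((n:ℝ) ^ (-β⁻¹)) l) ^ n) atTop
      (𝓝 (Real.exp (-(l ^ β *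
        ∫ x in Set.Ioi (0:ℝ), (1 - Real.exp (-(1 * x))) * (β * x ^ (-(β + 1))))))) := by
  have key : Tendsto (fun n : ℕ => ∫ x in Set.Ioi (0:ℝ), (Set.Ici ((n:ℝ) ^ (-β⁻¹))).indicator
      (fun x : ℝ => (1 - Real.exp (-(l * x))) * (β * x ^ (-(β + 1)))) x) atTop
      (𝓝 (∫ x in Set.Ioi (0:ℝ), (1 - Real.exp (-(l * x))) * (β * x ^ (-(β + 1))))) := by
    refine tendsto_integral_of_dominated_convergence
      (fun x => ‖(1 - Real.exp (-(l * x))) * (β * x ^ (-(β + 1)))‖) ?_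
      (levy_integrable h0 h1 hl).norm ?_ ?_
    · intro n
      exact (Measurable.indicator (by fun_prop) measurableSet_Ici).aestronglyMeasurable
    · intro n
      exact Eventually.of_forall fun x => norm_indicator_le_norm_self _ _
    · refine (ae_restrict_iff' measurableSet_Ioi).2 (Eventually.of_forall fun x hx => ?_)
      have ht : Tendsto (fun n : ℕ => (n:ℝ) ^ (-β⁻¹)) atTop (𝓝 0) :=
        (tendsto_rpow_neg_atTop (inv_pos.2 h0)).comp tendsto_natCast_atTop_atTop
      refine tendsto_const_nhds.congr' ?_
      filter_upwards [ht.eventually (Iio_mem_nhds hx)] with n hn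
      rw [Set.indicator_of_mem]
      exact le_of_lt hn
  rw [← levy_scale hl]
  have h2 := Real.tendsto_one_add_pow_exp_of_tendsto (g := fun n : ℕ =>
    parL β ((n:ℝ) ^ (-β⁻¹)) l - 1) (t := -(∫ x in Set.Ioi (0:ℝ), (1 - Real.exp (-(l * x))) *
      (β * x ^ (-(β + 1))))) ?_
  · simpa using h2
  · refine key.neg.congr' ?_
    filter_upwards [eventually_gt_atTop 0] with n hn
    have hn' : (0:ℝ) < n := by exact_mod_cast hn
    have := parL_eq (t := (n:ℝ) ^ (-β⁻¹)) h0 (by positivity) hl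
    rw [← Real.rpow_mul hn'.le, neg_mul, inv_mul_cancel₀ h0.ne', Real.rpow_neg_one] at this
    have h3 : parL β ((n:ℝ) ^ (-β⁻¹)) l - 1 = -(1 - parL β ((n:ℝ) ^ (-β⁻¹)) l) := by ring
    rw [h3, this]
    field_simp

/-- approximants on the unit interval -/
noncomputable def toUnit (n : ℕ) (x : Fin n → ℝ) : unitInterval :=
  ⟨Real.exp (-∑ i, |x i|), (Real.exp_pos _).le, Real.exp_le_one_iff.2 (by
    have : 0 ≤ ∑ i, |x i| := Finset.sum_nonneg fun i _ => abs_nonneg _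
    linarith)⟩

lemma toUnit_meas (n : ℕ) : Measurable (toUnit n) := by
  unfold toUnit
  exact Measurable.subtype_mk (by fun_prop)

lemma exists_unit_measure {β : ℝ} (h0 : 0 < β) (h1 : β < 1) :
    ∃ (K : ℝ) (ν : Measure unitInterval), 0 < K ∧ IsProbabilityMeasure ν ∧
      ∀ l : ℝ, 0 < l → ∫ y, (y : ℝ) ^ l ∂ν = Real.exp (-(l ^ β * K)) := by
  have hex : ∀ n : ℕ, ∃ P : ProbabilityMeasure unitInterval, 0 < n → ∀ l : ℝ, 0 < l →
      ∫ y, (y : ℝ) ^ l ∂(P : Measure unitInterval) = (parL β ((n:ℝ) ^ (-β⁻¹)) l) ^ n := by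
    intro n
    rcases Nat.eq_zero_or_pos n with rfl | hn
    · exact ⟨⟨Measure.dirac 0, inferInstance⟩, fun h => absurd h (lt_irrefl _)⟩
    have hn' : (0:ℝ) < n := by exact_mod_cast hn
    have hP := ProbabilityTheory.isProbabilityMeasure_paretoMeasure
      (t := (n:ℝ) ^ (-β⁻¹)) (by positivity) h0
    refine ⟨⟨(Measure.pi fun _ : Fin n => ProbabilityTheory.paretoMeasure ((n:ℝ) ^ (-β⁻¹)) β).map
      (toUnit n), Measure.isProbabilityMeasure_map (toUnit_meas n).aemeasurable⟩,
      fun _ l hl => ?_⟩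
    simp only [ProbabilityMeasure.coe_mk]
    rw [integral_map (toUnit_meas n).aemeasurable
      (by exact (measurable_subtype_coe.pow_const l).aestronglyMeasurable)]
    have := integral_fintype_prod_eq_pow (ι := Fin n) (fun x : ℝ => Real.exp (-(l * |x|)))
      (μ := ProbabilityTheory.paretoMeasure ((n:ℝ) ^ (-β⁻¹)) β)
    rw [Fintype.card_fin] at this
    rw [parL, ← this]
    refine integral_congr_ae (Eventually.of_forall fun x => ?_)
    simp only [toUnit]
    rw [← Real.exp_mul, ← Real.exp_sum]
    congr 1
    rw [Finset.sum_neg_distrib, ← Finset.mul_sum]; ring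
  choose P hP using hex
  obtain ⟨Q, -, hQ⟩ := isCompact_univ.ultrafilter_le_nhds
    ((hyperfilter ℕ).map P) (by simp)
  have hT : Tendsto P (hyperfilter ℕ) (𝓝 Q) := hQ
  refine ⟨_, Q, levy_pos h0 h1, inferInstance, fun l hl => ?_⟩
  rw [ProbabilityMeasure.tendsto_iff_forall_integral_tendsto] at hT
  let f : BoundedContinuousFunction unitInterval ℝ := BoundedContinuousFunction.mkOfCompact
    ⟨fun y => (y : ℝ) ^ l, continuous_subtype_val.rpow_const fun _ => Or.inr hl.le⟩
  have hf := hT f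
  refine tendsto_nhds_unique hf (((parL_tendsto h0 h1 hl).mono_left
    Nat.hyperfilter_le_atTop).congr' ?_)
  have : ∀ᶠ n : ℕ in atTop, (parL β ((n:ℝ) ^ (-β⁻¹)) l) ^ n =
      ∫ y, f y ∂(P n : Measure unitInterval) := by
    filter_upwards [eventually_gt_atTop 0] with n hn
    rw [← hP n hn l hl]; rfl
  exact Nat.hyperfilter_le_atTop this

lemma exists_subordinator {β : ℝ} (h0 : 0 < β) (h1 : β < 1) :
    ∃ μ : Measure ℝ, IsProbabilityMeasure μ ∧ (∀ᵐ s ∂μ, 0 < s) ∧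
      ∀ l : ℝ, 0 < l → ∫ s, Real.exp (-(l * s)) ∂μ = Real.exp (-l ^ β) := by
  obtain ⟨K, ν, hK, hν, hL⟩ := exists_unit_measure h0 h1
  have hExpInt : ∀ l : ℝ, 0 < l → Integrable (fun y : unitInterval => (y : ℝ) ^ l) ν := by
    intro l hl
    refine Integrable.of_bound (measurable_subtype_coe.pow_const l).aestronglyMeasurable 1
      (Eventually.of_forall fun y => ?_)
    rw [Real.norm_of_nonneg (Real.rpow_nonneg y.2.1 _)]
    exact Real.rpow_le_one y.2.1 y.2.2 hl.le
  have hz : ν {0} = 0 := by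
    have h : ∀ l : ℝ, 0 < l → ν.real {0} ≤ 1 - Real.exp (-(l ^ β * K)) := by
      intro l hl
      rw [← hL l hl]
      have e1 : ν.real {0} = ∫ y, ({0} : Set unitInterval).indicator (fun _ => (1:ℝ)) y ∂ν := by
        rw [integral_indicator (measurableSet_singleton _)]; simp [Measure.real]
      have e2 : ∫ y, (1 - (y : ℝ) ^ l) ∂ν = 1 - ∫ y, (y : ℝ) ^ l ∂ν := by
        rw [integral_sub (integrable_const _) (hExpInt l hl)]; simp
      rw [e1, ← e2]
      refine integral_mono_ae ((integrable_const _).indicator (measurableSet_singleton _))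
        ((integrable_const _).sub (hExpInt l hl)) (Eventually.of_forall fun y => ?_)
      by_cases hy : y = 0
      · simp [hy, Real.zero_rpow hl.ne']
      · simp [hy]; exact Real.rpow_le_one y.2.1 y.2.2 hl.le
    have ht : Tendsto (fun l : ℝ => 1 - Real.exp (-(l ^ β * K))) (𝓝[>] 0) (𝓝 0) := by
      have hc : ContinuousAt (fun l : ℝ => 1 - Real.exp (-(l ^ β * K))) 0 := by
        have : ContinuousAt (fun l : ℝ => l ^ β) 0 :=
          Real.continuousAt_rpow_const 0 β (Or.inr h0.le)
        fun_prop
      have := hc.tendsto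
      simp only [Real.zero_rpow h0.ne', zero_mul, neg_zero, Real.exp_zero, sub_self] at this
      exact this.mono_left nhdsWithin_le_nhds
    have h3 : ν.real {0} ≤ 0 := ge_of_tendsto ht (by
      filter_upwards [self_mem_nhdsWithin] with l hl using h l hl)
    have h4 : ν.real {0} = 0 := le_antisymm h3 measureReal_nonneg
    exact (measureReal_eq_zero_iff).1 h4
  have ho : ν {1} = 0 := by
    have h : ∀ l : ℝ, 0 < l → ν.real {1} ≤ Real.exp (-(l ^ β * K)) := by
      intro l hl
      rw [← hL l hl]
      have e1 : ν.real {1} = ∫ y, ({1} : Set unitInterval).indicator (fun _ => (1:ℝ)) y ∂ν := by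
        rw [integral_indicator (measurableSet_singleton _)]; simp [Measure.real]
      rw [e1]
      refine integral_mono_ae ((integrable_const _).indicator (measurableSet_singleton _))
        (hExpInt l hl) (Eventually.of_forall fun y => ?_)
      by_cases hy : y = 1
      · simp [hy]
      · simp [hy]; exact Real.rpow_nonneg y.2.1 _
    have ht : Tendsto (fun l : ℝ => Real.exp (-(l ^ β * K))) atTop (𝓝 0) :=
      Real.tendsto_exp_neg_atTop_nhds_zero.comp ((tendsto_rpow_atTop h0).atTop_mul_const hK)
    have h3 : ν.real {1} ≤ 0 := ge_of_tendsto ht (by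
      filter_upwards [eventually_gt_atTop 0] with l hl using h l hl)
    have h4 : ν.real {1} = 0 := le_antisymm h3 measureReal_nonneg
    exact (measureReal_eq_zero_iff).1 h4
  have hae : ∀ᵐ y : unitInterval ∂ν, 0 < (y : ℝ) ∧ (y : ℝ) < 1 := by
    have a0 : ∀ᵐ y : unitInterval ∂ν, y ≠ 0 := by simpa [ae_iff] using hz
    have a1 : ∀ᵐ y : unitInterval ∂ν, y ≠ 1 := by simpa [ae_iff] using ho
    filter_upwards [a0, a1] with y hy0 hy1
    exact ⟨lt_of_le_of_ne y.2.1 fun h => hy0 (Subtype.ext h.symm),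
      lt_of_le_of_ne y.2.2 fun h => hy1 (Subtype.ext h)⟩
  set c := K ^ (-β⁻¹) with hc
  have hcp : 0 < c := by positivity
  have hm : Measurable (fun y : unitInterval => -(c * Real.log y)) := by fun_prop
  refine ⟨ν.map (fun y : unitInterval => -(c * Real.log y)),
    Measure.isProbabilityMeasure_map hm.aemeasurable, ?_, ?_⟩
  · rw [ae_map_iff hm.aemeasurable measurableSet_Ioi]
    filter_upwards [hae] with y hy
    have := Real.log_neg hy.1 hy.2
    nlinarith
  · intro l hl
    rw [integral_map hm.aemeasurable (by fun_prop)]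
    have : ∫ y : unitInterval, Real.exp (-(l * -(c * Real.log y))) ∂ν =
        ∫ y : unitInterval, (y : ℝ) ^ (l * c) ∂ν := by
      refine integral_congr_ae ?_
      filter_upwards [hae] with y hy
      rw [Real.rpow_def_of_pos hy.1]; congr 1; ring
    rw [this, hL _ (by positivity), Real.mul_rpow hl.le hcp.le, hc, ← Real.rpow_mul hK.le, neg_mul,
      inv_mul_cancel₀ h0.ne', Real.rpow_neg_one, mul_assoc, inv_mul_cancel₀ hK.ne', mul_one]

/-- The normalising constant of the Gaussian kernel. -/
noncomputable def gA (d : ℕ) : ℝ := (2 * Real.pi) ^ (-(d : ℝ)) * Real.pi ^ ((d : ℝ) / 2)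

lemma gA_pos (d : ℕ) : 0 < gA d := by unfold gA; positivity

/-- The Gaussian kernel at time `s` and distance `r`. -/
noncomputable def gk (d : ℕ) (s r : ℝ) : ℝ :=
  gA d * s ^ (-((d : ℝ) / 2)) * Real.exp (-(r ^ 2 / (4 * s)))

lemma gauss_int (d : ℕ) {s : ℝ} (hs : 0 < s) (x : EuclideanSpace ℝ (Fin d)) :
    (((2 * Real.pi) ^ (-(d : ℝ)) : ℝ) : ℂ) * ∫ ξ : EuclideanSpace ℝ (Fin d),
      Complex.exp (-Complex.I * ((⟪ξ, x⟫ : ℝ) : ℂ)) * ((Real.exp (-(‖ξ‖ ^ 2 * s)) : ℝ) : ℂ) =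
    ((gk d s ‖x‖ : ℝ) : ℂ) := by
  have h := GaussianFourier.integral_cexp_neg_mul_sq_norm_add_of_euclideanSpace
    (b := (s : ℂ)) (by simpa using hs) (-Complex.I) x
  have e : ∀ ξ : EuclideanSpace ℝ (Fin d),
      Complex.exp (-Complex.I * ((⟪ξ, x⟫ : ℝ) : ℂ)) * ((Real.exp (-(‖ξ‖ ^ 2 * s)) : ℝ) : ℂ) =
      Complex.exp (-(s : ℂ) * (‖ξ‖ : ℂ) ^ 2 + -Complex.I * ((⟪x, ξ⟫ : ℝ) : ℂ)) := by
    intro ξ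
    rw [Complex.ofReal_exp, ← Complex.exp_add, real_inner_comm]
    congr 1; push_cast; ring
  simp_rw [e]
  rw [h]
  have e2 : ((Real.pi : ℂ) / (s : ℂ)) ^ ((Fintype.card (Fin d) : ℂ) / 2) =
      (((Real.pi / s) ^ ((d : ℝ) / 2) : ℝ) : ℂ) := by
    rw [Complex.ofReal_cpow (by positivity)]; simp
  have e3 : Complex.exp ((-Complex.I) ^ 2 * (‖x‖ : ℂ) ^ 2 / (4 * (s : ℂ))) =
      ((Real.exp (-(‖x‖ ^ 2 / (4 * s))) : ℝ) : ℂ) := by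
    rw [Complex.ofReal_exp]; congr 1; push_cast; rw [neg_sq, Complex.I_sq]; ring
  rw [e2, e3, gk, gA, Real.div_rpow Real.pi_pos.le hs.le, Real.rpow_neg hs.le]
  push_cast; ring

lemma stable_integrable (d : ℕ) (hd : 1 ≤ d) {α : ℝ} (hα : 0 < α) :
    Integrable (fun ξ : EuclideanSpace ℝ (Fin d) => Real.exp (-‖ξ‖ ^ α)) := by
  have : Nonempty (Fin d) := ⟨⟨0, hd⟩⟩
  have : Nontrivial (EuclideanSpace ℝ (Fin d)) := inferInstance
  rw [integrable_fun_norm_addHaar volume (f := fun y : ℝ => Real.exp (-y ^ α))]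
  have h := integrableOn_rpow_mul_exp_neg_rpow (p := α) (s := ((d - 1 : ℕ) : ℝ))
    (by have : (0:ℝ) ≤ ((d - 1 : ℕ) : ℝ) := Nat.cast_nonneg _
        linarith) hα
  simpa [Real.rpow_natCast] using h

lemma density_one (d : ℕ) (hd : 1 ≤ d) {α : ℝ} (hα : 0 < α) (μ : Measure ℝ)
    [IsProbabilityMeasure μ] (hpos : ∀ᵐ s ∂μ, 0 < s)
    (hL : ∀ l : ℝ, 0 < l → ∫ s, Real.exp (-(l * s)) ∂μ = Real.exp (-l ^ (α / 2)))
    (x : EuclideanSpace ℝ (Fin d)) :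
    Integrable (fun s => gk d s ‖x‖) μ ∧
      stableDensityC d α 1 x = ((∫ s, gk d s ‖x‖ ∂μ : ℝ) : ℂ) := by
  have hL' : ∀ ξ : EuclideanSpace ℝ (Fin d),
      ∫ s, Real.exp (-(‖ξ‖ ^ 2 * s)) ∂μ = Real.exp (-‖ξ‖ ^ α) := by
    intro ξ
    rcases eq_or_ne ξ 0 with rfl | h
    · simp [Real.zero_rpow hα.ne']
    · have hn : 0 < ‖ξ‖ := norm_pos_iff.2 h
      rw [hL _ (by positivity), ← Real.rpow_natCast, ← Real.rpow_mul hn.le]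
      congr 3; push_cast; ring
  let F : ℝ → EuclideanSpace ℝ (Fin d) → ℂ := fun s ξ =>
    Complex.exp (-Complex.I * ((⟪ξ, x⟫ : ℝ) : ℂ)) * ((Real.exp (-(‖ξ‖ ^ 2 * s)) : ℝ) : ℂ)
  have hnorm : ∀ s ξ, ‖F s ξ‖ = Real.exp (-(‖ξ‖ ^ 2 * s)) := by
    intro s ξ
    simp only [F, norm_mul, Complex.norm_real, Real.norm_of_nonneg (Real.exp_pos _).le]
    rw [show -Complex.I * ((⟪ξ, x⟫ : ℝ) : ℂ) = ((-⟪ξ, x⟫ : ℝ) : ℂ) * Complex.I by push_cast; ring,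
      Complex.norm_exp_ofReal_mul_I, one_mul]
  have hFc : Continuous (Function.uncurry F) := by
    simp only [F, Function.uncurry_def]; fun_prop
  have hFint : Integrable (Function.uncurry F) (μ.prod volume) := by
    rw [integrable_prod_iff' hFc.aestronglyMeasurable]
    constructor
    · refine Eventually.of_forall fun ξ => ?_
      refine Integrable.of_bound (C := 1) ?_ ?_
      · exact (hFc.comp (by fun_prop : Continuous fun s : ℝ => (s, ξ))).aestronglyMeasurable
      · filter_upwards [hpos] with s hs
        simp only [Function.uncurry_apply_pair, hnorm]
        exact Real.exp_le_one_iff.2 (by nlinarith [sq_nonneg ‖ξ‖, mul_nonneg (sq_nonneg ‖ξ‖) hs.le])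
    · simp only [Function.uncurry_apply_pair, hnorm, hL']
      exact stable_integrable d hd hα
  have hin := hFint.integral_prod_left
  have hae : ∀ᵐ s ∂μ, (((2 * Real.pi) ^ (-(d : ℝ)) : ℝ) : ℂ) *
      (∫ ξ, Function.uncurry F (s, ξ)) = ((gk d s ‖x‖ : ℝ) : ℂ) := by
    filter_upwards [hpos] with s hs
    exact gauss_int d hs x
  constructor
  · have := ((hin.const_mul (((2 * Real.pi) ^ (-(d : ℝ)) : ℝ) : ℂ)).congr hae).re
    simpa using this
  · rw [← integral_complex_ofReal, ← integral_congr_ae hae, integral_const_mul]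
    unfold stableDensityC
    congr 1
    have := integral_integral_swap hFint
    simp only [Function.uncurry_apply_pair]
    rw [this]
    refine integral_congr_ae (Eventually.of_forall fun ξ => ?_)
    simp only [F]
    rw [integral_const_mul, integral_complex_ofReal, hL', Complex.ofReal_exp]
    congr 2; push_cast; ring

lemma density_scale (d : ℕ) {α : ℝ} (hα : 0 < α) {t : ℝ} (ht : 0 < t)
    (x : EuclideanSpace ℝ (Fin d)) :
    stableDensityC d α t x =
      ((t ^ (-(d : ℝ) / α) : ℝ) : ℂ) * stableDensityC d α 1 (t ^ (-α⁻¹) • x) := by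
  unfold stableDensityC
  have h := Measure.integral_comp_smul (volume : Measure (EuclideanSpace ℝ (Fin d)))
    (fun ξ : EuclideanSpace ℝ (Fin d) =>
      Complex.exp (-Complex.I * ((⟪ξ, t ^ (-α⁻¹) • x⟫ : ℝ) : ℂ)) *
        Complex.exp (-((1:ℝ) : ℂ) * ((‖ξ‖ ^ α : ℝ) : ℂ))) (t ^ α⁻¹)
  have hR : 0 < t ^ α⁻¹ := by positivity
  have e1 : |((t ^ α⁻¹) ^ Module.finrank ℝ (EuclideanSpace ℝ (Fin d)))⁻¹| =
      t ^ (-(d : ℝ) / α) := by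
    rw [abs_of_pos (by positivity), finrank_euclideanSpace_fin, ← Real.rpow_natCast,
      ← Real.rpow_mul ht.le, ← Real.rpow_neg ht.le]
    congr 1; field_simp
  rw [e1, Complex.real_smul] at h
  rw [mul_left_comm, ← h]
  congr 1
  refine integral_congr_ae (Eventually.of_forall fun ξ => ?_)
  simp only
  have e2 : ⟪t ^ α⁻¹ • ξ, t ^ (-α⁻¹) • x⟫ = ⟪ξ, x⟫ := by
    rw [inner_smul_left, inner_smul_right, ← mul_assoc]
    simp only [conj_trivial]
    rw [← Real.rpow_add ht]; simp
  have e3 : ‖t ^ α⁻¹ • ξ‖ ^ α = t * ‖ξ‖ ^ α := by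
    rw [norm_smul, Real.norm_of_nonneg hR.le, Real.mul_rpow hR.le (norm_nonneg _),
      ← Real.rpow_mul ht.le, inv_mul_cancel₀ hα.ne', Real.rpow_one]
  rw [e2, e3]
  push_cast; ring_nf

lemma gk_pos (d : ℕ) {s : ℝ} (hs : 0 < s) (r : ℝ) : 0 < gk d s r := by
  have := gA_pos d
  unfold gk; positivity

lemma gk_anti (d : ℕ) {s : ℝ} (hs : 0 < s) {r r' : ℝ} (hr : 0 ≤ r) (h : r ≤ r') :
    gk d s r' ≤ gk d s r := by
  have := gA_pos d
  unfold gk; gcongr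

lemma gk_scale (d : ℕ) {s r : ℝ} (hs : 0 < s) (hr : 0 < r) :
    gk d s r = r ^ (-(d : ℝ)) * gk d ((r ^ 2)⁻¹ * s) 1 := by
  have e : ((r ^ 2)⁻¹) ^ (-((d : ℝ) / 2)) = r ^ (d : ℝ) := by
    rw [Real.inv_rpow (by positivity), Real.rpow_neg (by positivity), inv_inv, ← Real.rpow_natCast,
      ← Real.rpow_mul hr.le]
    congr 1; push_cast; ring
  have e2 : r ^ (-(d : ℝ)) * r ^ (d : ℝ) = 1 := by rw [← Real.rpow_add hr]; simp
  have e3 : 1 ^ 2 / (4 * ((r ^ 2)⁻¹ * s)) = r ^ 2 / (4 * s) := by field_simp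
  unfold gk
  rw [Real.mul_rpow (by positivity) hs.le, e, e3]
  linear_combination (-gA d * s ^ (-((d : ℝ) / 2)) * Real.exp (-(r ^ 2 / (4 * s)))) * e2

lemma half_le {y : ℝ} (h0 : 0 ≤ y) (h1 : y ≤ 1) : y / 2 ≤ 1 - Real.exp (-y) := by
  have h := Real.add_one_le_exp y
  have h2 : Real.exp (-y) ≤ (y + 1)⁻¹ := by
    rw [Real.exp_neg]; exact inv_anti₀ (by linarith) h
  have h3 : (y + 1)⁻¹ ≤ 1 - y / 2 := by
    rw [inv_le_iff_one_le_mul₀ (by linarith)]; nlinarith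
  linarith

lemma half_le' {y : ℝ} (h1 : 1 ≤ y) : 1 / 2 ≤ 1 - Real.exp (-y) := by
  have h := half_le zero_le_one le_rfl
  have : Real.exp (-y) ≤ Real.exp (-1) := Real.exp_le_exp.2 (by linarith)
  linarith

lemma gk_upper (d : ℕ) {u : ℝ} (hu : 0 < u) :
    gk d u 1 ≤ 2 * gA d * ((d + 1).factorial * 4 ^ (d + 1)) * (1 - Real.exp (-u)) := by
  have hA := gA_pos d
  have hM : (1:ℝ) ≤ (d + 1).factorial * 4 ^ (d + 1) := by
    have h1 : (1:ℝ) ≤ (d + 1).factorial := by exact_mod_cast Nat.succ_le_of_lt (Nat.factorial_pos _)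
    have h2 : (1:ℝ) ≤ 4 ^ (d + 1) := one_le_pow₀ (by norm_num)
    nlinarith
  rcases le_total u 1 with h | h
  · have h1 := half_le hu.le h
    have h2 : u ^ (-((d : ℝ) / 2)) ≤ u * (u⁻¹) ^ (d + 1) := by
      have e : u * (u⁻¹) ^ (d + 1) = u ^ (-(d : ℝ)) := by
        rw [Real.rpow_neg hu.le, Real.rpow_natCast, pow_succ, inv_pow]; field_simp
      rw [e]
      exact Real.rpow_le_rpow_of_exponent_ge hu h (by
        have : (0:ℝ) ≤ d := Nat.cast_nonneg _
        linarith)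
    have h3 : (u⁻¹) ^ (d + 1) * Real.exp (-(1 ^ 2 / (4 * u))) ≤
        (d + 1).factorial * 4 ^ (d + 1) := by
      have h4 := Real.pow_div_factorial_le_exp (1 / (4 * u)) (by positivity) (d + 1)
      rw [one_pow, Real.exp_neg, ← div_eq_mul_inv, div_le_iff₀ (Real.exp_pos _)]
      rw [div_le_iff₀ (by positivity)] at h4
      have e : (u⁻¹) ^ (d + 1) = 4 ^ (d + 1) * (1 / (4 * u)) ^ (d + 1) := by
        rw [← mul_pow]; congr 1; field_simp
      rw [e]
      calc _ ≤ 4 ^ (d + 1) * (Real.exp (1 / (4 * u)) * (d + 1).factorial) := by gcongr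
        _ = _ := by ring
    unfold gk
    calc gA d * u ^ (-((d : ℝ) / 2)) * Real.exp (-(1 ^ 2 / (4 * u)))
        ≤ gA d * (u * (u⁻¹) ^ (d + 1)) * Real.exp (-(1 ^ 2 / (4 * u))) := by gcongr
      _ = gA d * u * ((u⁻¹) ^ (d + 1) * Real.exp (-(1 ^ 2 / (4 * u)))) := by ring
      _ ≤ gA d * u * ((d + 1).factorial * 4 ^ (d + 1)) := by gcongr
      _ = 2 * gA d * ((d + 1).factorial * 4 ^ (d + 1)) * (u / 2) := by ring
      _ ≤ _ := by gcongr
  · have h1 := half_le' h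
    have h2 : u ^ (-((d : ℝ) / 2)) ≤ 1 := Real.rpow_le_one_of_one_le_of_nonpos h (by
        have : (0:ℝ) ≤ d := Nat.cast_nonneg _
        linarith)
    have h3 : Real.exp (-(1 ^ 2 / (4 * u))) ≤ 1 := Real.exp_le_one_iff.2 (by
      have : 0 ≤ 1 ^ 2 / (4 * u) := by positivity
      linarith)
    unfold gk
    calc gA d * u ^ (-((d : ℝ) / 2)) * Real.exp (-(1 ^ 2 / (4 * u)))
        ≤ gA d * 1 * 1 := by gcongr
      _ = 2 * gA d * 1 * (1 / 2) := by ring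
      _ ≤ _ := by gcongr

/-- The test function used for the lower bound. -/
noncomputable def tF (N M u : ℝ) : ℝ :=
  (1 - Real.exp (-u)) - 2 / N * (1 - Real.exp (-(N * u))) - 2 * (1 - Real.exp (-(M⁻¹ * u)))

lemma gk_lower (d : ℕ) {N M : ℝ} (hN : 0 < N) (hM : 0 < M) {u : ℝ} (hu : 0 < u) :
    gA d * M ^ (-((d : ℝ) / 2)) * Real.exp (-(N / 4)) * tF N M u ≤ gk d u 1 := by
  have hA := gA_pos d
  have hN0 : 0 ≤ 1 - Real.exp (-(N * u)) := by
    have : Real.exp (-(N * u)) ≤ 1 := Real.exp_le_one_iff.2 (by nlinarith [mul_pos hN hu])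
    linarith
  have hM0 : 0 ≤ 1 - Real.exp (-(M⁻¹ * u)) := by
    have : Real.exp (-(M⁻¹ * u)) ≤ 1 :=
      Real.exp_le_one_iff.2 (by nlinarith [mul_pos (inv_pos.2 hM) hu])
    linarith
  have hN1 : 0 ≤ 2 / N * (1 - Real.exp (-(N * u))) := by positivity
  have hp := gk_pos d hu 1
  have hm : 0 < gA d * M ^ (-((d : ℝ) / 2)) * Real.exp (-(N / 4)) := by positivity
  by_cases h1 : N * u ≤ 1
  · have h := half_le (by positivity) h1
    have h2 : u ≤ 2 / N * (1 - Real.exp (-(N * u))) := by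
      calc u = 2 / N * (N * u / 2) := by field_simp
        _ ≤ _ := by gcongr
    have h3 : 1 - Real.exp (-u) ≤ u := by
      have := Real.add_one_le_exp (-u); linarith
    have : tF N M u ≤ 0 := by unfold tF; linarith
    nlinarith
  by_cases h2 : 1 ≤ M⁻¹ * u
  · have h := half_le' h2
    have : tF N M u ≤ 0 := by unfold tF; linarith [Real.exp_pos (-u)]
    nlinarith
  push Not at h1 h2
  have h3 : tF N M u ≤ 1 := by unfold tF; linarith [Real.exp_pos (-u)]
  have h4 : u ≤ M := by
    rw [inv_mul_lt_iff₀ hM] at h2; linarith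
  have h5 : M ^ (-((d : ℝ) / 2)) ≤ u ^ (-((d : ℝ) / 2)) :=
    Real.rpow_le_rpow_of_nonpos hu h4 (by
      have : (0:ℝ) ≤ d := Nat.cast_nonneg _
      linarith)
  have h6 : 1 ^ 2 / (4 * u) ≤ N / 4 := by
    rw [div_le_div_iff₀ (by positivity) (by norm_num)]; nlinarith
  calc _ ≤ gA d * M ^ (-((d : ℝ) / 2)) * Real.exp (-(N / 4)) * 1 := by gcongr
    _ ≤ gA d * u ^ (-((d : ℝ) / 2)) * Real.exp (-(1 ^ 2 / (4 * u))) * 1 := by gcongr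
    _ = _ := by unfold gk; ring

lemma G_bounds (d : ℕ) {α : ℝ} (hα : 0 < α) (hα2 : α < 2) (μ : Measure ℝ)
    [IsProbabilityMeasure μ] (hpos : ∀ᵐ s ∂μ, 0 < s)
    (hL : ∀ l : ℝ, 0 < l → ∫ s, Real.exp (-(l * s)) ∂μ = Real.exp (-l ^ (α / 2)))
    (hG : ∀ r : ℝ, 0 ≤ r → Integrable (fun s => gk d s r) μ) :
    ∃ c : ℝ, 1 ≤ c ∧ ∀ r : ℝ, 0 ≤ r → 0 < ∫ s, gk d s r ∂μ ∧ ∫ s, gk d s r ∂μ ≤ c ∧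
      (0 < r → ∫ s, gk d s r ∂μ ≤ c * r ^ (-((d : ℝ) + α))) ∧
      (r ≤ 1 → c⁻¹ ≤ ∫ s, gk d s r ∂μ) ∧
      (1 ≤ r → c⁻¹ * r ^ (-((d : ℝ) + α)) ≤ ∫ s, gk d s r ∂μ) := by
  have hA := gA_pos d
  have hGpos : ∀ r : ℝ, 0 ≤ r → 0 < ∫ s, gk d s r ∂μ := by
    intro r hr
    have h0 : 0 ≤ᵐ[μ] fun s => gk d s r := by
      filter_upwards [hpos] with s hs using (gk_pos d hs r).le
    refine lt_of_le_of_ne (integral_nonneg_of_ae h0) fun h => ?_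
    have h1 := (integral_eq_zero_iff_of_nonneg_ae h0 (hG r hr)).1 h.symm
    have h2 : ∀ᵐ s ∂μ, False := by
      filter_upwards [h1, hpos] with s hs hs'
      exact (gk_pos d hs' r).ne' hs
    simp at h2
    exact (IsProbabilityMeasure.ne_zero μ) h2
  have hanti : ∀ r r' : ℝ, 0 ≤ r → r ≤ r' → ∫ s, gk d s r' ∂μ ≤ ∫ s, gk d s r ∂μ := by
    intro r r' hr h
    refine integral_mono_ae (hG r' (hr.trans h)) (hG r hr) ?_
    filter_upwards [hpos] with s hs using gk_anti d hs hr h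
  have hExpInt : ∀ l : ℝ, 0 < l → Integrable (fun s => Real.exp (-(l * s))) μ := by
    intro l hl
    refine Integrable.of_bound (C := 1) (by fun_prop) ?_
    filter_upwards [hpos] with s hs
    rw [Real.norm_of_nonneg (Real.exp_pos _).le]
    exact Real.exp_le_one_iff.2 (by nlinarith [mul_pos hl hs])
  have hExpOne : ∀ l : ℝ, 0 < l → Integrable (fun s => 1 - Real.exp (-(l * s))) μ :=
    fun l hl => (integrable_const _).sub (hExpInt l hl)
  have hL1 : ∀ l : ℝ, 0 < l → ∫ s, (1 - Real.exp (-(l * s))) ∂μ = 1 - Real.exp (-l ^ (α / 2)) := by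
    intro l hl
    rw [integral_sub (integrable_const _) (hExpInt l hl), hL l hl]; simp
  have hrr : ∀ r : ℝ, 0 < r → ((r ^ 2)⁻¹) ^ (α / 2) = r ^ (-α) := by
    intro r hr
    rw [Real.inv_rpow (by positivity), ← Real.rpow_natCast, ← Real.rpow_mul hr.le,
      ← Real.rpow_neg hr.le]
    congr 1; push_cast; ring
  have hsplit : ∀ r : ℝ, 0 < r → r ^ (-((d : ℝ) + α)) = r ^ (-(d : ℝ)) * r ^ (-α) := by
    intro r hr
    rw [← Real.rpow_add hr]; congr 1; ring
  have hGs : ∀ r : ℝ, 0 < r → ∫ s, gk d s r ∂μ =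
      r ^ (-(d : ℝ)) * ∫ s, gk d ((r ^ 2)⁻¹ * s) 1 ∂μ := by
    intro r hr
    rw [← integral_const_mul]
    refine integral_congr_ae ?_
    filter_upwards [hpos] with s hs using gk_scale d hs hr
  have hGi : ∀ r : ℝ, 0 < r → Integrable (fun s => gk d ((r ^ 2)⁻¹ * s) 1) μ := by
    intro r hr
    refine ((hG r hr.le).const_mul ((r ^ (-(d : ℝ)))⁻¹)).congr ?_
    filter_upwards [hpos] with s hs
    rw [gk_scale d hs hr, inv_mul_cancel_left₀ (by positivity)]
  set C1 : ℝ := 2 * gA d * ((d + 1).factorial * 4 ^ (d + 1)) with hC1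
  have hC1p : 0 < C1 := by positivity
  have hup : ∀ r : ℝ, 0 < r → ∫ s, gk d s r ∂μ ≤ C1 * r ^ (-((d : ℝ) + α)) := by
    intro r hr
    have hq : 0 < (r ^ 2)⁻¹ := by positivity
    rw [hGs r hr, hsplit r hr]
    have h1 : ∫ s, gk d ((r ^ 2)⁻¹ * s) 1 ∂μ ≤ C1 * r ^ (-α) := by
      calc ∫ s, gk d ((r ^ 2)⁻¹ * s) 1 ∂μ
          ≤ ∫ s, C1 * (1 - Real.exp (-((r ^ 2)⁻¹ * s))) ∂μ := by
            refine integral_mono_ae (hGi r hr) ((hExpOne _ hq).const_mul _) ?_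
            filter_upwards [hpos] with s hs using gk_upper d (mul_pos hq hs)
        _ = C1 * (1 - Real.exp (-r ^ (-α))) := by
            rw [integral_const_mul, hL1 _ hq, hrr r hr]
        _ ≤ C1 * r ^ (-α) := by
            gcongr
            have := Real.add_one_le_exp (-r ^ (-α)); linarith
    calc _ ≤ r ^ (-(d : ℝ)) * (C1 * r ^ (-α)) := by gcongr
      _ = _ := by ring
  obtain ⟨N, hN, hNb⟩ : ∃ N : ℝ, 0 < N ∧ 2 / N * N ^ (α / 2) ≤ 1 / 8 := by
    have ht : Tendsto (fun N : ℝ => N ^ (-(1 - α / 2))) atTop (𝓝 0) :=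
      tendsto_rpow_neg_atTop (by linarith)
    obtain ⟨N, h1, h2⟩ := ((ht.eventually (Iio_mem_nhds (show (0:ℝ) < 1 / 16 by norm_num))).and
      (eventually_gt_atTop 0)).exists
    refine ⟨N, h2, ?_⟩
    have e : N ^ (-(1 - α / 2)) = N⁻¹ * N ^ (α / 2) := by
      rw [← Real.rpow_neg_one, ← Real.rpow_add h2]; congr 1; ring
    simp only [e] at h1
    rw [div_eq_mul_inv, mul_assoc]; linarith
  obtain ⟨M, hM, hMb⟩ : ∃ M : ℝ, 0 < M ∧ 2 * (M⁻¹) ^ (α / 2) ≤ 1 / 8 := by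
    have ht : Tendsto (fun N : ℝ => N ^ (-(α / 2))) atTop (𝓝 0) :=
      tendsto_rpow_neg_atTop (by linarith)
    obtain ⟨M, h1, h2⟩ := ((ht.eventually (Iio_mem_nhds (show (0:ℝ) < 1 / 16 by norm_num))).and
      (eventually_gt_atTop 0)).exists
    refine ⟨M, h2, ?_⟩
    rw [Real.rpow_neg h2.le, ← Real.inv_rpow h2.le] at h1
    linarith
  set m : ℝ := gA d * M ^ (-((d : ℝ) / 2)) * Real.exp (-(N / 4)) with hm
  have hmp : 0 < m := by positivity
  have hlow : ∀ r : ℝ, 1 ≤ r → m / 4 * r ^ (-((d : ℝ) + α)) ≤ ∫ s, gk d s r ∂μ := by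
    intro r hr1
    have hr : 0 < r := by linarith
    have hq : 0 < (r ^ 2)⁻¹ := by positivity
    set ρ := r ^ (-α) with hρ
    have hρ0 : 0 < ρ := by positivity
    have hρ1 : ρ ≤ 1 := Real.rpow_le_one_of_one_le_of_nonpos hr1 (by linarith)
    rw [hGs r hr, hsplit r hr]
    have hNq : 0 < N * (r ^ 2)⁻¹ := by positivity
    have hMq : 0 < M⁻¹ * (r ^ 2)⁻¹ := by positivity
    have e1 : ∀ s, tF N M ((r ^ 2)⁻¹ * s) = (1 - Real.exp (-((r ^ 2)⁻¹ * s))) -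
        2 / N * (1 - Real.exp (-(N * (r ^ 2)⁻¹ * s))) -
        2 * (1 - Real.exp (-(M⁻¹ * (r ^ 2)⁻¹ * s))) := by
      intro s; unfold tF; simp only [mul_assoc]
    have i1 := hExpOne _ hq
    have i2 := (hExpOne _ hNq).const_mul (2 / N)
    have i3 := (hExpOne _ hMq).const_mul 2
    have itF : Integrable (fun s => tF N M ((r ^ 2)⁻¹ * s)) μ := by
      simp only [e1]; exact (i1.sub i2).sub i3
    have e2 : ∫ s, tF N M ((r ^ 2)⁻¹ * s) ∂μ = (1 - Real.exp (-ρ)) -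
        2 / N * (1 - Real.exp (-(N ^ (α / 2) * ρ))) -
        2 * (1 - Real.exp (-((M⁻¹) ^ (α / 2) * ρ))) := by
      simp only [e1]
      rw [integral_sub (by exact i1.sub i2) i3, integral_sub i1 i2, integral_const_mul,
        integral_const_mul, hL1 _ hq, hL1 _ hNq, hL1 _ hMq, Real.mul_rpow hN.le hq.le,
        Real.mul_rpow (inv_pos.2 hM).le hq.le, hrr r hr]
    have e3 : ρ / 4 ≤ ∫ s, tF N M ((r ^ 2)⁻¹ * s) ∂μ := by
      rw [e2]
      have a1 := half_le hρ0.le hρ1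
      have a2 : 2 / N * (1 - Real.exp (-(N ^ (α / 2) * ρ))) ≤ 1 / 8 * ρ := by
        have := Real.add_one_le_exp (-(N ^ (α / 2) * ρ))
        calc _ ≤ 2 / N * (N ^ (α / 2) * ρ) := by gcongr; linarith
          _ = (2 / N * N ^ (α / 2)) * ρ := by ring
          _ ≤ _ := by gcongr
      have a3 : 2 * (1 - Real.exp (-((M⁻¹) ^ (α / 2) * ρ))) ≤ 1 / 8 * ρ := by
        have := Real.add_one_le_exp (-((M⁻¹) ^ (α / 2) * ρ))
        calc _ ≤ 2 * ((M⁻¹) ^ (α / 2) * ρ) := by gcongr; linarith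
          _ = (2 * (M⁻¹) ^ (α / 2)) * ρ := by ring
          _ ≤ _ := by gcongr
      linarith
    have e4 : m * ∫ s, tF N M ((r ^ 2)⁻¹ * s) ∂μ ≤ ∫ s, gk d ((r ^ 2)⁻¹ * s) 1 ∂μ := by
      rw [← integral_const_mul]
      refine integral_mono_ae (itF.const_mul _) (hGi r hr) ?_
      filter_upwards [hpos] with s hs using gk_lower d hN hM (mul_pos hq hs)
    calc m / 4 * (r ^ (-(d : ℝ)) * ρ) = r ^ (-(d : ℝ)) * (m * (ρ / 4)) := by ring
      _ ≤ r ^ (-(d : ℝ)) * (m * ∫ s, tF N M ((r ^ 2)⁻¹ * s) ∂μ) := by gcongr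
      _ ≤ _ := by gcongr
  have g0 := hGpos 0 le_rfl
  have g1 := hGpos 1 zero_le_one
  set c : ℝ := 1 + ∫ s, gk d s 0 ∂μ + C1 + (∫ s, gk d s 1 ∂μ)⁻¹ + (m / 4)⁻¹ with hc
  have i1 : 0 < (∫ s, gk d s 1 ∂μ)⁻¹ := by positivity
  have i2 : 0 < (m / 4)⁻¹ := by positivity
  have hc1 : 1 ≤ c := by linarith
  refine ⟨c, hc1, fun r hr => ⟨hGpos r hr, ?_, fun hr0 => ?_, fun hr1 => ?_, fun hr1 => ?_⟩⟩
  · have := hanti 0 r le_rfl hr; linarith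
  · refine (hup r hr0).trans ?_
    gcongr; linarith
  · refine le_trans ?_ (hanti r 1 hr hr1)
    rw [inv_le_comm₀ (by linarith) g1]; linarith
  · refine le_trans ?_ (hlow r hr1)
    have hr0 : 0 < r := by linarith
    gcongr
    rw [inv_le_comm₀ (by linarith) (by positivity)]; linarith

lemma bnd_eq (d : ℕ) {α : ℝ} (hα : 0 < α) {t : ℝ} (ht : 0 < t)
    (x : EuclideanSpace ℝ (Fin d)) :
    stableBnd d α t x = ENNReal.ofReal (t ^ (-(d : ℝ) / α) *
      (if x = 0 then 1 else min 1 (‖t ^ (-α⁻¹) • x‖ ^ (-((d : ℝ) + α))))) := by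
  have hd0 : (0:ℝ) ≤ d := Nat.cast_nonneg _
  unfold stableBnd
  rw [ENNReal.ofReal_rpow_of_pos ht]
  split_ifs with hx
  · rw [hx, nnnorm_zero, ENNReal.coe_zero, ENNReal.zero_rpow_of_neg (by linarith),
      ENNReal.mul_top (by simpa using ht), min_eq_left le_top, mul_one]
  · have hn : 0 < ‖x‖ := norm_pos_iff.2 hx
    have e0 : (‖x‖₊ : ℝ≥0∞) = ENNReal.ofReal ‖x‖ := (ofReal_norm x).symm
    have e1 : t ^ (-(d : ℝ) / α) * ‖t ^ (-α⁻¹) • x‖ ^ (-((d : ℝ) + α)) =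
        t * ‖x‖ ^ (-((d : ℝ) + α)) := by
      rw [norm_smul, Real.norm_of_nonneg (by positivity), Real.mul_rpow (by positivity) hn.le,
        ← Real.rpow_mul ht.le, ← mul_assoc, ← Real.rpow_add ht]
      congr 1
      rw [show -(d : ℝ) / α + -α⁻¹ * -((d : ℝ) + α) = 1 by field_simp; ring, Real.rpow_one]
    rw [e0, ENNReal.ofReal_rpow_of_pos hn, ← ENNReal.ofReal_mul ht.le,
      mul_min_of_nonneg _ _ (by positivity), mul_one, e1, ENNReal.ofReal_min]

/-- `p(t,x)` is real-valued and strictly positive, and is comparable to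
`t^{-d/α} ∧ t |x|^{-(d+α)}` with a constant depending only on `d` and `α`. -/
theorem stmt3 (d : ℕ) (hd : 1 ≤ d) (α : ℝ) (hα1 : 1 < α) (hα2 : α < 2) :
    ∃ c : ℝ, 1 ≤ c ∧ ∀ t : ℝ, 0 < t → ∀ x : EuclideanSpace ℝ (Fin d),
      (stableDensityC d α t x).im = 0 ∧ 0 < (stableDensityC d α t x).re ∧
      ENNReal.ofReal c⁻¹ * stableBnd d α t x ≤ ENNReal.ofReal ((stableDensityC d α t x).re) ∧
      ENNReal.ofReal ((stableDensityC d α t x).re) ≤ ENNReal.ofReal c * stableBnd d α t x := by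
  have hα : 0 < α := by linarith
  obtain ⟨μ, hμ, hpos, hL⟩ := exists_subordinator (β := α / 2) (by linarith) (by linarith)
  have hG : ∀ r : ℝ, 0 ≤ r → Integrable (fun s => gk d s r) μ := by
    intro r hr
    have := (density_one d hd hα μ hpos hL (EuclideanSpace.single ⟨0, hd⟩ r)).1
    simpa [abs_of_nonneg hr] using this
  obtain ⟨c, hc, hb⟩ := G_bounds d hα hα2 μ hpos hL hG
  have hc0 : 0 < c := by linarith
  have hci : c⁻¹ ≤ 1 := inv_le_one_of_one_le₀ hc
  refine ⟨c, hc, fun t ht x => ?_⟩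
  set y := t ^ (-α⁻¹) • x with hy
  have hT : 0 < t ^ (-(d : ℝ) / α) := by positivity
  have hp : stableDensityC d α t x =
      ((t ^ (-(d : ℝ) / α) * ∫ s, gk d s ‖y‖ ∂μ : ℝ) : ℂ) := by
    rw [density_scale d hα ht, (density_one d hd hα μ hpos hL _).2]; push_cast; rfl
  obtain ⟨b1, b2, b3, b4, b5⟩ := hb ‖y‖ (norm_nonneg _)
  have hy0 : x ≠ 0 → 0 < ‖y‖ := by
    intro hx
    rw [hy, norm_smul]
    have := norm_pos_iff.2 hx
    have : 0 < t ^ (-α⁻¹) := by positivity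
    rw [Real.norm_of_nonneg this.le]; positivity
  rw [bnd_eq d hα ht, hp, Complex.ofReal_re, Complex.ofReal_im, ← ENNReal.ofReal_mul hc0.le,
    ← ENNReal.ofReal_mul (inv_pos.2 hc0).le, ← hy]
  refine ⟨rfl, by positivity, ENNReal.ofReal_le_ofReal ?_, ENNReal.ofReal_le_ofReal ?_⟩
  · rw [mul_left_comm]
    refine mul_le_mul_of_nonneg_left ?_ hT.le
    split_ifs with hx
    · rw [mul_one]; exact b4 (by simp [hy, hx])
    · rcases le_total ‖y‖ 1 with h | h
      · refine le_trans ?_ (b4 h)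
        calc _ ≤ c⁻¹ * 1 := by gcongr; exact min_le_left _ _
          _ = _ := mul_one _
      · refine le_trans ?_ (b5 h)
        gcongr; exact min_le_right _ _
  · rw [mul_left_comm]
    refine mul_le_mul_of_nonneg_left ?_ hT.le
    split_ifs with hx
    · rw [mul_one]; exact b2
    · rw [mul_min_of_nonneg _ _ hc0.le, mul_one]
      exact le_min b2 (b3 (hy0 hx))
end

section
/- Let d ≥ 1 and α ∈ (1,2). There exists a constant c ≥ 1 depending only on d and α such that for every λ > 0 and every x ∈ ℝ^d \ {0}, c^{−1} [ ( λ^{(d−α)/α} ∨ |x|^{α−d} ) ∧ λ^{−2} |x|^{−(d+α)} ] ≤ r_λ(x) ≤ c [ ( λ^{(d−α)/α} ∨ |x|^{α−d} ) ∧ λ^{−2} |x|^{−(d+α)} ], where a ∨ b := max{a,b} and a ∧ b := min{a,b}. -/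
open MeasureTheory Filter Topology
open scoped ENNReal RealInnerProductSpace

/-- `p(t,x) = (2π)^{-d} ∫ e^{-iξ·x} e^{-t|ξ|^α} dξ` (real part of the complex integral),
the transition density of the rotationally symmetric α-stable process. -/
noncomputable def stableP (d : ℕ) (α : ℝ) (t : ℝ) (x : EuclideanSpace ℝ (Fin d)) : ℝ :=
  ((((2 * Real.pi) ^ (-(d : ℝ)) : ℝ) : ℂ) *
    ∫ ξ : EuclideanSpace ℝ (Fin d),
      Complex.exp (-Complex.I * ((⟪ξ, x⟫ : ℝ) : ℂ)) *
        Complex.exp (-(t : ℂ) * ((‖ξ‖ ^ α : ℝ) : ℂ))).re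

/-- The `λ`-resolvent kernel `r_λ(x) = ∫_0^∞ e^{-λt} p(t,x) dt`. -/
noncomputable def resKer (d : ℕ) (α : ℝ) (l : ℝ) (x : EuclideanSpace ℝ (Fin d)) : ℝ :=
  ∫ t in Set.Ioi (0 : ℝ), Real.exp (-(l * t)) * stableP d α t x

theorem sk_gauss_int (d : ℕ) {b : ℝ} (hb : 0 < b) :
    Integrable (fun ξ : EuclideanSpace ℝ (Fin d) => Real.exp (-b * ‖ξ‖ ^ 2)) := by
  have h := GaussianFourier.integrable_cexp_neg_mul_sq_norm_add (V := EuclideanSpace ℝ (Fin d))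
    (b := (b : ℂ)) (by simpa using hb) 0 0
  have h2 := h.re
  refine h2.congr (Filter.Eventually.of_forall fun ξ => ?_)
  simp only [zero_mul, add_zero, inner_zero_left]
  rw [show (-(b : ℂ) * (‖ξ‖ : ℂ) ^ 2) = ((-b * ‖ξ‖ ^ 2 : ℝ) : ℂ) by push_cast; ring]
  rw [← Complex.ofReal_exp]
  exact Complex.ofReal_re _

theorem sk_gauss_cos (d : ℕ) {b : ℝ} (hb : 0 < b) (x : EuclideanSpace ℝ (Fin d)) :
    ∫ ξ : EuclideanSpace ℝ (Fin d), Real.cos ⟪ξ, x⟫ * Real.exp (-b * ‖ξ‖ ^ 2)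
      = (Real.pi / b) ^ ((d : ℝ) / 2) * Real.exp (-(‖x‖ ^ 2 / (4 * b))) := by
  have hb' : 0 < (b : ℂ).re := by simpa using hb
  have h := GaussianFourier.integral_cexp_neg_mul_sq_norm_add (V := EuclideanSpace ℝ (Fin d))
    hb' Complex.I x
  have hi := GaussianFourier.integrable_cexp_neg_mul_sq_norm_add (V := EuclideanSpace ℝ (Fin d))
    hb' Complex.I x
  have h2 := congrArg Complex.re h
  have h3 := integral_re hi
  simp only [RCLike.re_to_complex] at h3
  rw [← h3] at h2
  have e1 : ∀ ξ : EuclideanSpace ℝ (Fin d),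
      (Complex.exp (-(b : ℂ) * (‖ξ‖ : ℂ) ^ 2 + Complex.I * ((⟪x, ξ⟫ : ℝ) : ℂ))).re
        = Real.cos ⟪ξ, x⟫ * Real.exp (-b * ‖ξ‖ ^ 2) := by
    intro ξ
    rw [Complex.exp_re, real_inner_comm]
    have : (-(b : ℂ) * (‖ξ‖ : ℂ) ^ 2) = ((-b * ‖ξ‖ ^ 2 : ℝ) : ℂ) := by push_cast; ring
    rw [this, Complex.add_re, Complex.add_im, Complex.ofReal_re, Complex.ofReal_im,
      Complex.re_mul_ofReal, Complex.im_mul_ofReal]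
    simp [mul_comm]
  simp only [e1] at h2
  rw [h2]
  have e2 : ((Real.pi : ℂ) / (b : ℂ)) ^ ((Module.finrank ℝ (EuclideanSpace ℝ (Fin d)) : ℂ) / 2)
      * Complex.exp (Complex.I ^ 2 * (‖x‖ : ℂ) ^ 2 / (4 * (b : ℂ)))
      = (((Real.pi / b) ^ ((d : ℝ) / 2) * Real.exp (-(‖x‖ ^ 2 / (4 * b))) : ℝ) : ℂ) := by
    rw [Complex.ofReal_mul, Complex.ofReal_cpow (by positivity), Complex.ofReal_exp]
    simp
    left; congr 1; ring
  rw [e2, Complex.ofReal_re]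

/-- cosine transform of a radial function of `‖ξ‖²` with Gaussian regularisation is
nonnegative and radially decreasing. -/
def SkMon (d : ℕ) (δ : ℝ) (f : ℝ → ℝ) : Prop :=
  ∀ x y : EuclideanSpace ℝ (Fin d), ‖x‖ ≤ ‖y‖ →
    0 ≤ (∫ ξ : EuclideanSpace ℝ (Fin d), Real.cos ⟪ξ, y⟫ * (Real.exp (-δ * ‖ξ‖ ^ 2) * f (‖ξ‖ ^ 2))) ∧
    (∫ ξ : EuclideanSpace ℝ (Fin d), Real.cos ⟪ξ, y⟫ * (Real.exp (-δ * ‖ξ‖ ^ 2) * f (‖ξ‖ ^ 2))) ≤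
    ∫ ξ : EuclideanSpace ℝ (Fin d), Real.cos ⟪ξ, x⟫ * (Real.exp (-δ * ‖ξ‖ ^ 2) * f (‖ξ‖ ^ 2))

theorem SkMon.lim {d : ℕ} {δ : ℝ} (hδ : 0 < δ) {f : ℕ → ℝ → ℝ} {g : ℝ → ℝ} {C : ℝ}
    (hm : ∀ n, Measurable (f n)) (hb : ∀ n, ∀ u, 0 ≤ u → |f n u| ≤ C)
    (ht : ∀ u, 0 ≤ u → Tendsto (fun n => f n u) atTop (𝓝 (g u)))
    (h : ∀ n, SkMon d δ (f n)) : SkMon d δ g := by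
  have key : ∀ x : EuclideanSpace ℝ (Fin d), Tendsto (fun n =>
      ∫ ξ : EuclideanSpace ℝ (Fin d), Real.cos ⟪ξ, x⟫ * (Real.exp (-δ * ‖ξ‖ ^ 2) * f n (‖ξ‖ ^ 2)))
      atTop (𝓝 (∫ ξ : EuclideanSpace ℝ (Fin d),
        Real.cos ⟪ξ, x⟫ * (Real.exp (-δ * ‖ξ‖ ^ 2) * g (‖ξ‖ ^ 2)))) := by
    intro x
    refine tendsto_integral_of_dominated_convergence
      (fun ξ => Real.exp (-δ * ‖ξ‖ ^ 2) * C) ?_ ((sk_gauss_int d hδ).mul_const C) ?_ ?_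
    · intro n
      have := hm n
      apply Measurable.aestronglyMeasurable
      fun_prop
    · intro n
      refine Filter.Eventually.of_forall fun ξ => ?_
      rw [Real.norm_eq_abs, abs_mul, abs_mul, Real.abs_exp]
      have h1 := Real.abs_cos_le_one ⟪ξ, x⟫
      have h2 := hb n (‖ξ‖ ^ 2) (by positivity)
      calc _ ≤ 1 * (Real.exp (-δ * ‖ξ‖ ^ 2) * C) := by gcongr
        _ = _ := one_mul _
    · refine Filter.Eventually.of_forall fun ξ => ?_
      exact ((ht (‖ξ‖ ^ 2) (by positivity)).const_mul _).const_mul _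
  intro x y hxy
  exact ⟨ge_of_tendsto' (key y) fun n => (h n x y hxy).1,
    le_of_tendsto_of_tendsto' (key y) (key x) fun n => (h n x y hxy).2⟩

/-- Laplace transforms of finite measures. -/
def SkLap (f : ℝ → ℝ) : Prop :=
  ∃ ν : Measure NNReal, IsFiniteMeasure ν ∧ ∀ u, 0 ≤ u → f u = ∫ s : NNReal, Real.exp (-(s * u)) ∂ν

theorem sk_lap_int (ν : Measure NNReal) [IsFiniteMeasure ν] {u : ℝ} (hu : 0 ≤ u) :
    Integrable (fun s : NNReal => Real.exp (-(s * u))) ν := by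
  refine Integrable.of_bound (C := 1) (Measurable.aestronglyMeasurable (by fun_prop)) ?_
  refine Filter.Eventually.of_forall fun s => ?_
  rw [Real.norm_eq_abs, Real.abs_exp, Real.exp_le_one_iff]
  have := mul_nonneg s.2 hu
  simpa using this

theorem SkLap.add {f g : ℝ → ℝ} (hf : SkLap f) (hg : SkLap g) : SkLap (fun u => f u + g u) := by
  obtain ⟨μ, _, h1⟩ := hf
  obtain ⟨ν, _, h2⟩ := hg
  refine ⟨μ + ν, inferInstance, fun u hu => ?_⟩
  beta_reduce
  rw [integral_add_measure (sk_lap_int μ hu) (sk_lap_int ν hu), h1 u hu, h2 u hu]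

theorem SkLap.const {c : ℝ} (hc : 0 ≤ c) : SkLap (fun _ => c) := by
  refine ⟨ENNReal.ofReal c • Measure.dirac 0, ?_, fun u hu => ?_⟩
  · exact Measure.smul_finite _ ENNReal.ofReal_ne_top
  · rw [integral_smul_measure, integral_dirac]; simp [hc]

theorem SkLap.mul {f g : ℝ → ℝ} (hf : SkLap f) (hg : SkLap g) : SkLap (fun u => f u * g u) := by
  obtain ⟨μ, _, h1⟩ := hf
  obtain ⟨ν, _, h2⟩ := hg
  refine ⟨μ ∗ ν, inferInstance, fun u hu => ?_⟩
  beta_reduce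
  rw [integral_conv (sk_lap_int _ hu), h1 u hu, h2 u hu, ← integral_mul_const]
  congr 1; ext s
  rw [← integral_const_mul]
  congr 1; ext r
  rw [← Real.exp_add]; push_cast; congr 1; ring

theorem SkLap.pow {f : ℝ → ℝ} (hf : SkLap f) (n : ℕ) : SkLap (fun u => f u ^ n) := by
  induction n with
  | zero => simpa using SkLap.const zero_le_one
  | succ n ih => simpa [pow_succ] using ih.mul hf

theorem SkLap.mon {f : ℝ → ℝ} (hf : SkLap f) (d : ℕ) {δ : ℝ} (hδ : 0 < δ) : SkMon d δ f := by
  obtain ⟨ν, _, h⟩ := hf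
  have key : ∀ x : EuclideanSpace ℝ (Fin d),
      (∫ ξ : EuclideanSpace ℝ (Fin d), Real.cos ⟪ξ, x⟫ * (Real.exp (-δ * ‖ξ‖ ^ 2) * f (‖ξ‖ ^ 2)))
      = ∫ s : NNReal, (Real.pi / (δ + s)) ^ ((d : ℝ) / 2) * Real.exp (-(‖x‖ ^ 2 / (4 * (δ + s)))) ∂ν := by
    intro x
    have e1 : ∀ ξ : EuclideanSpace ℝ (Fin d),
        Real.cos ⟪ξ, x⟫ * (Real.exp (-δ * ‖ξ‖ ^ 2) * f (‖ξ‖ ^ 2))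
        = ∫ s : NNReal, Real.cos ⟪ξ, x⟫ * Real.exp (-(δ + s) * ‖ξ‖ ^ 2) ∂ν := by
      intro ξ
      rw [h _ (by positivity), ← mul_assoc, ← integral_const_mul]
      congr 1; ext s
      rw [mul_assoc, ← Real.exp_add]; congr 2; ring
    simp only [e1]
    rw [integral_integral_swap]
    · congr 1; ext s
      exact sk_gauss_cos d (add_pos_of_pos_of_nonneg hδ s.2) x
    · have hI : Integrable (fun z : EuclideanSpace ℝ (Fin d) × NNReal =>
          Real.exp (-δ * ‖z.1‖ ^ 2) * (1 : ℝ)) (volume.prod ν) :=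
        (sk_gauss_int d hδ).mul_prod (integrable_const (1 : ℝ))
      refine hI.mono' (Measurable.aestronglyMeasurable (by unfold Function.uncurry; fun_prop)) ?_
      refine Filter.Eventually.of_forall fun z => ?_
      simp only [Function.uncurry]
      rw [Real.norm_eq_abs, abs_mul, Real.abs_exp, mul_one]
      calc _ ≤ 1 * Real.exp (-(δ + z.2) * ‖z.1‖ ^ 2) := by
              gcongr; exact Real.abs_cos_le_one _
        _ ≤ _ := by
          rw [one_mul]; apply Real.exp_le_exp.2
          have := mul_nonneg z.2.2 (sq_nonneg ‖z.1‖)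
          have h3 : ((z.2 : NNReal) : ℝ) * ‖z.1‖ ^ 2 ≥ 0 := this
          nlinarith
  have hint : ∀ x : EuclideanSpace ℝ (Fin d), Integrable (fun s : NNReal =>
      (Real.pi / (δ + s)) ^ ((d : ℝ) / 2) * Real.exp (-(‖x‖ ^ 2 / (4 * (δ + s))))) ν := by
    intro x
    refine Integrable.of_bound (C := (Real.pi / δ) ^ ((d : ℝ) / 2))
      (Measurable.aestronglyMeasurable (by fun_prop)) ?_
    refine Filter.Eventually.of_forall fun s => ?_
    have hs : (0 : ℝ) ≤ s := s.2
    rw [Real.norm_eq_abs, abs_of_nonneg (by positivity)]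
    calc _ ≤ (Real.pi / δ) ^ ((d : ℝ) / 2) * 1 := by
            gcongr
            · linarith
            · rw [Real.exp_le_one_iff]
              have : 0 ≤ ‖x‖ ^ 2 / (4 * (δ + s)) := by positivity
              linarith
      _ = _ := mul_one _
  intro x y hxy
  rw [key, key]
  constructor
  · apply integral_nonneg
    intro s
    have hs : (0 : ℝ) ≤ s := s.2
    positivity
  · apply integral_mono (hint y) (hint x)
    intro s
    have hs : (0 : ℝ) ≤ s := s.2
    dsimp only
    gcongr

theorem SkLap.exp_mon {g : ℝ → ℝ} (hg : SkLap g) (hgm : Measurable g) {m : ℝ}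
    (hgb : ∀ u, 0 ≤ u → g u ≤ m) (d : ℕ) {δ : ℝ} (hδ : 0 < δ) :
    SkMon d δ (fun u => Real.exp (-m + g u)) := by
  have hg0 : ∀ u, 0 ≤ u → 0 ≤ g u := by
    obtain ⟨ν, _, h⟩ := hg
    intro u hu
    rw [h u hu]
    exact integral_nonneg fun s => (Real.exp_pos _).le
  refine SkMon.lim hδ (f := fun n u => Real.exp (-m) * (1 + (1 / (n : ℝ)) * g u) ^ n) (C := 1)
    (fun n => by fun_prop) ?_ ?_ ?_
  · intro n u hu
    have h0 := hg0 u hu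
    rw [abs_of_nonneg (by positivity)]
    have : (1 + (1 / (n : ℝ)) * g u) ^ n ≤ Real.exp (g u) := by
      calc (1 + (1 / (n : ℝ)) * g u) ^ n ≤ (Real.exp ((1 / (n : ℝ)) * g u)) ^ n := by
            gcongr
            linarith [Real.add_one_le_exp ((1 / (n : ℝ)) * g u)]
        _ = Real.exp (n * ((1 / (n : ℝ)) * g u)) := by rw [← Real.exp_nat_mul]
        _ ≤ _ := by
          apply Real.exp_le_exp.2
          rcases eq_or_ne (n : ℝ) 0 with h | h
          · simp [h, h0]
          · apply le_of_eq; field_simp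
    calc _ ≤ Real.exp (-m) * Real.exp (g u) := by gcongr
      _ ≤ 1 := by
        rw [← Real.exp_add, Real.exp_le_one_iff]
        linarith [hgb u hu]
  · intro u hu
    rw [Real.exp_add]
    apply Tendsto.const_mul
    have := Real.tendsto_one_add_div_pow_exp (g u)
    refine this.congr fun n => ?_
    congr 2; ring
  · intro n
    apply SkLap.mon _ d hδ
    exact (SkLap.const (Real.exp_pos _).le).mul
      (((SkLap.const zero_le_one).add ((SkLap.const (by positivity)).mul hg)).pow n)
theorem sk_h_int {β : ℝ} (h0 : 0 < β) (h1 : β < 1) {u : ℝ} (hu : 0 ≤ u) :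
    IntegrableOn (fun s : ℝ => (1 - Real.exp (-(s * u))) * s ^ (-1 - β)) (Set.Ioi 0) := by
  rw [← Set.Ioc_union_Ioi_eq_Ioi (zero_le_one' ℝ)]
  apply IntegrableOn.union
  · have hi : IntegrableOn (fun s : ℝ => u * s ^ (-β)) (Set.Ioc 0 1) := by
      have := (intervalIntegral.intervalIntegrable_rpow' (a := 0) (b := 1) (r := -β) (by linarith))
      rw [intervalIntegrable_iff_integrableOn_Ioc_of_le zero_le_one] at this
      exact this.const_mul u
    refine hi.mono' (Measurable.aestronglyMeasurable (by fun_prop)) ?_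
    refine (ae_restrict_iff' measurableSet_Ioc).2 (Filter.Eventually.of_forall fun s hs => ?_)
    have hs0 : 0 < s := hs.1
    have hsu : 0 ≤ s * u := by positivity
    have h2 : Real.exp (-(s * u)) ≤ 1 := Real.exp_le_one_iff.2 (by linarith)
    have h3 := Real.add_one_le_exp (-(s * u))
    rw [Real.norm_eq_abs, abs_of_nonneg (mul_nonneg (by linarith) (by positivity))]
    calc _ ≤ (s * u) * s ^ (-1 - β) := by gcongr; linarith
      _ = u * (s ^ (1 : ℝ) * s ^ (-1 - β)) := by rw [Real.rpow_one]; ring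
      _ = _ := by rw [← Real.rpow_add hs0]; congr 2; ring
  · have hi : IntegrableOn (fun s : ℝ => s ^ (-1 - β)) (Set.Ioi 1) :=
      integrableOn_Ioi_rpow_of_lt (by linarith) zero_lt_one
    refine hi.mono' (Measurable.aestronglyMeasurable (by fun_prop)) ?_
    refine (ae_restrict_iff' measurableSet_Ioi).2 (Filter.Eventually.of_forall fun s hs => ?_)
    have hs0 : 0 < s := zero_lt_one.trans hs
    have hsu : 0 ≤ s * u := by positivity
    have h2 : Real.exp (-(s * u)) ≤ 1 := Real.exp_le_one_iff.2 (by linarith)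
    have h3 := Real.exp_pos (-(s * u))
    rw [Real.norm_eq_abs, abs_of_nonneg (mul_nonneg (by linarith) (by positivity))]
    calc _ ≤ 1 * s ^ (-1 - β) := by gcongr; linarith
      _ = _ := one_mul _

theorem sk_h_scale {β : ℝ} (h0 : 0 < β) {u : ℝ} (hu : 0 ≤ u) :
    ∫ s in Set.Ioi (0 : ℝ), (1 - Real.exp (-(s * u))) * s ^ (-1 - β)
      = u ^ β * ∫ s in Set.Ioi (0 : ℝ), (1 - Real.exp (-s)) * s ^ (-1 - β) := by
  rcases hu.eq_or_lt with rfl | hu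
  · simp [Real.zero_rpow h0.ne']
  · have h := integral_comp_mul_left_Ioi (fun s : ℝ => (1 - Real.exp (-s)) * s ^ (-1 - β)) 0 hu
    rw [mul_zero] at h
    have e : ∀ s ∈ Set.Ioi (0 : ℝ), (1 - Real.exp (-(s * u))) * s ^ (-1 - β)
        = u ^ (1 + β) * ((1 - Real.exp (-(u * s))) * (u * s) ^ (-1 - β)) := by
      intro s hs
      rw [Real.mul_rpow hu.le (le_of_lt hs), mul_comm u s]
      have : u ^ (1 + β) * u ^ (-1 - β) = 1 := by
        rw [← Real.rpow_add hu]; ring_nf; exact Real.rpow_zero u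
      linear_combination -(1 - Real.exp (-(s * u))) * s ^ (-1 - β) * this
    rw [setIntegral_congr_fun measurableSet_Ioi e, integral_const_mul, h, smul_eq_mul, ← mul_assoc]
    congr 1
    rw [← Real.rpow_neg_one, ← Real.rpow_add hu]
    congr 1; ring

theorem sk_C_pos {β : ℝ} (h0 : 0 < β) (h1 : β < 1) :
    0 < ∫ s in Set.Ioi (0 : ℝ), (1 - Real.exp (-s)) * s ^ (-1 - β) := by
  have hi := sk_h_int h0 h1 zero_le_one
  simp only [mul_one] at hi
  have hpos : ∀ s ∈ Set.Ioi (0 : ℝ), 0 < (1 - Real.exp (-s)) * s ^ (-1 - β) := by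
    intro s hs
    have hs : 0 < s := hs
    have : Real.exp (-s) < 1 := by rw [Real.exp_lt_one_iff]; linarith
    exact mul_pos (by linarith) (by positivity)
  rw [setIntegral_pos_iff_support_of_nonneg_ae _ hi]
  · have : Set.Ioi (0 : ℝ) ⊆ Function.support (fun s : ℝ => (1 - Real.exp (-s)) * s ^ (-1 - β)) :=
      fun s hs => (hpos s hs).ne'
    rw [Set.inter_eq_right.2 this]
    simp
  · exact (ae_restrict_iff' measurableSet_Ioi).2
      (Filter.Eventually.of_forall fun s hs => (hpos s hs).le)

theorem sk_lap_trunc {β ε : ℝ} (h0 : 0 < β) (hε : 0 < ε) :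
    SkLap (fun u => ∫ s in Set.Ioi ε, Real.exp (-(s * u)) * s ^ (-1 - β)) := by
  have hi : IntegrableOn (fun s : ℝ => s ^ (-1 - β)) (Set.Ioi ε) :=
    integrableOn_Ioi_rpow_of_lt (by linarith) hε
  refine ⟨((volume.restrict (Set.Ioi ε)).withDensity
    (fun s => ENNReal.ofReal (s ^ (-1 - β)))).map Real.toNNReal, ?_, ?_⟩
  · have : IsFiniteMeasure ((volume.restrict (Set.Ioi ε)).withDensity
        (fun s => ENNReal.ofReal (s ^ (-1 - β)))) := isFiniteMeasure_withDensity_ofReal hi.2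
    infer_instance
  · intro u hu
    rw [integral_map (by fun_prop) (Measurable.aestronglyMeasurable (by fun_prop)),
      integral_withDensity_eq_integral_toReal_smul (by fun_prop) (by simp)]
    refine setIntegral_congr_fun measurableSet_Ioi fun s hs => ?_
    have hs0 : 0 < s := hε.trans hs
    simp only [smul_eq_mul]
    rw [ENNReal.toReal_ofReal (by positivity), Real.coe_toNNReal _ hs0.le, mul_comm]

theorem sk_mon_exp (d : ℕ) {β δ : ℝ} (h0 : 0 < β) (h1 : β < 1) (hδ : 0 < δ) :
    SkMon d δ (fun u => Real.exp (-(u ^ β))) := by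
  set C := ∫ s in Set.Ioi (0 : ℝ), (1 - Real.exp (-s)) * s ^ (-1 - β) with hC
  have hCp : 0 < C := sk_C_pos h0 h1
  set g : ℕ → ℝ → ℝ := fun n u =>
    C⁻¹ * ∫ s in Set.Ioi (1 / ((n : ℝ) + 1)), Real.exp (-(s * u)) * s ^ (-1 - β) with hg
  have hgm : ∀ n, Measurable (g n) := by
    intro n
    apply Measurable.const_mul
    apply StronglyMeasurable.measurable
    apply StronglyMeasurable.integral_prod_right'
      (f := fun z : ℝ × ℝ => Real.exp (-(z.2 * z.1)) * z.2 ^ (-1 - β))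
    apply Measurable.stronglyMeasurable
    fun_prop
  have hint : ∀ n : ℕ, ∀ u, 0 ≤ u → IntegrableOn
      (fun s : ℝ => Real.exp (-(s * u)) * s ^ (-1 - β)) (Set.Ioi (1 / ((n : ℝ) + 1))) := by
    intro n u hu
    have hε : 0 < 1 / ((n : ℝ) + 1) := by positivity
    have hi : IntegrableOn (fun s : ℝ => s ^ (-1 - β)) (Set.Ioi (1 / ((n : ℝ) + 1))) :=
      integrableOn_Ioi_rpow_of_lt (by linarith) hε
    refine hi.mono' (Measurable.aestronglyMeasurable (by fun_prop)) ?_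
    refine (ae_restrict_iff' measurableSet_Ioi).2 (Filter.Eventually.of_forall fun s hs => ?_)
    have hs0 : 0 < s := hε.trans hs
    have hsu : 0 ≤ s * u := by positivity
    have h2 : Real.exp (-(s * u)) ≤ 1 := Real.exp_le_one_iff.2 (by linarith)
    rw [Real.norm_eq_abs, abs_of_nonneg (by positivity)]
    calc _ ≤ 1 * s ^ (-1 - β) := by gcongr
      _ = _ := one_mul _
  have hdiff : ∀ n u, 0 ≤ u → -(g n 0) + g n u = -(C⁻¹ *
      ∫ s in Set.Ioi (1 / ((n : ℝ) + 1)), (1 - Real.exp (-(s * u))) * s ^ (-1 - β)) := by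
    intro n u hu
    have := integral_sub (hint n 0 le_rfl) (hint n u hu)
    simp only [hg]
    have e : ∀ s : ℝ, (1 - Real.exp (-(s * u))) * s ^ (-1 - β) =
      Real.exp (-(s * 0)) * s ^ (-1 - β) - Real.exp (-(s * u)) * s ^ (-1 - β) := by
      intro s; simp; ring
    simp only [e]
    rw [this]; ring
  have hle : ∀ n u, 0 ≤ u → g n u ≤ g n 0 := by
    intro n u hu
    have h := hdiff n u hu
    have : 0 ≤ C⁻¹ * ∫ s in Set.Ioi (1 / ((n : ℝ) + 1)),
        (1 - Real.exp (-(s * u))) * s ^ (-1 - β) := by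
      apply mul_nonneg (by positivity)
      apply setIntegral_nonneg measurableSet_Ioi
      intro s hs
      have hs0 : 0 < s := lt_trans (by positivity) hs
      have hsu : 0 ≤ s * u := by positivity
      have h2 : Real.exp (-(s * u)) ≤ 1 := Real.exp_le_one_iff.2 (by linarith)
      exact mul_nonneg (by linarith) (by positivity)
    linarith
  refine SkMon.lim hδ (f := fun n u => Real.exp (-(g n 0) + g n u)) (C := 1) ?_ ?_ ?_ ?_
  · intro n
    have := hgm n
    fun_prop
  · intro n u hu
    rw [Real.abs_exp, Real.exp_le_one_iff]
    linarith [hle n u hu]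
  · intro u hu
    apply (Real.continuous_exp.tendsto _).comp
    simp only [hdiff _ u hu]
    have hunion : (⋃ n : ℕ, Set.Ioi (1 / ((n : ℝ) + 1))) = Set.Ioi 0 := by
      ext s
      simp only [Set.mem_iUnion, Set.mem_Ioi]
      constructor
      · rintro ⟨n, hn⟩
        exact lt_trans (by positivity) hn
      · intro hs
        exact exists_nat_one_div_lt hs
    have ht := tendsto_setIntegral_of_monotone (μ := volume)
      (s := fun n : ℕ => Set.Ioi (1 / ((n : ℝ) + 1)))
      (f := fun s : ℝ => (1 - Real.exp (-(s * u))) * s ^ (-1 - β))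
      (fun n => measurableSet_Ioi)
      (fun a b hab => Set.Ioi_subset_Ioi (by
        have : (a : ℝ) ≤ b := by exact_mod_cast hab
        gcongr))
      (by rw [hunion]; exact sk_h_int h0 h1 hu)
    rw [hunion, sk_h_scale h0 hu] at ht
    have h3 := (ht.const_mul C⁻¹).neg
    have e : C⁻¹ * (u ^ β * C) = u ^ β := by field_simp
    rw [← hC, e] at h3
    exact h3
  · intro n
    apply SkLap.exp_mon _ (hgm n) (hle n) d hδ
    exact (SkLap.const (by positivity)).mul (sk_lap_trunc h0 (by positivity))

theorem sk_int_exp (d : ℕ) {α : ℝ} (hα : 1 < α) :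
    Integrable (fun ξ : EuclideanSpace ℝ (Fin d) => Real.exp (-(‖ξ‖ ^ α))) := by
  have hi : Integrable (fun ξ : EuclideanSpace ℝ (Fin d) => (1 + ‖ξ‖) ^ (-((d : ℝ) + 1))) :=
    integrable_one_add_norm (by simp)
  refine (hi.const_mul (Real.exp 2 * (d + 1).factorial)).mono'
    (Measurable.aestronglyMeasurable (by fun_prop)) ?_
  refine Filter.Eventually.of_forall fun ξ => ?_
  rw [Real.norm_eq_abs, Real.abs_exp]
  set r := ‖ξ‖ with hr
  have hr0 : 0 ≤ r := norm_nonneg _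
  have h1 : r - 1 ≤ r ^ α := by
    rcases le_total r 1 with h | h
    · have : 0 ≤ r ^ α := by positivity
      linarith
    · have := Real.rpow_le_rpow_of_exponent_le h hα.le
      rw [Real.rpow_one] at this
      linarith
  have h2 : (1 + r) ^ (d + 1) / (d + 1).factorial ≤ Real.exp (1 + r) :=
    Real.pow_div_factorial_le_exp (1 + r) (by linarith) (d + 1)
  have h3 : (1 + r) ^ (-((d : ℝ) + 1)) = ((1 + r) ^ (d + 1))⁻¹ := by
    rw [Real.rpow_neg (by linarith)]
    congr 1
    exact_mod_cast Real.rpow_natCast (1 + r) (d + 1)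
  rw [h3]
  calc Real.exp (-(r ^ α)) ≤ Real.exp (2 - (1 + r)) := Real.exp_le_exp.2 (by linarith)
    _ = Real.exp 2 * (Real.exp (1 + r))⁻¹ := by rw [Real.exp_sub]; rfl
    _ ≤ Real.exp 2 * ((1 + r) ^ (d + 1) / (d + 1).factorial)⁻¹ := by gcongr
    _ = _ := by rw [inv_div]; ring

/-- unnormalised density at time one -/
noncomputable def skP (d : ℕ) (α : ℝ) (x : EuclideanSpace ℝ (Fin d)) : ℝ :=
  ∫ ξ : EuclideanSpace ℝ (Fin d), Real.cos ⟪ξ, x⟫ * Real.exp (-(‖ξ‖ ^ α))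

theorem skP_mon (d : ℕ) {α : ℝ} (hα1 : 1 < α) (hα2 : α < 2) (x y : EuclideanSpace ℝ (Fin d))
    (hxy : ‖x‖ ≤ ‖y‖) : 0 ≤ skP d α y ∧ skP d α y ≤ skP d α x := by
  have key : ∀ x : EuclideanSpace ℝ (Fin d), Tendsto (fun n : ℕ =>
      ∫ ξ : EuclideanSpace ℝ (Fin d), Real.cos ⟪ξ, x⟫ *
        (Real.exp (-(1 / ((n : ℝ) + 1)) * ‖ξ‖ ^ 2) * Real.exp (-((‖ξ‖ ^ 2) ^ (α / 2)))))
      atTop (𝓝 (skP d α x)) := by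
    intro x
    refine tendsto_integral_of_dominated_convergence
      (fun ξ => Real.exp (-(‖ξ‖ ^ α))) ?_ (sk_int_exp d hα1) ?_ ?_
    · intro n
      apply Measurable.aestronglyMeasurable
      fun_prop
    · intro n
      refine Filter.Eventually.of_forall fun ξ => ?_
      rw [Real.norm_eq_abs, abs_mul, abs_mul, Real.abs_exp, Real.abs_exp, ← Real.rpow_natCast,
        ← Real.rpow_mul (norm_nonneg _)]
      have h1 := Real.abs_cos_le_one ⟪ξ, x⟫
      have h2 : Real.exp (-(1 / ((n : ℝ) + 1)) * ‖ξ‖ ^ ((2 : ℕ) : ℝ)) ≤ 1 := by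
        rw [Real.exp_le_one_iff, neg_mul]
        have : 0 ≤ (1 / ((n : ℝ) + 1)) * ‖ξ‖ ^ ((2 : ℕ) : ℝ) := by positivity
        linarith
      have e : ((2 : ℕ) : ℝ) * (α / 2) = α := by push_cast; ring
      rw [e]
      calc _ ≤ 1 * (1 * Real.exp (-‖ξ‖ ^ α)) := by gcongr
        _ = _ := by ring
    · refine Filter.Eventually.of_forall fun ξ => ?_
      apply Tendsto.const_mul
      have e : (‖ξ‖ ^ 2) ^ (α / 2) = ‖ξ‖ ^ α := by
        rw [← Real.rpow_natCast, ← Real.rpow_mul (norm_nonneg _)]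
        congr 1; push_cast; ring
      rw [e]
      have h1 : Tendsto (fun n : ℕ => -(1 / ((n : ℝ) + 1)) * ‖ξ‖ ^ 2) atTop (𝓝 (-0 * ‖ξ‖ ^ 2)) :=
        (tendsto_one_div_add_atTop_nhds_zero_nat.neg).mul_const _
      have h2 := ((Real.continuous_exp.tendsto _).comp h1).mul_const (Real.exp (-‖ξ‖ ^ α))
      simpa using h2
  have hm := fun n : ℕ => sk_mon_exp d (β := α / 2) (δ := 1 / ((n : ℝ) + 1)) (by linarith)
    (by linarith) (by positivity) x y hxy
  exact ⟨ge_of_tendsto' (key y) fun n => (hm n).1,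
    le_of_tendsto_of_tendsto' (key y) (key x) fun n => (hm n).2⟩
theorem skP_meas (d : ℕ) (α : ℝ) : Measurable (skP d α) := by
  apply StronglyMeasurable.measurable
  apply StronglyMeasurable.integral_prod_right'
    (f := fun z : EuclideanSpace ℝ (Fin d) × EuclideanSpace ℝ (Fin d) =>
      Real.cos ⟪z.2, z.1⟫ * Real.exp (-(‖z.2‖ ^ α)))
  apply Measurable.stronglyMeasurable
  fun_prop

theorem skP_le (d : ℕ) {α : ℝ} (hα1 : 1 < α) (x : EuclideanSpace ℝ (Fin d)) :
    |skP d α x| ≤ ∫ ξ : EuclideanSpace ℝ (Fin d), Real.exp (-(‖ξ‖ ^ α)) := by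
  rw [← Real.norm_eq_abs]
  apply norm_integral_le_of_norm_le (sk_int_exp d hα1)
  refine Filter.Eventually.of_forall fun ξ => ?_
  rw [Real.norm_eq_abs, abs_mul, Real.abs_exp]
  calc _ ≤ 1 * Real.exp (-(‖ξ‖ ^ α)) := by gcongr; exact Real.abs_cos_le_one _
    _ = _ := one_mul _

theorem skP_gauss_int (d : ℕ) {α a : ℝ} (hα1 : 1 < α) (ha : 0 < a) :
    Integrable (fun y : EuclideanSpace ℝ (Fin d) => skP d α y * Real.exp (-a * ‖y‖ ^ 2)) := by
  have hm := skP_meas d α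
  refine ((sk_gauss_int d ha).const_mul
    (∫ ξ : EuclideanSpace ℝ (Fin d), Real.exp (-(‖ξ‖ ^ α)))).mono'
    (Measurable.aestronglyMeasurable (by fun_prop)) ?_
  refine Filter.Eventually.of_forall fun ξ => ?_
  rw [Real.norm_eq_abs, abs_mul, Real.abs_exp]
  gcongr
  exact skP_le d hα1 ξ

theorem sk_id (d : ℕ) {α a : ℝ} (hα1 : 1 < α) (ha : 0 < a) :
    ∫ y : EuclideanSpace ℝ (Fin d), skP d α y * Real.exp (-a * ‖y‖ ^ 2)
     = ∫ ξ : EuclideanSpace ℝ (Fin d), Real.exp (-(‖ξ‖ ^ α)) *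
        ((Real.pi / a) ^ ((d : ℝ) / 2) * Real.exp (-(‖ξ‖ ^ 2 / (4 * a)))) := by
  have e1 : ∀ y : EuclideanSpace ℝ (Fin d), skP d α y * Real.exp (-a * ‖y‖ ^ 2)
      = ∫ ξ : EuclideanSpace ℝ (Fin d),
        Real.exp (-(‖ξ‖ ^ α)) * (Real.cos ⟪y, ξ⟫ * Real.exp (-a * ‖y‖ ^ 2)) := by
    intro y
    rw [skP, ← integral_mul_const]
    congr 1; ext ξ
    rw [real_inner_comm]; ring
  simp only [e1]
  rw [integral_integral_swap]
  · congr 1; ext ξ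
    rw [integral_const_mul, sk_gauss_cos d ha ξ]
  · have hI := (sk_gauss_int d ha).mul_prod (sk_int_exp d hα1)
    refine hI.mono' (Measurable.aestronglyMeasurable (by unfold Function.uncurry; fun_prop)) ?_
    refine Filter.Eventually.of_forall fun z => ?_
    simp only [Function.uncurry]
    rw [Real.norm_eq_abs, abs_mul, abs_mul, Real.abs_exp, Real.abs_exp, mul_comm]
    gcongr
    calc _ ≤ 1 * Real.exp (-a * ‖z.1‖ ^ 2) := by gcongr; exact Real.abs_cos_le_one _
      _ = _ := one_mul _

theorem sk_id2 (d : ℕ) {α s : ℝ} (hα1 : 1 < α) (hs : 0 < s) :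
    ∫ y : EuclideanSpace ℝ (Fin d), skP d α y * Real.exp (-(s ^ 2 / 4) * ‖y‖ ^ 2)
     = (4 * Real.pi) ^ ((d : ℝ) / 2) * ∫ ζ : EuclideanSpace ℝ (Fin d),
        Real.exp (-(s ^ α * ‖ζ‖ ^ α)) * Real.exp (-1 * ‖ζ‖ ^ 2) := by
  rw [sk_id d hα1 (by positivity)]
  have h := Measure.integral_comp_smul (volume : Measure (EuclideanSpace ℝ (Fin d)))
    (fun ξ => Real.exp (-(‖ξ‖ ^ α)) *
        ((Real.pi / (s ^ 2 / 4)) ^ ((d : ℝ) / 2) * Real.exp (-(‖ξ‖ ^ 2 / (4 * (s ^ 2 / 4)))))) s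
  rw [abs_of_nonneg (by positivity), smul_eq_mul, finrank_euclideanSpace, Fintype.card_fin] at h
  have h' := congrArg (fun v => s ^ d * v) h
  beta_reduce at h'
  rw [← mul_assoc, mul_inv_cancel₀ (by positivity), one_mul] at h'
  rw [← h', ← integral_const_mul, ← integral_const_mul]
  congr 1; ext ζ
  rw [norm_smul, Real.norm_eq_abs, abs_of_pos hs, Real.mul_rpow hs.le (norm_nonneg _)]
  have e1 : (s * ‖ζ‖) ^ 2 / (4 * (s ^ 2 / 4)) = ‖ζ‖ ^ 2 := by field_simp
  have e2 : s ^ d * (Real.pi / (s ^ 2 / 4)) ^ ((d : ℝ) / 2) = (4 * Real.pi) ^ ((d : ℝ) / 2) := by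
    have : s ^ d = (s ^ 2) ^ ((d : ℝ) / 2) := by
      rw [← Real.rpow_natCast s 2, ← Real.rpow_mul hs.le, ← Real.rpow_natCast]
      congr 1; push_cast; ring
    rw [this, ← Real.mul_rpow (by positivity) (by positivity)]
    congr 1; field_simp
  rw [e1, ← e2]
  ring_nf

/-- difference of two Gaussian averages -/
noncomputable def skD (d : ℕ) (α s : ℝ) : ℝ :=
  ∫ y : EuclideanSpace ℝ (Fin d), skP d α y *
    (Real.exp (-((s / 2) ^ 2 / 4) * ‖y‖ ^ 2) - Real.exp (-(s ^ 2 / 4) * ‖y‖ ^ 2))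

theorem skD_int (d : ℕ) {α s : ℝ} (hα1 : 1 < α) (hs : 0 < s) :
    Integrable fun y : EuclideanSpace ℝ (Fin d) => skP d α y *
    (Real.exp (-((s / 2) ^ 2 / 4) * ‖y‖ ^ 2) - Real.exp (-(s ^ 2 / 4) * ‖y‖ ^ 2)) := by
  simp only [mul_sub]
  exact (skP_gauss_int d hα1 (by positivity)).sub (skP_gauss_int d hα1 (by positivity))

theorem sk_G_int (d : ℕ) {α s : ℝ} (hs : 0 < s) :
    Integrable fun ζ : EuclideanSpace ℝ (Fin d) =>
      Real.exp (-(s ^ α * ‖ζ‖ ^ α)) * Real.exp (-1 * ‖ζ‖ ^ 2) := by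
  refine (sk_gauss_int d one_pos).mono' (Measurable.aestronglyMeasurable (by fun_prop)) ?_
  refine Filter.Eventually.of_forall fun ζ => ?_
  rw [Real.norm_eq_abs, abs_mul, Real.abs_exp, Real.abs_exp]
  have : Real.exp (-(s ^ α * ‖ζ‖ ^ α)) ≤ 1 := by
    rw [Real.exp_le_one_iff]
    have : 0 ≤ s ^ α * ‖ζ‖ ^ α := by positivity
    linarith
  calc _ ≤ 1 * Real.exp (-1 * ‖ζ‖ ^ 2) := by gcongr
    _ = _ := one_mul _

theorem skD_eq (d : ℕ) {α s : ℝ} (hα1 : 1 < α) (hs : 0 < s) :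
    skD d α s = (4 * Real.pi) ^ ((d : ℝ) / 2) * ∫ ζ : EuclideanSpace ℝ (Fin d),
      (Real.exp (-((s / 2) ^ α * ‖ζ‖ ^ α)) * Real.exp (-1 * ‖ζ‖ ^ 2) -
        Real.exp (-(s ^ α * ‖ζ‖ ^ α)) * Real.exp (-1 * ‖ζ‖ ^ 2)) := by
  have hs2 : 0 < s / 2 := by positivity
  rw [integral_sub (sk_G_int d hs2) (sk_G_int d hs), mul_sub, ← sk_id2 d hα1 hs,
    ← sk_id2 d hα1 hs2, ← integral_sub (skP_gauss_int d hα1 (by positivity))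
      (skP_gauss_int d hα1 (by positivity)), skD]
  simp only [mul_sub]

theorem skD_upper (d : ℕ) {α : ℝ} (hα1 : 1 < α) (hα2 : α < 2) :
    ∃ C : ℝ, 0 < C ∧ ∀ s, 0 < s → skD d α s ≤ C * s ^ α := by
  refine ⟨(4 * Real.pi) ^ ((d : ℝ) / 2) * (2 * ∫ ζ : EuclideanSpace ℝ (Fin d),
    Real.exp (-(1 / 2) * ‖ζ‖ ^ 2)), ?_, ?_⟩
  · rw [GaussianFourier.integral_rexp_neg_mul_sq_norm (by norm_num)]
    positivity
  · intro s hs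
    rw [skD_eq d hα1 hs, mul_assoc]
    apply mul_le_mul_of_nonneg_left _ (by positivity)
    rw [mul_comm _ (s ^ α), ← integral_const_mul, ← integral_const_mul]
    apply integral_mono ((sk_G_int d (by positivity)).sub (sk_G_int d hs))
      (((sk_gauss_int d (by norm_num)).const_mul _).const_mul _)
    intro ζ
    simp only [Pi.sub_apply]
    set r := ‖ζ‖ with hr
    have hr0 : 0 ≤ r := norm_nonneg _
    have hA : 0 ≤ s ^ α * r ^ α := by positivity
    have h1 : Real.exp (-((s / 2) ^ α * r ^ α)) ≤ 1 := by
      rw [Real.exp_le_one_iff]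
      have : 0 ≤ (s / 2) ^ α * r ^ α := by positivity
      linarith
    have h2 := Real.add_one_le_exp (-(s ^ α * r ^ α))
    have h3 : r ^ α ≤ 1 + r ^ 2 := by
      rcases le_total r 1 with h | h
      · have := Real.rpow_le_one hr0 h (by linarith : 0 ≤ α)
        nlinarith
      · have := Real.rpow_le_rpow_of_exponent_le h hα2.le
        rw [Real.rpow_two] at this
        linarith
    have h4 : 1 + r ^ 2 ≤ 2 * Real.exp ((1 / 2) * r ^ 2) := by
      have := Real.add_one_le_exp ((1 / 2) * r ^ 2)
      linarith
    calc _ = (Real.exp (-((s / 2) ^ α * r ^ α)) - Real.exp (-(s ^ α * r ^ α)))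
          * Real.exp (-1 * r ^ 2) := by ring
      _ ≤ (s ^ α * r ^ α) * Real.exp (-1 * r ^ 2) := by gcongr; linarith
      _ ≤ (s ^ α * (2 * Real.exp ((1 / 2) * r ^ 2))) * Real.exp (-1 * r ^ 2) := by
          gcongr; linarith
      _ = s ^ α * (2 * (Real.exp ((1 / 2) * r ^ 2) * Real.exp (-1 * r ^ 2))) := by ring
      _ = _ := by rw [← Real.exp_add]; congr 3; ring

theorem sk_exp_diff (A B : ℝ) : Real.exp (-A) * (A - B) ≤ Real.exp (-B) - Real.exp (-A) := by
  have h := Real.add_one_le_exp (A - B)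
  have e : Real.exp (-B) = Real.exp (-A) * Real.exp (A - B) := by
    rw [← Real.exp_add]; congr 1; ring
  rw [e]
  nlinarith [Real.exp_pos (-A)]

theorem sk_ball_le {d : ℕ} {f : EuclideanSpace ℝ (Fin d) → ℝ} (hf : Integrable f)
    (h0 : ∀ y, 0 ≤ f y) {z : EuclideanSpace ℝ (Fin d)} {r m : ℝ}
    (hm : ∀ y ∈ Metric.ball z r, m ≤ f y) :
    m * (volume (Metric.ball z r)).toReal ≤ ∫ y, f y := by
  calc _ = ∫ y in Metric.ball z r, m := by
        rw [setIntegral_const, smul_eq_mul, mul_comm]; rfl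
    _ ≤ ∫ y in Metric.ball z r, f y := by
        apply setIntegral_mono_on _ hf.integrableOn measurableSet_ball hm
        exact integrableOn_const measure_ball_lt_top.ne
    _ ≤ _ := setIntegral_le_integral hf (Filter.Eventually.of_forall h0)

theorem skD_lower (d : ℕ) (hd : 1 ≤ d) {α : ℝ} (hα1 : 1 < α) :
    ∃ c : ℝ, 0 < c ∧ ∀ s, 0 < s → s ≤ 1 → c * s ^ α ≤ skD d α s := by
  have : Nonempty (Fin d) := ⟨⟨0, hd⟩⟩
  obtain ⟨z, hz⟩ := exists_norm_eq (EuclideanSpace ℝ (Fin d)) (c := 3 / 4) (by norm_num)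
  set V := (volume (Metric.ball z (1 / 4))).toReal with hV
  have hVp : 0 < V := ENNReal.toReal_pos (Metric.measure_ball_pos _ _ (by norm_num)).ne'
    measure_ball_lt_top.ne
  have h2α : (1 / 2 : ℝ) ^ α < 1 := Real.rpow_lt_one (by norm_num) (by norm_num) (by linarith)
  refine ⟨(4 * Real.pi) ^ ((d : ℝ) / 2) *
    ((Real.exp (-1) * ((1 / 2) ^ α * (1 - (1 / 2) ^ α)) * Real.exp (-1)) * V), ?_, ?_⟩
  · have : 0 < 1 - (1 / 2 : ℝ) ^ α := by linarith
    positivity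
  · intro s hs hs1
    rw [skD_eq d hα1 hs, mul_assoc]
    apply mul_le_mul_of_nonneg_left _ (by positivity)
    have key : ∀ ζ : EuclideanSpace ℝ (Fin d),
        Real.exp (-(s ^ α * ‖ζ‖ ^ α)) * ((s ^ α * ‖ζ‖ ^ α) * (1 - (1 / 2) ^ α))
          * Real.exp (-1 * ‖ζ‖ ^ 2) ≤
        Real.exp (-((s / 2) ^ α * ‖ζ‖ ^ α)) * Real.exp (-1 * ‖ζ‖ ^ 2) -
        Real.exp (-(s ^ α * ‖ζ‖ ^ α)) * Real.exp (-1 * ‖ζ‖ ^ 2) := by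
      intro ζ
      rw [← sub_mul]
      apply mul_le_mul_of_nonneg_right _ (Real.exp_pos _).le
      refine le_trans (le_of_eq ?_) (sk_exp_diff _ _)
      rw [div_eq_mul_one_div s 2, Real.mul_rpow hs.le (by norm_num)]
      ring
    have h1m : 0 ≤ 1 - (1 / 2 : ℝ) ^ α := by linarith
    refine le_trans (le_of_eq ?_) (sk_ball_le (z := z) (r := 1 / 4)
      (m := s ^ α * (Real.exp (-1) * ((1 / 2) ^ α * (1 - (1 / 2) ^ α)) * Real.exp (-1)))
      ((sk_G_int d (by positivity)).sub (sk_G_int d hs)) ?_ ?_)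
    · rw [hV]; ring
    · intro ζ
      exact le_trans (by positivity) (key ζ)
    · intro ζ hζ
      refine le_trans ?_ (key ζ)
      rw [Metric.mem_ball, dist_eq_norm] at hζ
      have hl : 1 / 2 ≤ ‖ζ‖ := by
        have := norm_sub_norm_le z ζ
        rw [norm_sub_rev] at this
        linarith
      have hu : ‖ζ‖ ≤ 1 := by
        have := norm_sub_norm_le ζ z
        linarith
      have e1 : (1 / 2 : ℝ) ^ α ≤ ‖ζ‖ ^ α := by gcongr
      have e2 : s ^ α * ‖ζ‖ ^ α ≤ 1 :=
        mul_le_one₀ (Real.rpow_le_one hs.le hs1 (by linarith)) (by positivity)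
          (Real.rpow_le_one (norm_nonneg _) hu (by linarith))
      have e3 : Real.exp (-1) ≤ Real.exp (-(s ^ α * ‖ζ‖ ^ α)) := Real.exp_le_exp.2 (by linarith)
      have e4 : Real.exp (-1) ≤ Real.exp (-1 * ‖ζ‖ ^ 2) := Real.exp_le_exp.2 (by
        nlinarith [norm_nonneg ζ])
      calc _ = Real.exp (-1) * ((s ^ α * (1 / 2) ^ α) * (1 - (1 / 2) ^ α)) * Real.exp (-1) := by
            ring
        _ ≤ _ := by gcongr
theorem skP_upper (d : ℕ) (hd : 1 ≤ d) {α : ℝ} (hα1 : 1 < α) (hα2 : α < 2) :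
    ∃ C : ℝ, 0 < C ∧ ∀ x : EuclideanSpace ℝ (Fin d), x ≠ 0 →
      skP d α x ≤ C * ‖x‖ ^ (-((d : ℝ) + α)) := by
  have : Nonempty (Fin d) := ⟨⟨0, hd⟩⟩
  obtain ⟨C, hC, hD⟩ := skD_upper d hα1 hα2
  set V := (volume (Metric.ball (0 : EuclideanSpace ℝ (Fin d)) 1)).toReal with hV
  have hVp : 0 < V := ENNReal.toReal_pos (Metric.measure_ball_pos _ _ (by norm_num)).ne'
    measure_ball_lt_top.ne
  refine ⟨C * 4 ^ α * 4 ^ d / (Real.exp (-4) * (3 / 4) * V), by positivity, fun x hx => ?_⟩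
  set N := ‖x‖ with hN
  have hNp : 0 < N := norm_pos_iff.2 hx
  obtain ⟨z, hz⟩ := exists_norm_eq (EuclideanSpace ℝ (Fin d)) (c := 3 * N / 4) (by positivity)
  have hs : 0 < 4 / N := by positivity
  have hx0 : 0 ≤ skP d α x := (skP_mon d hα1 hα2 x x le_rfl).1
  have h1 := sk_ball_le (z := z) (r := N / 4) (m := skP d α x * (Real.exp (-4) * (3 / 4)))
    (skD_int d hα1 hs) ?_ ?_
  · have h2 := h1.trans (hD _ hs)
    rw [Measure.addHaar_ball _ _ (by positivity), ENNReal.toReal_mul,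
      ENNReal.toReal_ofReal (by positivity), finrank_euclideanSpace, Fintype.card_fin, ← hV] at h2
    rw [Real.rpow_neg hNp.le, Real.rpow_add hNp, Real.rpow_natCast]
    rw [Real.div_rpow (by norm_num) hNp.le] at h2
    rw [div_pow] at h2
    have hNα : 0 < N ^ α := by positivity
    have hNd : 0 < N ^ d := by positivity
    rw [div_mul_eq_mul_div, le_div_iff₀ (by positivity)]
    have h3 := mul_le_mul_of_nonneg_right h2 (by positivity : 0 ≤ (4 : ℝ) ^ d / N ^ d)
    calc _ = skP d α x * (Real.exp (-4) * (3 / 4)) * (N ^ d / 4 ^ d * V) * (4 ^ d / N ^ d) := by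
          field_simp
      _ ≤ _ := h3
      _ = _ := by field_simp
  · intro y
    apply mul_nonneg (skP_mon d hα1 hα2 y y le_rfl).1
    rw [sub_nonneg]
    apply Real.exp_le_exp.2
    have : 0 ≤ (4 / N) ^ 2 * ‖y‖ ^ 2 := by positivity
    nlinarith
  · intro y hy
    rw [Metric.mem_ball, dist_eq_norm] at hy
    have hl : N / 2 ≤ ‖y‖ := by
      have := norm_sub_norm_le z y
      rw [norm_sub_rev] at this
      linarith
    have hu : ‖y‖ ≤ N := by
      have := norm_sub_norm_le y z
      linarith
    have hxy := (skP_mon d hα1 hα2 y x hu).2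
    have hw : 1 ≤ (‖y‖ / N) ^ 2 * 4 := by
      have : 1 / 2 ≤ ‖y‖ / N := by rw [le_div_iff₀ hNp]; linarith
      nlinarith
    have hw2 : (‖y‖ / N) ^ 2 ≤ 1 := by
      have : ‖y‖ / N ≤ 1 := by rw [div_le_one hNp]; exact hu
      have h0 : 0 ≤ ‖y‖ / N := by positivity
      nlinarith
    have e1 : -((4 / N / 2) ^ 2 / 4) * ‖y‖ ^ 2 = -((‖y‖ / N) ^ 2) := by field_simp; ring
    have e2 : -((4 / N) ^ 2 / 4) * ‖y‖ ^ 2 = -(4 * (‖y‖ / N) ^ 2) := by field_simp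
    rw [e1, e2]
    set w := (‖y‖ / N) ^ 2
    have h5 := sk_exp_diff (4 * w) w
    have h6 : Real.exp (-4) ≤ Real.exp (-(4 * w)) := Real.exp_le_exp.2 (by linarith)
    have h7 : Real.exp (-4) * (3 / 4) ≤ Real.exp (-w) - Real.exp (-(4 * w)) := by
      refine le_trans ?_ h5
      gcongr
      linarith
    have hy0 := hx0.trans hxy
    gcongr

theorem sk_exp_diff' {A B : ℝ} (hB : 0 ≤ B) (hBA : B ≤ A) :
    Real.exp (-B) - Real.exp (-A) ≤ A - B := by
  have h := Real.add_one_le_exp (-(A - B))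
  have e : Real.exp (-A) = Real.exp (-B) * Real.exp (-(A - B)) := by
    rw [← Real.exp_add]; congr 1; ring
  have h1 : Real.exp (-B) ≤ 1 := Real.exp_le_one_iff.2 (by linarith)
  have h2 := Real.exp_pos (-B)
  have h3 : Real.exp (-(A - B)) ≤ 1 := Real.exp_le_one_iff.2 (by linarith)
  rw [e]
  nlinarith

theorem skP_compare (d : ℕ) {α : ℝ} (hα1 : 1 < α) (hα2 : α < 2) {M : ℝ} (hM : 0 < M)
    (x : EuclideanSpace ℝ (Fin d)) (hx : x ≠ 0) :
    skD d α (1 / (M * ‖x‖)) ≤ Real.exp 1 / (4 * M ^ 2) * skD d α (2 / ‖x‖)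
      + skP d α x * ((16 * Real.pi) ^ ((d : ℝ) / 2) * (M * ‖x‖) ^ d) := by
  set N := ‖x‖ with hN
  have hNp : 0 < N := norm_pos_iff.2 hx
  have hs : 0 < 1 / (M * N) := by positivity
  have hs1 : 0 < 2 / N := by positivity
  have hb : 0 < (1 / (M * N) / 2) ^ 2 / 4 := by positivity
  have hx0 : 0 ≤ skP d α x := (skP_mon d hα1 hα2 x x le_rfl).1
  have e0 : ∫ y : EuclideanSpace ℝ (Fin d), Real.exp (-((1 / (M * N) / 2) ^ 2 / 4) * ‖y‖ ^ 2)
      = (16 * Real.pi) ^ ((d : ℝ) / 2) * (M * N) ^ d := by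
    rw [GaussianFourier.integral_rexp_neg_mul_sq_norm hb, finrank_euclideanSpace, Fintype.card_fin]
    have : (M * N) ^ d = ((M * N) ^ 2) ^ ((d : ℝ) / 2) := by
      rw [← Real.rpow_natCast (M * N) 2, ← Real.rpow_mul (by positivity), ← Real.rpow_natCast]
      congr 1; push_cast; ring
    rw [this, ← Real.mul_rpow (by positivity) (by positivity)]
    congr 1; field_simp; ring
  rw [← e0, skD, skD, ← integral_const_mul, ← integral_const_mul,
    ← integral_add ((skD_int d hα1 hs1).const_mul _) ((sk_gauss_int d hb).const_mul _)]
  apply integral_mono (skD_int d hα1 hs)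
    (((skD_int d hα1 hs1).const_mul _).add ((sk_gauss_int d hb).const_mul _))
  intro y
  simp only [Pi.add_apply]
  have hy0 : 0 ≤ skP d α y := (skP_mon d hα1 hα2 y y le_rfl).1
  set w := (‖y‖ / N) ^ 2 with hw
  have hw0 : 0 ≤ w := by positivity
  have e1 : -((2 / N / 2) ^ 2 / 4) * ‖y‖ ^ 2 = -(w / 4) := by rw [hw]; field_simp
  have e2 : -((2 / N) ^ 2 / 4) * ‖y‖ ^ 2 = -w := by rw [hw]; field_simp; ring
  have e3 : -((1 / (M * N) / 2) ^ 2 / 4) * ‖y‖ ^ 2 = -(w / (16 * M ^ 2)) := by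
    rw [hw]; field_simp; ring
  have e4 : -((1 / (M * N)) ^ 2 / 4) * ‖y‖ ^ 2 = -(w / (4 * M ^ 2)) := by rw [hw]; field_simp
  rw [e1, e2, e3, e4]
  have hpos1 := Real.exp_pos (-(w / (16 * M ^ 2)))
  rcases le_total ‖y‖ N with h | h
  · have hw1 : w ≤ 1 := by
      have h1 : ‖y‖ / N ≤ 1 := by rw [div_le_one hNp]; exact h
      have h0 : 0 ≤ ‖y‖ / N := by positivity
      rw [hw]; nlinarith
    have h1 : Real.exp (-(w / (16 * M ^ 2))) - Real.exp (-(w / (4 * M ^ 2)))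
        ≤ w / (4 * M ^ 2) - w / (16 * M ^ 2) :=
      sk_exp_diff' (by positivity) (by gcongr; norm_num)
    have h2 : Real.exp (-1) * (3 / 4 * w) ≤ Real.exp (-(w / 4)) - Real.exp (-w) := by
      refine le_trans ?_ (sk_exp_diff w (w / 4))
      have : Real.exp (-1) ≤ Real.exp (-w) := Real.exp_le_exp.2 (by linarith)
      calc _ ≤ Real.exp (-w) * (3 / 4 * w) := by gcongr
        _ = _ := by ring
    have h3 : w / (4 * M ^ 2) - w / (16 * M ^ 2)
        = Real.exp 1 / (4 * M ^ 2) * (Real.exp (-1) * (3 / 4 * w)) := by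
      have : Real.exp 1 * Real.exp (-1) = 1 := by rw [← Real.exp_add]; simp
      calc _ = 1 * (3 / 4 * w) / (4 * M ^ 2) := by field_simp; ring
        _ = (Real.exp 1 * Real.exp (-1)) * (3 / 4 * w) / (4 * M ^ 2) := by rw [this]
        _ = _ := by ring
    have h4 : Real.exp (-(w / (16 * M ^ 2))) - Real.exp (-(w / (4 * M ^ 2))) ≤
        Real.exp 1 / (4 * M ^ 2) * (Real.exp (-(w / 4)) - Real.exp (-w)) := by
      rw [h3] at h1
      refine h1.trans ?_
      gcongr
    have h5 := mul_le_mul_of_nonneg_left h4 hy0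
    have h6 : 0 ≤ skP d α x * Real.exp (-(w / (16 * M ^ 2))) := by positivity
    linarith
  · have hyx := (skP_mon d hα1 hα2 x y h).2
    have h1 : 0 ≤ Real.exp (-(w / 4)) - Real.exp (-w) := by
      rw [sub_nonneg]; exact Real.exp_le_exp.2 (by linarith)
    have h2 := Real.exp_pos (-(w / (4 * M ^ 2)))
    have h3 : 0 ≤ Real.exp 1 / (4 * M ^ 2) *
        (skP d α y * (Real.exp (-(w / 4)) - Real.exp (-w))) := by positivity
    have h4 : skP d α y * (Real.exp (-(w / (16 * M ^ 2))) - Real.exp (-(w / (4 * M ^ 2))))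
        ≤ skP d α y * Real.exp (-(w / (16 * M ^ 2))) := by gcongr; linarith
    have h5 : skP d α y * Real.exp (-(w / (16 * M ^ 2)))
        ≤ skP d α x * Real.exp (-(w / (16 * M ^ 2))) := by gcongr
    linarith

theorem skP_lower (d : ℕ) (hd : 1 ≤ d) {α : ℝ} (hα1 : 1 < α) (hα2 : α < 2) :
    ∃ c : ℝ, 0 < c ∧ ∀ x : EuclideanSpace ℝ (Fin d), 1 ≤ ‖x‖ →
      c * ‖x‖ ^ (-((d : ℝ) + α)) ≤ skP d α x := by
  obtain ⟨C, hC, hDu⟩ := skD_upper d hα1 hα2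
  obtain ⟨c, hc, hDl⟩ := skD_lower d hd hα1
  have hex : ∃ M : ℝ, 1 ≤ M ∧ Real.exp 1 / 4 * C * 2 ^ α / (c / 2) ≤ M ^ (2 - α) := by
    have ht := tendsto_rpow_atTop (by linarith : 0 < 2 - α)
    exact ((eventually_ge_atTop 1).and (ht.eventually_ge_atTop _)).exists
  obtain ⟨M, hM1, hM⟩ := hex
  have hMp : 0 < M := by linarith
  set κ := (16 * Real.pi) ^ ((d : ℝ) / 2) * M ^ d with hκ
  have hκp : 0 < κ := by positivity
  refine ⟨c / 2 * M ^ (-α) / κ, by positivity, fun x hx1 => ?_⟩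
  set N := ‖x‖ with hN
  have hNp : 0 < N := by linarith
  have hx : x ≠ 0 := norm_pos_iff.1 hNp
  have h1 := skP_compare d hα1 hα2 hMp x hx
  rw [← hN] at h1
  have h2 := hDu (2 / N) (by positivity)
  have hMN : 1 / (M * N) ≤ 1 := by
    rw [div_le_one (by positivity)]; nlinarith
  have h3 := hDl (1 / (M * N)) (by positivity) hMN
  have e1 : (1 / (M * N)) ^ α = M ^ (-α) * N ^ (-α) := by
    rw [one_div, Real.inv_rpow (by positivity), Real.mul_rpow hMp.le hNp.le,
      Real.rpow_neg hMp.le, Real.rpow_neg hNp.le, mul_inv]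
  have e2 : (2 / N) ^ α = 2 ^ α * N ^ (-α) := by
    rw [Real.div_rpow (by norm_num) hNp.le, Real.rpow_neg hNp.le]; rfl
  have e3 : M ^ (2 - α) = M ^ 2 * M ^ (-α) := by
    rw [sub_eq_add_neg, Real.rpow_add hMp, Real.rpow_two]
  rw [e1] at h3
  rw [e2] at h2
  rw [div_le_iff₀ (by positivity), e3] at hM
  have h4 : Real.exp 1 / (4 * M ^ 2) * skD d α (2 / N) ≤ c / 2 * (M ^ (-α) * N ^ (-α)) := by
    calc _ ≤ Real.exp 1 / (4 * M ^ 2) * (C * (2 ^ α * N ^ (-α))) := by gcongr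
      _ = (Real.exp 1 / 4 * C * 2 ^ α) * (N ^ (-α) / M ^ 2) := by field_simp
      _ ≤ (M ^ 2 * M ^ (-α) * (c / 2)) * (N ^ (-α) / M ^ 2) := by gcongr
      _ = _ := by field_simp
  have h5 : c / 2 * (M ^ (-α) * N ^ (-α)) ≤ skP d α x * (κ * N ^ d) := by
    rw [hκ]
    rw [mul_pow] at h1
    linarith
  have e5 : N ^ (-((d : ℝ) + α)) = N ^ (-α) / N ^ d := by
    rw [neg_add, Real.rpow_add hNp, Real.rpow_neg hNp.le (d : ℝ), Real.rpow_natCast]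
    ring
  rw [e5]
  calc _ = c / 2 * (M ^ (-α) * N ^ (-α)) / (κ * N ^ d) := by field_simp
    _ ≤ _ := by rw [div_le_iff₀ (by positivity)]; exact h5

theorem skP_bounds (d : ℕ) (hd : 1 ≤ d) {α : ℝ} (hα1 : 1 < α) (hα2 : α < 2) :
    ∃ c C : ℝ, 0 < c ∧ 0 < C ∧ ∀ x : EuclideanSpace ℝ (Fin d), x ≠ 0 →
      c * min 1 (‖x‖ ^ (-((d : ℝ) + α))) ≤ skP d α x ∧
      skP d α x ≤ C * min 1 (‖x‖ ^ (-((d : ℝ) + α))) := by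
  have : Nonempty (Fin d) := ⟨⟨0, hd⟩⟩
  obtain ⟨C, hC, hu⟩ := skP_upper d hd hα1 hα2
  obtain ⟨c, hc, hl⟩ := skP_lower d hd hα1 hα2
  set I := ∫ ξ : EuclideanSpace ℝ (Fin d), Real.exp (-(‖ξ‖ ^ α))
  refine ⟨c, max C I, hc, lt_max_of_lt_left hC, fun x hx => ⟨?_, ?_⟩⟩
  · rcases le_total 1 ‖x‖ with h | h
    · refine le_trans ?_ (hl x h)
      gcongr
      exact min_le_right _ _
    · obtain ⟨z, hz⟩ := exists_norm_eq (EuclideanSpace ℝ (Fin d)) (c := 1) (by norm_num)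
      have h1 := hl z hz.ge
      have h2 := (skP_mon d hα1 hα2 x z (by rw [hz]; exact h)).2
      rw [hz, Real.one_rpow] at h1
      refine le_trans ?_ (h1.trans h2)
      gcongr
      exact min_le_left _ _
  · rw [mul_min_of_nonneg _ _ (by positivity)]
    apply le_min
    · rw [mul_one]
      exact (le_abs_self _).trans ((skP_le d hα1 x).trans (le_max_right _ _))
    · refine (hu x hx).trans ?_
      gcongr
      exact le_max_left _ _
theorem sk_stableP_eq (d : ℕ) {α t : ℝ} (hα1 : 1 < α) (ht : 0 < t)
    (x : EuclideanSpace ℝ (Fin d)) :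
    stableP d α t x = (2 * Real.pi) ^ (-(d : ℝ)) *
      (t ^ (-((d : ℝ) / α)) * skP d α ((t ^ (-(1 / α))) • x)) := by
  have hα0 : α ≠ 0 := by linarith
  set R := t ^ (-(1 / α)) with hR
  have hRp : 0 < R := by positivity
  have hRα : t * R ^ α = 1 := by
    rw [hR, ← Real.rpow_mul ht.le]
    have : -(1 / α) * α = -1 := by field_simp
    rw [this, Real.rpow_neg_one, mul_inv_cancel₀ ht.ne']
  have hRd : R ^ d = t ^ (-((d : ℝ) / α)) := by
    rw [hR, ← Real.rpow_natCast, ← Real.rpow_mul ht.le]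
    congr 1; ring
  have h := Measure.integral_comp_smul (volume : Measure (EuclideanSpace ℝ (Fin d)))
    (fun ξ => Complex.exp (-Complex.I * ((⟪ξ, x⟫ : ℝ) : ℂ)) *
        Complex.exp (-(t : ℂ) * ((‖ξ‖ ^ α : ℝ) : ℂ))) R
  rw [abs_of_nonneg (by positivity), finrank_euclideanSpace, Fintype.card_fin] at h
  have h' := congrArg (fun v => R ^ d • v) h
  beta_reduce at h'
  rw [smul_smul, mul_inv_cancel₀ (by positivity), one_smul] at h'
  have e1 : ∀ ζ : EuclideanSpace ℝ (Fin d),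
      Complex.exp (-Complex.I * ((⟪R • ζ, x⟫ : ℝ) : ℂ)) *
        Complex.exp (-(t : ℂ) * ((‖R • ζ‖ ^ α : ℝ) : ℂ))
      = Complex.exp (((-(‖ζ‖ ^ α) : ℝ) : ℂ) + ((-⟪ζ, R • x⟫ : ℝ) : ℂ) * Complex.I) := by
    intro ζ
    rw [norm_smul, Real.norm_eq_abs, abs_of_pos hRp, Real.mul_rpow hRp.le (norm_nonneg _),
      real_inner_smul_left, real_inner_smul_right, ← Complex.exp_add]
    congr 1
    have : (t : ℂ) * ((R ^ α : ℝ) : ℂ) = 1 := by exact_mod_cast hRα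
    push_cast at this ⊢
    linear_combination -((‖ζ‖ ^ α : ℝ) : ℂ) * this
  simp only [e1] at h'
  have hi : Integrable (fun ζ : EuclideanSpace ℝ (Fin d) =>
      Complex.exp (((-(‖ζ‖ ^ α) : ℝ) : ℂ) + ((-⟪ζ, R • x⟫ : ℝ) : ℂ) * Complex.I)) := by
    refine (sk_int_exp d hα1).mono' (Measurable.aestronglyMeasurable (by fun_prop)) ?_
    refine Filter.Eventually.of_forall fun ζ => ?_
    rw [Complex.norm_exp]
    apply le_of_eq; congr 1
    rw [Complex.add_re, Complex.re_ofReal_mul, Complex.I_re, Complex.ofReal_re]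
    ring
  have h3 := integral_re hi
  simp only [RCLike.re_to_complex] at h3
  rw [stableP, ← h', Complex.re_ofReal_mul, Complex.smul_re, ← h3, smul_eq_mul, hRd, skP]
  congr 3; ext ζ
  rw [Complex.exp_re, Complex.add_re, Complex.add_im, Complex.re_ofReal_mul,
    Complex.im_ofReal_mul, Complex.I_re, Complex.I_im, Complex.ofReal_re, Complex.ofReal_im,
    mul_zero, add_zero, mul_one, zero_add, Real.cos_neg, mul_comm]

theorem sk_stableP_meas (d : ℕ) (α : ℝ) (x : EuclideanSpace ℝ (Fin d)) :
    Measurable (fun t => stableP d α t x) := by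
  unfold stableP
  apply Complex.measurable_re.comp
  apply Measurable.const_mul
  apply StronglyMeasurable.measurable
  apply StronglyMeasurable.integral_prod_right'
    (f := fun z : ℝ × EuclideanSpace ℝ (Fin d) =>
      Complex.exp (-Complex.I * ((⟪z.2, x⟫ : ℝ) : ℂ)) *
        Complex.exp (-(z.1 : ℂ) * ((‖z.2‖ ^ α : ℝ) : ℂ)))
  apply Measurable.stronglyMeasurable
  fun_prop

theorem sk_stableP_bounds (d : ℕ) (hd : 1 ≤ d) {α : ℝ} (hα1 : 1 < α) (hα2 : α < 2) :
    ∃ c C : ℝ, 0 < c ∧ 0 < C ∧ ∀ x : EuclideanSpace ℝ (Fin d), x ≠ 0 → ∀ t, 0 < t →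
      c * min (t ^ (-((d : ℝ) / α))) (t * ‖x‖ ^ (-((d : ℝ) + α))) ≤ stableP d α t x ∧
      stableP d α t x ≤ C * min (t ^ (-((d : ℝ) / α))) (t * ‖x‖ ^ (-((d : ℝ) + α))) := by
  obtain ⟨c, C, hc, hC, h⟩ := skP_bounds d hd hα1 hα2
  have hα0 : α ≠ 0 := by linarith
  refine ⟨(2 * Real.pi) ^ (-(d : ℝ)) * c, (2 * Real.pi) ^ (-(d : ℝ)) * C, by positivity,
    by positivity, fun x hx t ht => ?_⟩
  have hR : 0 < t ^ (-(1 / α)) := by positivity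
  have h1 := h (t ^ (-(1 / α)) • x) (smul_ne_zero hR.ne' hx)
  rw [norm_smul, Real.norm_eq_abs, abs_of_pos hR, Real.mul_rpow hR.le (norm_nonneg _)] at h1
  have e : t ^ (-((d : ℝ) / α)) *
      min 1 ((t ^ (-(1 / α))) ^ (-((d : ℝ) + α)) * ‖x‖ ^ (-((d : ℝ) + α)))
      = min (t ^ (-((d : ℝ) / α))) (t * ‖x‖ ^ (-((d : ℝ) + α))) := by
    rw [mul_min_of_nonneg _ _ (by positivity), mul_one, ← mul_assoc, ← Real.rpow_mul ht.le,
      ← Real.rpow_add ht]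
    congr 2
    have : -((d : ℝ) / α) + -(1 / α) * -((d : ℝ) + α) = 1 := by field_simp; ring
    rw [this, Real.rpow_one]
  rw [sk_stableP_eq d hα1 ht, ← e]
  constructor
  · calc _ = (2 * Real.pi) ^ (-(d : ℝ)) * (t ^ (-((d : ℝ) / α)) * (c *
        min 1 ((t ^ (-(1 / α))) ^ (-((d : ℝ) + α)) * ‖x‖ ^ (-((d : ℝ) + α))))) := by ring
      _ ≤ _ := by
        have := h1.1
        gcongr
  · calc _ ≤ (2 * Real.pi) ^ (-(d : ℝ)) * (t ^ (-((d : ℝ) / α)) * (C *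
        min 1 ((t ^ (-(1 / α))) ^ (-((d : ℝ) + α)) * ‖x‖ ^ (-((d : ℝ) + α))))) := by
          have := h1.2
          gcongr
      _ = _ := by ring

theorem sk_cross_le {D α t N : ℝ} (hD : 0 < D) (hα : 0 < α) (ht : 0 < t) (hN : 0 < N)
    (h : t ≤ N ^ α) : t * N ^ (-(D + α)) ≤ t ^ (-(D / α)) := by
  have h1 : t ^ (1 / α) ≤ N := by
    have := Real.rpow_le_rpow ht.le h (by positivity : 0 ≤ 1 / α)
    rwa [← Real.rpow_mul hN.le, mul_one_div_cancel hα.ne', Real.rpow_one] at this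
  calc _ ≤ t * (t ^ (1 / α)) ^ (-(D + α)) := by
        apply mul_le_mul_of_nonneg_left _ ht.le
        exact Real.rpow_le_rpow_of_nonpos (by positivity) h1 (by linarith)
    _ = t ^ (1 : ℝ) * t ^ (1 / α * -(D + α)) := by rw [Real.rpow_one, ← Real.rpow_mul ht.le]
    _ = _ := by
      rw [← Real.rpow_add ht]; congr 1; field_simp; ring

theorem sk_cross_ge {D α t N : ℝ} (hD : 0 < D) (hα : 0 < α) (ht : 0 < t) (hN : 0 < N)
    (h : N ^ α ≤ t) : t ^ (-(D / α)) ≤ t * N ^ (-(D + α)) := by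
  have h1 : N ≤ t ^ (1 / α) := by
    have := Real.rpow_le_rpow (by positivity) h (by positivity : 0 ≤ 1 / α)
    rwa [← Real.rpow_mul hN.le, mul_one_div_cancel hα.ne', Real.rpow_one] at this
  calc _ = t ^ (1 : ℝ) * t ^ (1 / α * -(D + α)) := by
        rw [← Real.rpow_add ht]; congr 1; field_simp; ring
    _ = t * (t ^ (1 / α)) ^ (-(D + α)) := by rw [Real.rpow_one, ← Real.rpow_mul ht.le]
    _ ≤ _ := by
        apply mul_le_mul_of_nonneg_left _ ht.le
        exact Real.rpow_le_rpow_of_nonpos hN h1 (by linarith)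

theorem sk_Ioc_le {f : ℝ → ℝ} (hf : IntegrableOn f (Set.Ioi 0)) (h0 : ∀ t, 0 < t → 0 ≤ f t)
    {a m : ℝ} (ha : 0 < a) (hm : ∀ t, a < t → t ≤ 2 * a → m ≤ f t) :
    a * m ≤ ∫ t in Set.Ioi 0, f t := by
  have hsub : Set.Ioc a (2 * a) ⊆ Set.Ioi 0 := fun t ht => ha.trans ht.1
  calc a * m = ∫ t in Set.Ioc a (2 * a), m := by
        rw [setIntegral_const, smul_eq_mul, Measure.real, Real.volume_Ioc,
          ENNReal.toReal_ofReal (by linarith)]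
        ring
    _ ≤ ∫ t in Set.Ioc a (2 * a), f t := by
        apply setIntegral_mono_on _ (hf.mono_set hsub) measurableSet_Ioc
        · exact fun t ht => hm t ht.1 ht.2
        · exact integrableOn_const measure_Ioc_lt_top.ne
    _ ≤ _ := by
        apply setIntegral_mono_set hf
        · exact (ae_restrict_iff' measurableSet_Ioi).2 (Filter.Eventually.of_forall h0)
        · exact hsub.eventuallyLE

theorem sk_int_te {a l : ℝ} (ha : -1 < a) (hl : 0 < l) :
    IntegrableOn (fun t : ℝ => t ^ a * Real.exp (-(l * t))) (Set.Ioi 0) := by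
  have := integrableOn_rpow_mul_exp_neg_mul_rpow (p := 1) ha one_pos hl
  simpa only [Real.rpow_one, neg_mul] using this

theorem sk_res_lower {D α c l N : ℝ} (hD : 0 < D) (hα : 0 < α) (hc : 0 < c) (hl : 0 < l)
    (hN : 0 < N) {p : ℝ → ℝ}
    (hf : IntegrableOn (fun t => Real.exp (-(l * t)) * p t) (Set.Ioi 0))
    (hp : ∀ t, 0 < t → c * min (t ^ (-(D / α))) (t * N ^ (-(D + α))) ≤ p t) :
    c * Real.exp (-2) * 2 ^ (-(D / α)) / 4 *
      min (max (l ^ ((D - α) / α)) (N ^ (α - D))) (l ^ (-(2 : ℝ)) * N ^ (-(D + α))) ≤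
    ∫ t in Set.Ioi 0, Real.exp (-(l * t)) * p t := by
  have hf0 : ∀ t, 0 < t → 0 ≤ Real.exp (-(l * t)) * p t := by
    intro t ht
    apply mul_nonneg (Real.exp_pos _).le
    refine le_trans ?_ (hp t ht)
    positivity
  have h2 : (2 : ℝ) ^ (-(D / α)) ≤ 1 :=
    Real.rpow_le_one_of_one_le_of_nonpos (by norm_num) (by
      have : 0 < D / α := by positivity
      linarith)
  have h12 : Real.exp (-2) ≤ Real.exp (-1) := Real.exp_le_exp.2 (by norm_num)
  have hk1 : c * Real.exp (-2) * 2 ^ (-(D / α)) / 4 ≤ c * Real.exp (-1) / 4 := by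
    calc _ ≤ c * Real.exp (-1) * 1 / 4 := by gcongr
      _ = _ := by ring
  have hT : 0 < N ^ α := by positivity
  rcases le_total 1 (l * N ^ α) with h | h
  · have hlT : 1 / l ≤ N ^ α := by rw [div_le_iff₀ hl]; linarith
    have := sk_Ioc_le hf hf0 (a := 1 / (2 * l))
      (m := Real.exp (-1) * (c * (1 / (2 * l) * N ^ (-(D + α))))) (by positivity) ?_
    · refine le_trans ?_ this
      calc _ ≤ c * Real.exp (-1) / 4 * (l ^ (-(2 : ℝ)) * N ^ (-(D + α))) := by
            gcongr
            exact min_le_right _ _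
        _ = _ := by rw [Real.rpow_neg hl.le, Real.rpow_two]; field_simp; norm_num
    · intro t h1 h3
      have ht : 0 < t := lt_trans (by positivity) h1
      have h4 : 2 * (1 / (2 * l)) = 1 / l := by field_simp
      rw [h4] at h3
      have h5 := sk_cross_le hD hα ht hN (h3.trans hlT)
      have h6 := hp t ht
      rw [min_eq_right h5] at h6
      have h7 : l * t ≤ 1 := by rw [le_div_iff₀ hl] at h3; linarith
      have h8 : Real.exp (-1) ≤ Real.exp (-(l * t)) := Real.exp_le_exp.2 (by linarith)
      have h9 : c * (1 / (2 * l) * N ^ (-(D + α))) ≤ p t := by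
        refine le_trans ?_ h6
        gcongr
      gcongr
  · have hlT : N ^ α ≤ 1 / l := by rw [le_div_iff₀ hl]; linarith
    have hA : c * Real.exp (-2) * 2 ^ (-(D / α)) / 4 * l ^ ((D - α) / α) ≤
        ∫ t in Set.Ioi 0, Real.exp (-(l * t)) * p t := by
      have := sk_Ioc_le hf hf0 (a := 1 / l)
        (m := Real.exp (-2) * (c * (2 * (1 / l)) ^ (-(D / α)))) (by positivity) ?_
      · refine le_trans ?_ this
        have e : (2 * (1 / l)) ^ (-(D / α)) = 2 ^ (-(D / α)) * (l ^ ((D - α) / α) * l) := by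
          rw [Real.mul_rpow (by norm_num) (by positivity), one_div, Real.inv_rpow hl.le,
            Real.rpow_neg hl.le, inv_inv]
          congr 1
          have e0 : D / α = (D - α) / α + 1 := by field_simp; ring
          rw [e0, Real.rpow_add_one hl.ne']
        rw [e]
        have hq : 0 ≤ c * Real.exp (-2) * 2 ^ (-(D / α)) * l ^ ((D - α) / α) := by positivity
        calc _ ≤ c * Real.exp (-2) * 2 ^ (-(D / α)) * l ^ ((D - α) / α) := by linarith
          _ = _ := by field_simp
      · intro t h1 h3
        have ht : 0 < t := lt_trans (by positivity) h1
        have h5 := sk_cross_ge hD hα ht hN (hlT.trans h1.le)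
        have h6 := hp t ht
        rw [min_eq_left h5] at h6
        have h7 : l * t ≤ 2 := by
          have := mul_le_mul_of_nonneg_left h3 hl.le
          have e : l * (2 * (1 / l)) = 2 := by field_simp
          linarith
        have h8 : Real.exp (-2) ≤ Real.exp (-(l * t)) := Real.exp_le_exp.2 (by linarith)
        have h9 : c * (2 * (1 / l)) ^ (-(D / α)) ≤ p t := by
          refine le_trans ?_ h6
          apply mul_le_mul_of_nonneg_left _ hc.le
          apply Real.rpow_le_rpow_of_nonpos ht h3
          have : 0 < D / α := by positivity
          linarith
        gcongr
    have hB : c * Real.exp (-2) * 2 ^ (-(D / α)) / 4 * N ^ (α - D) ≤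
        ∫ t in Set.Ioi 0, Real.exp (-(l * t)) * p t := by
      have := sk_Ioc_le hf hf0 (a := N ^ α / 2)
        (m := Real.exp (-1) * (c * (N ^ α / 2 * N ^ (-(D + α))))) (by positivity) ?_
      · refine le_trans ?_ this
        have e : N ^ (α - D) = N ^ α * (N ^ α * N ^ (-(D + α))) := by
          rw [← Real.rpow_add hN, ← Real.rpow_add hN]; congr 1; ring
        calc _ ≤ c * Real.exp (-1) / 4 * N ^ (α - D) := by gcongr
          _ = _ := by rw [e]; ring
      · intro t h1 h3
        have ht : 0 < t := lt_trans (by positivity) h1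
        have h4 : 2 * (N ^ α / 2) = N ^ α := by ring
        rw [h4] at h3
        have h5 := sk_cross_le hD hα ht hN h3
        have h6 := hp t ht
        rw [min_eq_right h5] at h6
        have h7 : l * t ≤ 1 := by
          have := mul_le_mul_of_nonneg_left h3 hl.le
          linarith
        have h8 : Real.exp (-1) ≤ Real.exp (-(l * t)) := Real.exp_le_exp.2 (by linarith)
        have h9 : c * (N ^ α / 2 * N ^ (-(D + α))) ≤ p t := by
          refine le_trans ?_ h6
          gcongr
        gcongr
    refine le_trans (mul_le_mul_of_nonneg_left (min_le_left _ _) (by positivity)) ?_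
    rw [mul_max_of_nonneg _ _ (by positivity)]
    exact max_le hA hB

theorem sk_res_upper {D α C : ℝ} (hD : 0 < D) (hα : 0 < α) (hDα : D ≠ α) (hC : 0 < C) :
    ∃ K : ℝ, 0 < K ∧ ∀ l N : ℝ, 0 < l → 0 < N → ∀ p : ℝ → ℝ,
    IntegrableOn (fun t => Real.exp (-(l * t)) * p t) (Set.Ioi 0) →
    (∀ t, 0 < t → p t ≤ C * min (t ^ (-(D / α))) (t * N ^ (-(D + α)))) →
    ∫ t in Set.Ioi 0, Real.exp (-(l * t)) * p t ≤
      K * min (max (l ^ ((D - α) / α)) (N ^ (α - D))) (l ^ (-(2 : ℝ)) * N ^ (-(D + α))) := by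
  have U1 : ∀ l N : ℝ, 0 < l → 0 < N → ∀ p : ℝ → ℝ,
    IntegrableOn (fun t => Real.exp (-(l * t)) * p t) (Set.Ioi 0) →
    (∀ t, 0 < t → p t ≤ C * min (t ^ (-(D / α))) (t * N ^ (-(D + α)))) →
    ∫ t in Set.Ioi 0, Real.exp (-(l * t)) * p t ≤ C * (l ^ (-(2 : ℝ)) * N ^ (-(D + α))) := by
    intro l N hl hN p hf hp
    have hG := Real.integral_rpow_mul_exp_neg_mul_Ioi (a := 2) (r := l) (by norm_num) hl
    have hi := sk_int_te (a := 2 - 1) (by norm_num) hl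
    calc _ ≤ ∫ t in Set.Ioi 0, (C * N ^ (-(D + α))) * (t ^ ((2 : ℝ) - 1) * Real.exp (-(l * t))) := by
          apply setIntegral_mono_on hf (hi.const_mul _) measurableSet_Ioi
          intro t ht
          have ht : 0 < t := ht
          have e : (2 : ℝ) - 1 = 1 := by norm_num
          rw [e, Real.rpow_one]
          calc _ ≤ Real.exp (-(l * t)) * (C * (t * N ^ (-(D + α)))) := by
                gcongr
                refine (hp t ht).trans ?_
                gcongr
                exact min_le_right _ _
            _ = _ := by ring
      _ = _ := by
        rw [integral_const_mul, hG, Real.Gamma_two, one_div, Real.inv_rpow hl.le,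
          Real.rpow_neg hl.le]
        ring
  have U2 : ∃ K : ℝ, 0 < K ∧ ∀ l N : ℝ, 0 < l → 0 < N → ∀ p : ℝ → ℝ,
    IntegrableOn (fun t => Real.exp (-(l * t)) * p t) (Set.Ioi 0) →
    (∀ t, 0 < t → p t ≤ C * min (t ^ (-(D / α))) (t * N ^ (-(D + α)))) →
    ∫ t in Set.Ioi 0, Real.exp (-(l * t)) * p t ≤
      K * max (l ^ ((D - α) / α)) (N ^ (α - D)) := by
    rcases lt_or_gt_of_ne hDα with h | h
    · have h1 : D / α < 1 := by rw [div_lt_one hα]; exact h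
      have hg : 0 < Real.Gamma (1 - D / α) := Real.Gamma_pos_of_pos (by linarith)
      refine ⟨C * Real.Gamma (1 - D / α), by positivity, fun l N hl hN p hf hp => ?_⟩
      have hG := Real.integral_rpow_mul_exp_neg_mul_Ioi (a := 1 - D / α) (r := l)
        (by linarith) hl
      have hi := sk_int_te (a := 1 - D / α - 1) (by linarith) hl
      calc _ ≤ ∫ t in Set.Ioi 0, C * (t ^ (1 - D / α - 1) * Real.exp (-(l * t))) := by
            apply setIntegral_mono_on hf (hi.const_mul _) measurableSet_Ioi
            intro t ht
            have ht : 0 < t := ht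
            have e : 1 - D / α - 1 = -(D / α) := by ring
            rw [e]
            calc _ ≤ Real.exp (-(l * t)) * (C * t ^ (-(D / α))) := by
                  gcongr
                  refine (hp t ht).trans ?_
                  gcongr
                  exact min_le_left _ _
              _ = _ := by ring
        _ = C * Real.Gamma (1 - D / α) * l ^ ((D - α) / α) := by
          rw [integral_const_mul, hG, one_div, Real.inv_rpow hl.le, ← Real.rpow_neg hl.le]
          have e : -(1 - D / α) = (D - α) / α := by field_simp; ring
          rw [e]; ring
        _ ≤ _ := by gcongr; exact le_max_left _ _
    · have h1 : 1 < D / α := by rw [one_lt_div hα]; exact h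
      have h1' : 0 < D / α - 1 := by linarith
      refine ⟨C * (1 + 1 / (D / α - 1)), by positivity, fun l N hl hN p hf hp => ?_⟩
      have hT : 0 < N ^ α := by positivity
      have hle : ∀ t, 0 < t → Real.exp (-(l * t)) ≤ 1 := fun t ht =>
        Real.exp_le_one_iff.2 (by have := mul_pos hl ht; linarith)
      have hu : Set.Ioi (0 : ℝ) = Set.Ioc 0 (N ^ α) ∪ Set.Ioi (N ^ α) :=
        (Set.Ioc_union_Ioi_eq_Ioi hT.le).symm
      have hf1 : IntegrableOn (fun t => Real.exp (-(l * t)) * p t) (Set.Ioc 0 (N ^ α)) :=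
        hf.mono_set (by rw [hu]; exact Set.subset_union_left)
      have hf2 : IntegrableOn (fun t => Real.exp (-(l * t)) * p t) (Set.Ioi (N ^ α)) :=
        hf.mono_set (by rw [hu]; exact Set.subset_union_right)
      rw [hu, setIntegral_union (Set.Ioc_disjoint_Ioi le_rfl) measurableSet_Ioi hf1 hf2]
      have I1 : ∫ t in Set.Ioc 0 (N ^ α), Real.exp (-(l * t)) * p t ≤ C * N ^ (α - D) := by
        calc _ ≤ ∫ t in Set.Ioc 0 (N ^ α), C * (N ^ α * N ^ (-(D + α))) := by
              apply setIntegral_mono_on hf1 (integrableOn_const measure_Ioc_lt_top.ne)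
                measurableSet_Ioc
              intro t ht
              have h3 := ht.2
              have h4 : 0 < t := ht.1
              calc _ ≤ Real.exp (-(l * t)) * (C * (t * N ^ (-(D + α)))) := by
                    gcongr
                    refine (hp t h4).trans ?_
                    gcongr
                    exact min_le_right _ _
                _ ≤ 1 * (C * (N ^ α * N ^ (-(D + α)))) := by
                    gcongr
                    exact hle t h4
                _ = _ := one_mul _
          _ = _ := by
            rw [setIntegral_const, smul_eq_mul, Measure.real, Real.volume_Ioc,
              ENNReal.toReal_ofReal (by linarith)]
            have e : N ^ (α - D) = N ^ α * (N ^ α * N ^ (-(D + α))) := by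
              rw [← Real.rpow_add hN, ← Real.rpow_add hN]; congr 1; ring
            rw [e]; ring
      have I2 : ∫ t in Set.Ioi (N ^ α), Real.exp (-(l * t)) * p t
          ≤ C * (1 / (D / α - 1) * N ^ (α - D)) := by
        have hi : IntegrableOn (fun t : ℝ => t ^ (-(D / α))) (Set.Ioi (N ^ α)) :=
          integrableOn_Ioi_rpow_of_lt (by linarith) hT
        calc _ ≤ ∫ t in Set.Ioi (N ^ α), C * t ^ (-(D / α)) := by
              apply setIntegral_mono_on hf2 (hi.const_mul _) measurableSet_Ioi
              intro t ht
              have h4 : 0 < t := hT.trans ht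
              calc _ ≤ Real.exp (-(l * t)) * (C * t ^ (-(D / α))) := by
                    gcongr
                    refine (hp t h4).trans ?_
                    gcongr
                    exact min_le_left _ _
                _ ≤ 1 * (C * t ^ (-(D / α))) := by
                    gcongr
                    exact hle t h4
                _ = _ := one_mul _
          _ = _ := by
            rw [integral_const_mul, integral_Ioi_rpow_of_lt (by linarith) hT,
              ← Real.rpow_mul hN.le]
            have e : α * (-(D / α) + 1) = α - D := by field_simp; ring
            rw [e]
            have e2 : -(D / α) + 1 = -(D / α - 1) := by ring
            rw [e2, neg_div_neg_eq]
            ring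
      calc _ ≤ C * (1 + 1 / (D / α - 1)) * N ^ (α - D) := by linarith
        _ ≤ _ := by gcongr; exact le_max_right _ _
  obtain ⟨K, hK, U2⟩ := U2
  refine ⟨max C K, lt_max_of_lt_left hC, fun l N hl hN p hf hp => ?_⟩
  rw [mul_min_of_nonneg _ _ (by positivity)]
  apply le_min
  · refine (U2 l N hl hN p hf hp).trans ?_
    gcongr
    exact le_max_right _ _
  · refine (U1 l N hl hN p hf hp).trans ?_
    gcongr
    exact le_max_left _ _

/-- two-sided estimates for the resolvent kernel:
`r_λ(x) ≍ (λ^{(d-α)/α} ∨ |x|^{α-d}) ∧ λ^{-2}|x|^{-(d+α)}` for `λ > 0`, `x ≠ 0`. -/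
theorem stmt4 (d : ℕ) (hd : 1 ≤ d) (α : ℝ) (hα1 : 1 < α) (hα2 : α < 2) :
    ∃ c : ℝ, 1 ≤ c ∧ ∀ l : ℝ, 0 < l → ∀ x : EuclideanSpace ℝ (Fin d), x ≠ 0 →
      c⁻¹ * min (max (l ^ (((d : ℝ) - α) / α)) (‖x‖ ^ (α - (d : ℝ))))
          (l ^ (-(2 : ℝ)) * ‖x‖ ^ (-((d : ℝ) + α))) ≤ resKer d α l x ∧
      resKer d α l x ≤ c * min (max (l ^ (((d : ℝ) - α) / α)) (‖x‖ ^ (α - (d : ℝ))))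
          (l ^ (-(2 : ℝ)) * ‖x‖ ^ (-((d : ℝ) + α))) := by
  have hD : (0 : ℝ) < d := by exact_mod_cast hd
  have hα : 0 < α := by linarith
  have hDα : (d : ℝ) ≠ α := by
    intro h
    rw [← h] at hα1 hα2
    have h1 : 1 < d := by exact_mod_cast hα1
    have h2 : d < 2 := by exact_mod_cast hα2
    omega
  obtain ⟨c, C, hc, hC, hb⟩ := sk_stableP_bounds d hd hα1 hα2
  obtain ⟨K, hK, hup⟩ := sk_res_upper hD hα hDα hC
  set k := c * Real.exp (-2) * 2 ^ (-((d : ℝ) / α)) / 4 with hk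
  have hkp : 0 < k := by positivity
  refine ⟨max 1 (max K k⁻¹), le_max_left _ _, fun l hl x hx => ?_⟩
  have hN : 0 < ‖x‖ := norm_pos_iff.2 hx
  have hf : IntegrableOn (fun t => Real.exp (-(l * t)) * stableP d α t x) (Set.Ioi 0) := by
    have hi := (sk_int_te (a := 1) (by norm_num) hl).const_mul (C * ‖x‖ ^ (-((d : ℝ) + α)))
    have hm := sk_stableP_meas d α x
    refine hi.mono' (Measurable.aestronglyMeasurable (by fun_prop)) ?_
    refine (ae_restrict_iff' measurableSet_Ioi).2 (Filter.Eventually.of_forall fun t ht => ?_)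
    have ht : 0 < t := ht
    obtain ⟨h1, h2⟩ := hb x hx t ht
    have h0 : 0 ≤ stableP d α t x := le_trans (by positivity) h1
    rw [Real.norm_eq_abs, abs_of_nonneg (by positivity), Real.rpow_one]
    calc _ ≤ Real.exp (-(l * t)) * (C * (t * ‖x‖ ^ (-((d : ℝ) + α)))) := by
          gcongr
          refine h2.trans ?_
          gcongr
          exact min_le_right _ _
      _ = _ := by ring
  have hlow := sk_res_lower hD hα hc hl hN hf (fun t ht => (hb x hx t ht).1)
  have hupp := hup l ‖x‖ hl hN (fun t => stableP d α t x) hf (fun t ht => (hb x hx t ht).2)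
  constructor
  · refine le_trans ?_ hlow
    rw [← hk]
    gcongr
    apply inv_le_of_inv_le₀ hkp
    exact (le_max_right _ _).trans (le_max_right _ _)
  · refine le_trans hupp ?_
    gcongr
    exact (le_max_left _ _).trans (le_max_right _ _)
end
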